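/- Let Ω ⊂ ℝ² be a smooth bounded strictly star-shaped domain, g : ∂Ω → Γ smooth of degree d, and let u_ε solve Δu_ε = ε⁻²∇W(u_ε) in Ω with u_ε = g on ∂Ω. Then there is a constant C, independent of ε, such that E_ε(u_ε) = ∫_Ω [½|∇u_ε|² + W(u_ε)/ε²] ≤ C(|log ε| + 1) for all ε > 0. -/

import Mathlib

open Complex Metric MeasureTheory Filter Set Topology Bornology

noncomputable section

/-- The Laplacian of a map `u : ℂ → ℂ`, viewing `ℂ ≅ ℝ²`. -/
def lapC (u : ℂ → ℂ) (x : ℂ) : ℂ :=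
  fderiv ℝ (fun y => fderiv ℝ u y 1) x 1 +
    fderiv ℝ (fun y => fderiv ℝ u y Complex.I) x Complex.I

/-- The Laplacian of a function `h : ℂ → ℝ`. -/
def lapR (h : ℂ → ℝ) (x : ℂ) : ℝ :=
  fderiv ℝ (fun y => fderiv ℝ h y 1) x 1 +
    fderiv ℝ (fun y => fderiv ℝ h y Complex.I) x Complex.I

/-- `|∇u|²` for `u : ℂ → ℂ`. -/
def gradSq (u : ℂ → ℂ) (x : ℂ) : ℝ :=
  ‖fderiv ℝ u x 1‖ ^ 2 + ‖fderiv ℝ u x Complex.I‖ ^ 2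

/-- The gradient `∇W` of a potential `W : ℂ → ℝ`, as a point of `ℂ ≅ ℝ²`. -/
def gradW (W : ℂ → ℝ) (x : ℂ) : ℂ :=
  (fderiv ℝ W x 1 : ℂ) + (fderiv ℝ W x Complex.I : ℂ) * Complex.I

/-- The Ginzburg–Landau type energy `E_ε(u) = ∫_Ω [½|∇u|² + W(u)/ε²]`. -/
def energy (W : ℂ → ℝ) (Ω : Set ℂ) (ε : ℝ) (u : ℂ → ℂ) : ℝ :=
  ∫ x in Ω, ((1 / 2) * gradSq u x + W (u x) / ε ^ 2)

/-- `Γ` is a smooth simple closed curve of length `2π`, with (`2π`-periodic) arclength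
parametrization `τ` (so that the point `τ(e^{is})` of the paper is `τ s` here). -/
structure ArcParam (Γ : Set ℂ) (τ : ℝ → ℂ) : Prop where
  smooth : ContDiff ℝ (⊤ : ℕ∞) τ
  periodic : Function.Periodic τ (2 * Real.pi)
  arclength : ∀ s, ‖deriv τ s‖ = 1
  inj : ∀ s t : ℝ, τ s = τ t → ∃ k : ℤ, s - t = 2 * Real.pi * k
  srange : Set.range τ = Γ

/-- The hypotheses (h1)–(h5) on the potential `W`: smooth, nonnegative, vanishing exactly
on `Γ`, non-degenerate near `Γ`, and radially coercive outside `B_{R₀} ⊇ Γ`. -/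
structure PotentialHyp (Γ : Set ℂ) (W : ℂ → ℝ) (R₀ : ℝ) : Prop where
  smooth : ContDiff ℝ (⊤ : ℕ∞) W
  nonneg : ∀ z, 0 ≤ W z
  zeros : W ⁻¹' {0} = Γ
  nondeg : ∃ μ > 0, ∃ δ > 0, ∀ z : ℂ,
    Metric.infDist z Γ < δ → μ * Metric.infDist z Γ ^ 2 ≤ W z
  R0_large : ∀ z ∈ Γ, ‖z‖ < R₀
  coercive : ∀ z : ℂ, R₀ < ‖z‖ →
    0 ≤ (gradW W z).re * z.re + (gradW W z).im * z.im

/-- `u` is a (globally smooth) solution of `Δu = ε⁻² ∇W(u)` in `Ω`. -/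
def SolvesGL (W : ℂ → ℝ) (Ω : Set ℂ) (ε : ℝ) (u : ℂ → ℂ) : Prop :=
  ContDiff ℝ (⊤ : ℕ∞) u ∧ ∀ x ∈ Ω, lapC u x = (ε ^ 2)⁻¹ • gradW W (u x)

/-- The decomposition `u = τ(e^{iφ}) + t·n⃗(τ(e^{iφ}))` on the set `s`, where `t` is the
signed distance of `u` to `Γ` and `φ` is a (global) phase; the unit normal to `Γ` at `τ s`
is `i·τ'(s)`. -/
def PhaseDecomp (Γ : Set ℂ) (τ : ℝ → ℂ) (s : Set ℂ) (u : ℂ → ℂ) (t φ : ℂ → ℝ) : Prop :=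
  ContinuousOn t s ∧ ContinuousOn φ s ∧
    ∀ x ∈ s, u x = τ (φ x) + (t x : ℂ) * (Complex.I * deriv τ (φ x)) ∧
      |t x| = Metric.infDist (u x) Γ

/-- `γ` is an `L`-periodic arclength parametrization of the (smooth) boundary of `Ω`. -/
structure BoundaryParam (Ω : Set ℂ) (γ : ℝ → ℂ) (L : ℝ) : Prop where
  Lpos : 0 < L
  smooth : ContDiff ℝ (⊤ : ℕ∞) γ
  periodic : Function.Periodic γ L
  arclength : ∀ s, ‖deriv γ s‖ = 1
  inj : ∀ s t : ℝ, γ s = γ t → ∃ k : ℤ, s - t = L * k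
  srange : Set.range γ = frontier Ω

/-- `n` is the outward unit normal field along the boundary parametrization `γ` of `Ω`. -/
structure OutwardNormal (Ω : Set ℂ) (γ : ℝ → ℂ) (n : ℝ → ℂ) : Prop where
  unit : ∀ s, ‖n s‖ = 1
  orth : ∀ s, (n s).re * (deriv γ s).re + (n s).im * (deriv γ s).im = 0
  outward : ∀ s, ∀ᶠ r in nhdsWithin (0 : ℝ) (Set.Ioi (0 : ℝ)), γ s + Complex.ofReal r * n s ∉ closure Ω

/-- The maximum principle for the phase (Proposition 2.2) holds with constants `δ₁`, `m`:
for every critical point `u` of `E_ε` on a bounded simply connected domain `ω`, continuous on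
`closure ω` and with `dist(u,Γ) ≤ δ₁` there, the functions `φ ∓ m t²/2` attain their
min/max on `∂ω`. -/
def MaxPrinciple (Γ : Set ℂ) (τ : ℝ → ℂ) (W : ℂ → ℝ) (δ₁ m : ℝ) : Prop :=
  ∀ (ω : Set ℂ) (ε : ℝ) (u : ℂ → ℂ) (t φ : ℂ → ℝ),
    IsOpen ω → Bornology.IsBounded ω → ω.Nonempty → SimplyConnectedSpace ↥ω →
    0 < ε → ContDiffOn ℝ (⊤ : ℕ∞) u ω → ContinuousOn u (closure ω) →
    (∀ x ∈ ω, lapC u x = (ε ^ 2)⁻¹ • gradW W (u x)) →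
    (∀ x ∈ closure ω, Metric.infDist (u x) Γ ≤ δ₁) →
    PhaseDecomp Γ τ (closure ω) u t φ →
    sInf ((fun x => φ x - m * t x ^ 2 / 2) '' closure ω) =
        sInf ((fun x => φ x - m * t x ^ 2 / 2) '' frontier ω) ∧
      sSup ((fun x => φ x + m * t x ^ 2 / 2) '' closure ω) =
        sSup ((fun x => φ x + m * t x ^ 2 / 2) '' frontier ω)

/-- The partial derivative `∂f/∂x` of a function on `ℂ ≅ ℝ²`. -/
def dx (f : ℂ → ℝ) (z : ℂ) : ℝ := fderiv ℝ f z 1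

/-- The partial derivative `∂f/∂y` of a function on `ℂ ≅ ℝ²`. -/
def dy (f : ℂ → ℝ) (z : ℂ) : ℝ := fderiv ℝ f z Complex.I

/-- Smooth real functions on `ℂ ≅ ℝ²`. -/
abbrev Smooth (f : ℂ → ℝ) : Prop := ContDiff ℝ (⊤ : ℕ∞) f

theorem Smooth.differentiable' {f : ℂ → ℝ} (hf : Smooth f) : Differentiable ℝ f :=
  hf.differentiable (by simp)

theorem Smooth.diffAt {f : ℂ → ℝ} (hf : Smooth f) (z : ℂ) : DifferentiableAt ℝ f z :=
  hf.differentiable' z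

theorem Smooth.fderiv_dir {f : ℂ → ℝ} (hf : Smooth f) (v : ℂ) :
    Smooth (fun z => fderiv ℝ f z v) :=
  (hf.fderiv_right (m := (⊤ : ℕ∞)) (by simp)).clm_apply contDiff_const

theorem Smooth.dx {f : ℂ → ℝ} (hf : Smooth f) : Smooth (dx f) := hf.fderiv_dir 1

theorem Smooth.dy {f : ℂ → ℝ} (hf : Smooth f) : Smooth (dy f) := hf.fderiv_dir Complex.I

@[fun_prop]
theorem contDiff_dx {f : ℂ → ℝ} (hf : ContDiff ℝ (⊤ : ℕ∞) f) : ContDiff ℝ (⊤ : ℕ∞) (dx f) :=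
  Smooth.dx hf

@[fun_prop]
theorem contDiff_dy {f : ℂ → ℝ} (hf : ContDiff ℝ (⊤ : ℕ∞) f) : ContDiff ℝ (⊤ : ℕ∞) (dy f) :=
  Smooth.dy hf

@[fun_prop]
theorem contDiff_complex_re : ContDiff ℝ (⊤ : ℕ∞) Complex.re := Complex.reCLM.contDiff

@[fun_prop]
theorem contDiff_complex_im : ContDiff ℝ (⊤ : ℕ∞) Complex.im := Complex.imCLM.contDiff

theorem smooth_re : Smooth Complex.re := Complex.reCLM.contDiff

theorem smooth_im : Smooth Complex.im := Complex.imCLM.contDiff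

theorem smooth_re_comp {u : ℂ → ℂ} (hu : ContDiff ℝ (⊤ : ℕ∞) u) : Smooth fun z => (u z).re :=
  Complex.reCLM.contDiff.comp hu

theorem smooth_im_comp {u : ℂ → ℂ} (hu : ContDiff ℝ (⊤ : ℕ∞) u) : Smooth fun z => (u z).im :=
  Complex.imCLM.contDiff.comp hu

section rules

variable {f g : ℂ → ℝ}

theorem dx_add (hf : ContDiff ℝ (⊤ : ℕ∞) f)
    (hg : ContDiff ℝ (⊤ : ℕ∞) g) (z : ℂ) :
    dx (fun w => f w + g w) z = dx f z + dx g z := by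
  simp [dx, fderiv_fun_add (Smooth.diffAt hf z) (Smooth.diffAt hg z)]

theorem dy_add (hf : ContDiff ℝ (⊤ : ℕ∞) f)
    (hg : ContDiff ℝ (⊤ : ℕ∞) g) (z : ℂ) :
    dy (fun w => f w + g w) z = dy f z + dy g z := by
  simp [dy, fderiv_fun_add (Smooth.diffAt hf z) (Smooth.diffAt hg z)]

theorem dx_sub (hf : ContDiff ℝ (⊤ : ℕ∞) f)
    (hg : ContDiff ℝ (⊤ : ℕ∞) g) (z : ℂ) :
    dx (fun w => f w - g w) z = dx f z - dx g z := by
  simp [dx, fderiv_fun_sub (Smooth.diffAt hf z) (Smooth.diffAt hg z)]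

theorem dy_sub (hf : ContDiff ℝ (⊤ : ℕ∞) f)
    (hg : ContDiff ℝ (⊤ : ℕ∞) g) (z : ℂ) :
    dy (fun w => f w - g w) z = dy f z - dy g z := by
  simp [dy, fderiv_fun_sub (Smooth.diffAt hf z) (Smooth.diffAt hg z)]

theorem dx_mul (hf : ContDiff ℝ (⊤ : ℕ∞) f)
    (hg : ContDiff ℝ (⊤ : ℕ∞) g) (z : ℂ) :
    dx (fun w => f w * g w) z = f z * dx g z + dx f z * g z := by
  simp [dx, fderiv_fun_mul (Smooth.diffAt hf z) (Smooth.diffAt hg z)]; ring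

theorem dy_mul (hf : ContDiff ℝ (⊤ : ℕ∞) f)
    (hg : ContDiff ℝ (⊤ : ℕ∞) g) (z : ℂ) :
    dy (fun w => f w * g w) z = f z * dy g z + dy f z * g z := by
  simp [dy, fderiv_fun_mul (Smooth.diffAt hf z) (Smooth.diffAt hg z)]; ring

theorem dx_sq (hf : ContDiff ℝ (⊤ : ℕ∞) f) (z : ℂ) :
    dx (fun w => f w ^ 2) z = 2 * f z * dx f z := by
  simp only [pow_two, dx_mul hf hf]; ring

theorem dy_sq (hf : ContDiff ℝ (⊤ : ℕ∞) f) (z : ℂ) :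
    dy (fun w => f w ^ 2) z = 2 * f z * dy f z := by
  simp only [pow_two, dy_mul hf hf]; ring

theorem dx_const (c : ℝ) (z : ℂ) : dx (fun _ => c) z = 0 := by simp [dx]

theorem dy_const (c : ℝ) (z : ℂ) : dy (fun _ => c) z = 0 := by simp [dy]

theorem dx_re (z : ℂ) : dx Complex.re z = 1 := by
  have : fderiv ℝ Complex.re z = Complex.reCLM := Complex.reCLM.fderiv
  simp [dx, this]

theorem dy_re (z : ℂ) : dy Complex.re z = 0 := by
  have : fderiv ℝ Complex.re z = Complex.reCLM := Complex.reCLM.fderiv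
  simp [dy, this]

theorem dx_im (z : ℂ) : dx Complex.im z = 0 := by
  have : fderiv ℝ Complex.im z = Complex.imCLM := Complex.imCLM.fderiv
  simp [dx, this]

theorem dy_im (z : ℂ) : dy Complex.im z = 1 := by
  have : fderiv ℝ Complex.im z = Complex.imCLM := Complex.imCLM.fderiv
  simp [dy, this]

theorem fderiv_apply_eq_dx_dy (f : ℂ → ℝ) (z v : ℂ) :
    fderiv ℝ f z v = v.re * dx f z + v.im * dy f z := by
  have hv : v = v.re • (1 : ℂ) + v.im • Complex.I := by
    apply Complex.ext <;> simp
  conv_lhs => rw [hv]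
  rw [map_add, map_smul, map_smul]; simp [dx, dy]

theorem dy_dx_comm (hf : Smooth f) (z : ℂ) : dy (dx f) z = dx (dy f) z := by
  have hs : IsSymmSndFDerivAt ℝ f z := hf.contDiffAt.isSymmSndFDerivAt
    (by simpa using WithTop.coe_le_coe.2 (le_top (a := (2 : ℕ∞))))
  have hd : DifferentiableAt ℝ (fderiv ℝ f) z :=
    (hf.fderiv_right (m := (⊤ : ℕ∞)) (by simp)).differentiable (by simp) z
  have h1 : ∀ v w : ℂ, fderiv ℝ (fun y => fderiv ℝ f y v) z w = fderiv ℝ (fderiv ℝ f) z w v := by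
    intro v w
    rw [fderiv_clm_apply hd (differentiableAt_const v)]
    simp
  change fderiv ℝ (fun y => fderiv ℝ f y 1) z Complex.I
    = fderiv ℝ (fun y => fderiv ℝ f y Complex.I) z 1
  rw [h1, h1]; exact hs.eq _ _

/-- The chain rule along a curve. -/
theorem hasDerivAt_comp_curve (hf : Smooth f) {p : ℝ → ℂ} {p' : ℂ} {s : ℝ}
    (hp : HasDerivAt p p' s) :
    HasDerivAt (fun t => f (p t)) (p'.re * dx f (p s) + p'.im * dy f (p s)) s := by
  have := (hf.diffAt (p s)).hasFDerivAt.comp_hasDerivAt s hp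
  rwa [fderiv_apply_eq_dx_dy] at this

end rules

section compose

variable {F : ℂ → ℝ} {u : ℂ → ℂ}

theorem fderiv_re_comp (hu : ContDiff ℝ (⊤ : ℕ∞) u) (z v : ℂ) :
    (fderiv ℝ u z v).re = fderiv ℝ (fun w => (u w).re) z v := by
  have hd : DifferentiableAt ℝ u z := hu.differentiable (by simp) z
  have := (Complex.reCLM.hasFDerivAt.comp z hd.hasFDerivAt).fderiv
  have h2 : (fun w => (u w).re) = Complex.reCLM ∘ u := rfl
  rw [h2, this]; rfl

theorem fderiv_im_comp (hu : ContDiff ℝ (⊤ : ℕ∞) u) (z v : ℂ) :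
    (fderiv ℝ u z v).im = fderiv ℝ (fun w => (u w).im) z v := by
  have hd : DifferentiableAt ℝ u z := hu.differentiable (by simp) z
  have := (Complex.imCLM.hasFDerivAt.comp z hd.hasFDerivAt).fderiv
  have h2 : (fun w => (u w).im) = Complex.imCLM ∘ u := rfl
  rw [h2, this]; rfl

theorem fderiv_smooth_comp (hF : Smooth F) (hu : ContDiff ℝ (⊤ : ℕ∞) u) (z v : ℂ) :
    fderiv ℝ (fun w => F (u w)) z v =
      dx F (u z) * fderiv ℝ (fun w => (u w).re) z v +
        dy F (u z) * fderiv ℝ (fun w => (u w).im) z v := by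
  have hd : DifferentiableAt ℝ u z := hu.differentiable (by simp) z
  have := ((hF.diffAt (u z)).hasFDerivAt.comp z hd.hasFDerivAt).fderiv
  have h2 : (fun w => F (u w)) = F ∘ u := rfl
  rw [h2, this, ContinuousLinearMap.comp_apply, fderiv_apply_eq_dx_dy, fderiv_re_comp hu,
    fderiv_im_comp hu]
  ring

theorem dx_comp (hF : Smooth F) (hu : ContDiff ℝ (⊤ : ℕ∞) u) (z : ℂ) :
    dx (fun w => F (u w)) z =
      dx F (u z) * dx (fun w => (u w).re) z + dy F (u z) * dx (fun w => (u w).im) z :=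
  fderiv_smooth_comp hF hu z 1

theorem dy_comp (hF : Smooth F) (hu : ContDiff ℝ (⊤ : ℕ∞) u) (z : ℂ) :
    dy (fun w => F (u w)) z =
      dx F (u z) * dy (fun w => (u w).re) z + dy F (u z) * dy (fun w => (u w).im) z :=
  fderiv_smooth_comp hF hu z Complex.I

end compose

section fourier
open SchwartzMap FourierTransform

/-- The Fourier transform of a real function on `ℂ ≅ ℝ²`. -/
def fhat (f : ℂ → ℝ) : ℂ → ℂ := 𝓕 (fun z => (f z : ℂ))

theorem HasCompactSupport.fderiv_dir {f : ℂ → ℝ} (hc : HasCompactSupport f) (v : ℂ) :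
    HasCompactSupport (fun z => fderiv ℝ f z v) := by
  have := hc.fderiv (𝕜 := ℝ)
  exact this.comp_left (g := fun A : ℂ →L[ℝ] ℝ => A v) (by simp)

theorem HasCompactSupport.dx {f : ℂ → ℝ} (hc : HasCompactSupport f) :
    HasCompactSupport (dx f) := hc.fderiv_dir 1

theorem HasCompactSupport.dy {f : ℂ → ℝ} (hc : HasCompactSupport f) :
    HasCompactSupport (dy f) := hc.fderiv_dir Complex.I

theorem exists_schwartz {f : ℂ → ℝ} (hf : Smooth f) (hc : HasCompactSupport f) :
    ∃ s : 𝓢(ℂ, ℂ), ∀ z, s z = (f z : ℂ) :=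
  ⟨(hc.comp_left (g := fun x : ℝ => (x : ℂ)) (by simp)).toSchwartzMap
    (Complex.ofRealCLM.contDiff.comp hf), fun _ => rfl⟩

theorem fhat_eq {f : ℂ → ℝ} {s : 𝓢(ℂ, ℂ)} (hs : ∀ z, s z = (f z : ℂ)) :
    fhat f = ⇑(𝓕 s : 𝓢(ℂ, ℂ)) := by
  rw [SchwartzMap.fourier_coe, fhat]
  congr 1; funext z; exact (hs z).symm

theorem fhat_sq_integrable {f : ℂ → ℝ} (hf : Smooth f) (hc : HasCompactSupport f) :
    Integrable (fun ξ => ‖fhat f ξ‖ ^ 2) := by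
  obtain ⟨s, hs⟩ := exists_schwartz hf hc
  rw [fhat_eq hs]
  exact (memLp_two_iff_integrable_sq_norm (𝓕 s : 𝓢(ℂ, ℂ)).continuous.aestronglyMeasurable).1
    ((𝓕 s : 𝓢(ℂ, ℂ)).memLp 2 volume)

theorem integral_fhat_sq {f : ℂ → ℝ} (hf : Smooth f) (hc : HasCompactSupport f) :
    ∫ ξ, ‖fhat f ξ‖ ^ 2 = ∫ z, f z ^ 2 := by
  obtain ⟨s, hs⟩ := exists_schwartz hf hc
  rw [fhat_eq hs, SchwartzMap.integral_norm_sq_fourier]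
  congr 1; funext z; rw [hs]; simp

theorem norm_fhat_le (f : ℂ → ℝ) (ξ : ℂ) : ‖fhat f ξ‖ ≤ ∫ z, |f z| := by
  have := VectorFourier.norm_fourierIntegral_le_integral_norm Real.fourierChar volume
    (innerₗ ℂ) (fun z => (f z : ℂ)) ξ
  simp only [Complex.norm_real, Real.norm_eq_abs] at this
  exact this

theorem fhat_fderiv_dir {f : ℂ → ℝ} (hf : Smooth f) (hc : HasCompactSupport f) (v ξ : ℂ) :
    fhat (fun z => fderiv ℝ f z v) ξ = 2 * Real.pi * Complex.I * (inner ℝ ξ v : ℝ) * fhat f ξ := by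
  obtain ⟨s, hs⟩ := exists_schwartz hf hc
  have hd : ∀ z, (LineDeriv.lineDerivOp v s : 𝓢(ℂ, ℂ)) z = (fderiv ℝ f z v : ℂ) := by
    intro z
    rw [SchwartzMap.lineDerivOp_apply_eq_fderiv]
    have h2 : (⇑s : ℂ → ℂ) = Complex.ofRealCLM ∘ f := by funext w; exact hs w
    rw [h2, (Complex.ofRealCLM.hasFDerivAt.comp z (hf.diffAt z).hasFDerivAt).fderiv]
    rfl
  rw [fhat_eq hd, fhat_eq hs, SchwartzMap.fourier_lineDerivOp_eq]
  rw [smul_apply, SchwartzMap.smulLeftCLM_apply_apply (by fun_prop)]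
  simp; ring

theorem fhat_dx {f : ℂ → ℝ} (hf : Smooth f) (hc : HasCompactSupport f) (ξ : ℂ) :
    fhat (dx f) ξ = 2 * Real.pi * Complex.I * ξ.re * fhat f ξ := by
  refine (fhat_fderiv_dir hf hc 1 ξ).trans ?_
  simp [Complex.inner]

theorem fhat_dy {f : ℂ → ℝ} (hf : Smooth f) (hc : HasCompactSupport f) (ξ : ℂ) :
    fhat (dy f) ξ = 2 * Real.pi * Complex.I * ξ.im * fhat f ξ := by
  refine (fhat_fderiv_dir hf hc Complex.I ξ).trans ?_
  simp [Complex.inner]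

theorem integrable_of_smooth {f : ℂ → ℝ} (hf : Smooth f) (hc : HasCompactSupport f) :
    Integrable f := hf.continuous.integrable_of_hasCompactSupport hc

theorem fhat_add {f g : ℂ → ℝ} (hf : Smooth f) (hc : HasCompactSupport f)
    (hg : Smooth g) (hcg : HasCompactSupport g) (ξ : ℂ) :
    fhat (fun z => f z + g z) ξ = fhat f ξ + fhat g ξ := by
  obtain ⟨s, hs⟩ := exists_schwartz hf hc
  obtain ⟨t, ht⟩ := exists_schwartz hg hcg
  have : ∀ z, (s + t) z = ((f z + g z : ℝ) : ℂ) := by intro z; simp [hs, ht]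
  rw [fhat_eq hs, fhat_eq ht, fhat_eq this, FourierTransform.fourier_add]; rfl

theorem fhat_sub {f g : ℂ → ℝ} (hf : Smooth f) (hc : HasCompactSupport f)
    (hg : Smooth g) (hcg : HasCompactSupport g) (ξ : ℂ) :
    fhat (fun z => f z - g z) ξ = fhat f ξ - fhat g ξ := by
  obtain ⟨s, hs⟩ := exists_schwartz hf hc
  obtain ⟨t, ht⟩ := exists_schwartz hg hcg
  have : ∀ z, (s - t) z = ((f z - g z : ℝ) : ℂ) := by intro z; simp [hs, ht]
  rw [fhat_eq hs, fhat_eq ht, fhat_eq this]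
  rw [show (𝓕 (s - t) : 𝓢(ℂ, ℂ)) = 𝓕 s - 𝓕 t from
      map_sub (SchwartzMap.fourierTransformCLM ℂ) s t]
  rfl

/-- The logarithm as the integral of `|ξ|⁻²` over an annulus. -/
theorem integral_annulus {δ M : ℝ} (hδ : 0 < δ) (hM : δ ≤ M) :
    Integrable (fun ξ : ℂ => (Set.Ioc δ M).indicator (fun r => (r ^ 2)⁻¹) ‖ξ‖) ∧
    ∫ ξ : ℂ, (Set.Ioc δ M).indicator (fun r => (r ^ 2)⁻¹) ‖ξ‖ = 2 * Real.pi * Real.log (M / δ) := by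
  constructor
  · have hm : Measurable (fun ξ : ℂ => (Set.Ioc δ M).indicator (fun r => (r ^ 2)⁻¹) ‖ξ‖) := by
      have : Measurable ((Set.Ioc δ M).indicator (fun r : ℝ => (r ^ 2)⁻¹)) :=
        (by fun_prop : Measurable fun r : ℝ => (r ^ 2)⁻¹).indicator measurableSet_Ioc
      exact this.comp measurable_norm
    have hi : Integrable ((closedBall (0 : ℂ) M).indicator fun _ => (δ ^ 2)⁻¹) := by
      rw [integrable_indicator_iff measurableSet_closedBall]
      exact integrableOn_const (measure_closedBall_lt_top.ne)
    refine hi.mono' hm.aestronglyMeasurable (Filter.Eventually.of_forall fun ξ => ?_)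
    by_cases h : ‖ξ‖ ∈ Set.Ioc δ M
    · rw [Set.indicator_of_mem h, Set.indicator_of_mem (by simpa using h.2)]
      rw [Real.norm_of_nonneg (by positivity)]
      gcongr; exact h.1.le
    · rw [Set.indicator_of_notMem h, norm_zero]
      exact Set.indicator_nonneg (fun _ _ => by positivity) _
  · rw [integral_fun_norm_addHaar volume (fun r => (Set.Ioc δ M).indicator (fun r => (r ^ 2)⁻¹) r)]
    have h1 : ∀ y : ℝ, y ^ (Module.finrank ℝ ℂ - 1) • (Set.Ioc δ M).indicator (fun r => (r ^ 2)⁻¹) y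
        = (Set.Ioc δ M).indicator (fun r => r⁻¹) y := by
      intro y
      by_cases h : y ∈ Set.Ioc δ M
      · have : y ≠ 0 := (hδ.trans h.1).ne'
        simp [Set.indicator_of_mem h]; field_simp
      · simp [Set.indicator_of_notMem h]
    simp_rw [h1]
    rw [setIntegral_indicator measurableSet_Ioc,
      Set.inter_eq_self_of_subset_right
        (show Set.Ioc δ M ⊆ Set.Ioi 0 from fun x hx => hδ.trans hx.1),
      ← intervalIntegral.integral_of_le hM, integral_inv_of_pos hδ (hδ.trans_le hM)]
    simp [Measure.real, Complex.volume_ball]; ring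

end fourier

theorem hasCompactSupport_of_ball {f : ℂ → ℝ} {R : ℝ} (h : ∀ z, R < ‖z‖ → f z = 0) :
    HasCompactSupport f := by
  refine HasCompactSupport.intro (isCompact_closedBall (0 : ℂ) R) fun z hz => h z ?_
  simpa using hz

theorem integrable_sq_of_smooth {f : ℂ → ℝ} (hf : Smooth f) (hc : HasCompactSupport f) :
    Integrable fun z => f z ^ 2 := by
  have h : HasCompactSupport fun z => f z ^ 2 :=
    hc.mono fun z hz => by
      rw [Function.mem_support] at hz ⊢
      exact fun h => hz (by rw [h]; norm_num)
  exact (hf.continuous.pow 2).integrable_of_hasCompactSupport h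

theorem sq_integral_abs_le {f : ℂ → ℝ} (hf : Smooth f) {R : ℝ} (hR : 0 ≤ R)
    (h : ∀ z, R < ‖z‖ → f z = 0) :
    (∫ z, |f z|) ^ 2 ≤ Real.pi * R ^ 2 * ∫ z, f z ^ 2 := by
  have hc := hasCompactSupport_of_ball h
  have hi : Integrable fun z => |f z| := (integrable_of_smooth hf hc).abs
  have hi2 := integrable_sq_of_smooth hf hc
  set A := ∫ z, |f z| with hA
  set B := ∫ z, f z ^ 2 with hB
  have hvol : ∫ z : ℂ, (closedBall (0 : ℂ) R).indicator (fun _ => (1 : ℝ)) z = Real.pi * R ^ 2 := by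
    rw [integral_indicator measurableSet_closedBall]
    simp [Measure.real, Complex.volume_closedBall, hR]; ring
  have hiv : Integrable ((closedBall (0 : ℂ) R).indicator fun _ => (1 : ℝ)) := by
    rw [integrable_indicator_iff measurableSet_closedBall]
    exact integrableOn_const measure_closedBall_lt_top.ne
  have key : ∀ t : ℝ, 0 ≤ B * (t * t) + (-2 * A) * t + Real.pi * R ^ 2 := by
    intro t
    have : B * (t * t) + (-2 * A) * t + Real.pi * R ^ 2 =
        ∫ z, ((t * t) * f z ^ 2 + (-2 * t) * |f z| +
          (closedBall (0 : ℂ) R).indicator (fun _ => (1 : ℝ)) z) := by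
      rw [integral_add ((hi2.const_mul (t * t)).fun_add (hi.const_mul (-2 * t))) hiv,
        integral_add (hi2.const_mul _) (hi.const_mul _), integral_const_mul, integral_const_mul,
        hvol, ← hA, ← hB]
      ring
    rw [this]
    refine integral_nonneg fun z => ?_
    by_cases hz : z ∈ closedBall (0 : ℂ) R
    · simp only [Set.indicator_of_mem hz]
      have := sq_nonneg (t * |f z| - 1)
      rw [← sq_abs (f z)]
      simp only [Pi.zero_apply]
      nlinarith
    · have : f z = 0 := h z (by simpa using hz)
      simp [this, Set.indicator_of_notMem hz]
  have := discrim_le_zero key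
  rw [discrim] at this
  nlinarith

theorem curl_div_pointwise (x y a1 a2 b1 b2 g1 g2 h1 h2 : ℝ) :
    (x * x + y * y) * ((a1 * a1 + a2 * a2) + (b1 * b1 + b2 * b2)) ≤
      ((x * b1 - y * a1) * (x * b1 - y * a1) + (x * b2 - y * a2) * (x * b2 - y * a2)) +
      2 * ((x * g1 + y * h1) * (x * g1 + y * h1) + (x * g2 + y * h2) * (x * g2 + y * h2)) +
      2 * ((x * x + y * y) * (((a1 - g1) * (a1 - g1) + (a2 - g2) * (a2 - g2)) +
        ((b1 - h1) * (b1 - h1) + (b2 - h2) * (b2 - h2)))) := by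
  have e : ∀ a b g h : ℝ, (x * x + y * y) * (a * a + b * b) ≤
      (x * b - y * a) * (x * b - y * a) + 2 * ((x * g + y * h) * (x * g + y * h)) +
      2 * ((x * x + y * y) * ((a - g) * (a - g) + (b - h) * (b - h))) := by
    intro a b g h
    nlinarith [sq_nonneg ((x * g + y * h) - (x * (a - g) + y * (b - h))),
      sq_nonneg (x * (b - h) - y * (a - g))]
  linarith [e a1 b1 g1 h1, e a2 b2 g2 h2]

theorem curl_div_pointwise_complex (ξ a b g₁ g₂ : ℂ) :
    (2 * Real.pi) ^ 2 * ‖ξ‖ ^ 2 * (‖a‖ ^ 2 + ‖b‖ ^ 2) ≤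
      ‖2 * Real.pi * Complex.I * ξ.re * b - 2 * Real.pi * Complex.I * ξ.im * a‖ ^ 2 +
      2 * ‖2 * Real.pi * Complex.I * ξ.re * g₁ + 2 * Real.pi * Complex.I * ξ.im * g₂‖ ^ 2 +
      2 * ((2 * Real.pi) ^ 2 * ‖ξ‖ ^ 2 * (‖a - g₁‖ ^ 2 + ‖b - g₂‖ ^ 2)) := by
  have e1 : (2 * Real.pi * Complex.I * ξ.re * b - 2 * Real.pi * Complex.I * ξ.im * a) =
      ((2 * Real.pi : ℝ) : ℂ) * Complex.I * (ξ.re * b - ξ.im * a) := by push_cast; ring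
  have e2 : (2 * Real.pi * Complex.I * ξ.re * g₁ + 2 * Real.pi * Complex.I * ξ.im * g₂) =
      ((2 * Real.pi : ℝ) : ℂ) * Complex.I * (ξ.re * g₁ + ξ.im * g₂) := by push_cast; ring
  rw [e1, e2]
  simp only [norm_mul, Complex.norm_I, mul_one, mul_pow, Complex.norm_real, Real.norm_eq_abs,
    sq_abs, Complex.sq_norm, Complex.normSq_apply, Complex.sub_re, Complex.sub_im, Complex.mul_re,
    Complex.mul_im, Complex.ofReal_re, Complex.ofReal_im, zero_mul, sub_zero, add_zero,
    Complex.add_re, Complex.add_im]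
  have k := mul_le_mul_of_nonneg_left
    (curl_div_pointwise ξ.re ξ.im a.re a.im b.re b.im g₁.re g₁.im g₂.re g₂.im)
    (by positivity : 0 ≤ 2 ^ 2 * Real.pi ^ 2)
  linarith [k]

set_option maxHeartbeats 800000 in
/-- A compactly supported planar vector field `F` whose curl, and the divergence of a nearby
field `G`, are bounded in `L¹` and by `M` in `L²`, has energy at most of order `log M`. -/
theorem energy_le_log_of_curl_div {K R : ℝ} (hK : 0 ≤ K) (hR : 0 ≤ R) :
    ∃ C : ℝ, ∀ (M : ℝ) (F₁ F₂ G₁ G₂ : ℂ → ℝ), 1 ≤ M →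
      Smooth F₁ → Smooth F₂ → Smooth G₁ → Smooth G₂ →
      (∀ z, R < ‖z‖ → F₁ z = 0) → (∀ z, R < ‖z‖ → F₂ z = 0) →
      (∀ z, R < ‖z‖ → G₁ z = 0) → (∀ z, R < ‖z‖ → G₂ z = 0) →
      ∫ z, |dx F₂ z - dy F₁ z| ≤ K → ∫ z, |dx G₁ z + dy G₂ z| ≤ K →
      ∫ z, (dx F₂ z - dy F₁ z) ^ 2 ≤ K * M ^ 2 → ∫ z, (dx G₁ z + dy G₂ z) ^ 2 ≤ K * M ^ 2 →
      ∫ z, (F₁ z - G₁ z) ^ 2 ≤ K → ∫ z, (F₂ z - G₂ z) ^ 2 ≤ K →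
      ∫ z, (F₁ z ^ 2 + F₂ z ^ 2) ≤ C * (Real.log M + 1) := by
  set δ : ℝ := (2 * Real.pi * (R + 1))⁻¹ with hδ
  have hpi := Real.pi_gt_three
  have hδ0 : 0 < δ := by positivity
  have hδ1 : δ ≤ 1 := by
    rw [hδ]; apply inv_le_one_of_one_le₀; nlinarith
  refine ⟨2 * (K ^ 2 * (2 * Real.pi) + K ^ 2 * (2 * Real.pi) * |Real.log δ| + 7 * K), ?_⟩
  intro M F₁ F₂ G₁ G₂ hM hF₁ hF₂ hG₁ hG₂ sF₁ sF₂ sG₁ sG₂ hQ hD hQ2 hD2 hH₁ hH₂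
  have cF₁ := hasCompactSupport_of_ball sF₁
  have cF₂ := hasCompactSupport_of_ball sF₂
  have cG₁ := hasCompactSupport_of_ball sG₁
  have cG₂ := hasCompactSupport_of_ball sG₂
  have hQs : Smooth fun z => dx F₂ z - dy F₁ z := hF₂.dx.sub hF₁.dy
  have hDs : Smooth fun z => dx G₁ z + dy G₂ z := hG₁.dx.add hG₂.dy
  have hH₁s : Smooth fun z => F₁ z - G₁ z := hF₁.sub hG₁
  have hH₂s : Smooth fun z => F₂ z - G₂ z := hF₂.sub hG₂
  have cQ : HasCompactSupport fun z => dx F₂ z - dy F₁ z := cF₂.dx.sub cF₁.dy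
  have cD : HasCompactSupport fun z => dx G₁ z + dy G₂ z := cG₁.dx.add cG₂.dy
  have cH₁ : HasCompactSupport fun z => F₁ z - G₁ z := cF₁.sub cG₁
  have cH₂ : HasCompactSupport fun z => F₂ z - G₂ z := cF₂.sub cG₂
  set Q := fun z => dx F₂ z - dy F₁ z with hQdef
  set D := fun z => dx G₁ z + dy G₂ z with hDdef
  set H₁ := fun z => F₁ z - G₁ z with hH₁def
  set H₂ := fun z => F₂ z - G₂ z with hH₂def
  set I := ∫ z, (F₁ z ^ 2 + F₂ z ^ 2) with hI
  have sqi : ∀ {f : ℂ → ℝ}, Smooth f → HasCompactSupport f → Integrable fun z => f z ^ 2 :=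
    fun {f} hf hc => integrable_sq_of_smooth hf hc
  have hIsum : I = (∫ z, F₁ z ^ 2) + ∫ z, F₂ z ^ 2 := by
    rw [hI, integral_add (sqi hF₁ cF₁) (sqi hF₂ cF₂)]
  have hIfour : I = ∫ ξ, (‖fhat F₁ ξ‖ ^ 2 + ‖fhat F₂ ξ‖ ^ 2) := by
    rw [integral_add (fhat_sq_integrable hF₁ cF₁) (fhat_sq_integrable hF₂ cF₂),
      integral_fhat_sq hF₁ cF₁, integral_fhat_sq hF₂ cF₂, hIsum]
  have hI0 : 0 ≤ I := integral_nonneg fun z => by positivity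
  have hQhat : ∀ ξ, fhat Q ξ =
      2 * Real.pi * Complex.I * ξ.re * fhat F₂ ξ - 2 * Real.pi * Complex.I * ξ.im * fhat F₁ ξ :=
    fun ξ => by
      rw [hQdef, fhat_sub hF₂.dx cF₂.dx hF₁.dy cF₁.dy, fhat_dx hF₂ cF₂, fhat_dy hF₁ cF₁]
  have hDhat : ∀ ξ, fhat D ξ =
      2 * Real.pi * Complex.I * ξ.re * fhat G₁ ξ + 2 * Real.pi * Complex.I * ξ.im * fhat G₂ ξ :=
    fun ξ => by
      rw [hDdef, fhat_add hG₁.dx cG₁.dx hG₂.dy cG₂.dy, fhat_dx hG₁ cG₁, fhat_dy hG₂ cG₂]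
  have pt : ∀ ξ, ‖fhat F₁ ξ‖ ^ 2 + ‖fhat F₂ ξ‖ ^ 2 ≤
      (closedBall (0 : ℂ) δ).indicator (fun _ => Real.pi * R ^ 2 * I) ξ +
      K ^ 2 * (Set.Ioc δ M).indicator (fun r => (r ^ 2)⁻¹) ‖ξ‖ +
      (M ^ 2)⁻¹ * (‖fhat Q ξ‖ ^ 2 + 2 * ‖fhat D ξ‖ ^ 2) +
      2 * (‖fhat H₁ ξ‖ ^ 2 + ‖fhat H₂ ξ‖ ^ 2) := by
    intro ξ
    by_cases h1 : ‖ξ‖ ≤ δ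
    · have hm : ξ ∈ closedBall (0 : ℂ) δ := by simpa using h1
      rw [Set.indicator_of_mem hm, Set.indicator_of_notMem (fun h => absurd h.1 h1.not_gt)]
      have b1 : ‖fhat F₁ ξ‖ ^ 2 ≤ Real.pi * R ^ 2 * ∫ z, F₁ z ^ 2 :=
        (pow_le_pow_left₀ (norm_nonneg _) (norm_fhat_le F₁ ξ) 2).trans
          (sq_integral_abs_le hF₁ hR sF₁)
      have b2 : ‖fhat F₂ ξ‖ ^ 2 ≤ Real.pi * R ^ 2 * ∫ z, F₂ z ^ 2 :=
        (pow_le_pow_left₀ (norm_nonneg _) (norm_fhat_le F₂ ξ) 2).trans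
          (sq_integral_abs_le hF₂ hR sF₂)
      have : 0 ≤ (M ^ 2)⁻¹ * (‖fhat Q ξ‖ ^ 2 + 2 * ‖fhat D ξ‖ ^ 2) +
        2 * (‖fhat H₁ ξ‖ ^ 2 + ‖fhat H₂ ξ‖ ^ 2) := by positivity
      rw [hIsum]; linarith
    · push Not at h1
      have hm : ξ ∉ closedBall (0 : ℂ) δ := by simpa using h1
      rw [Set.indicator_of_notMem hm]
      have hξ0 : 0 < ‖ξ‖ := hδ0.trans h1
      have a := curl_div_pointwise_complex ξ (fhat F₁ ξ) (fhat F₂ ξ) (fhat G₁ ξ) (fhat G₂ ξ)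
      rw [← hQhat, ← hDhat, ← fhat_sub hF₁ cF₁ hG₁ cG₁, ← fhat_sub hF₂ cF₂ hG₂ cG₂,
        ← hH₁def, ← hH₂def] at a
      set S := ‖fhat F₁ ξ‖ ^ 2 + ‖fhat F₂ ξ‖ ^ 2
      set T := ‖fhat H₁ ξ‖ ^ 2 + ‖fhat H₂ ξ‖ ^ 2
      set P := ‖fhat Q ξ‖ ^ 2 + 2 * ‖fhat D ξ‖ ^ 2
      have hP0 : 0 ≤ P := by positivity
      have h2pi : 36 ≤ (2 * Real.pi) ^ 2 := by nlinarith
      have hS : S ≤ P / ((2 * Real.pi) ^ 2 * ‖ξ‖ ^ 2) + 2 * T := by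
        have hpos : 0 < (2 * Real.pi) ^ 2 * ‖ξ‖ ^ 2 := by positivity
        rw [← sub_le_iff_le_add, le_div_iff₀ hpos]
        nlinarith
      have hS' : S ≤ P / (36 * ‖ξ‖ ^ 2) + 2 * T := hS.trans (by gcongr)
      by_cases h2 : ‖ξ‖ ≤ M
      · rw [Set.indicator_of_mem (show ‖ξ‖ ∈ Set.Ioc δ M from ⟨h1, h2⟩)]
        have q1 : ‖fhat Q ξ‖ ^ 2 ≤ K ^ 2 :=
          pow_le_pow_left₀ (norm_nonneg _) ((norm_fhat_le Q ξ).trans hQ) 2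
        have d1 : ‖fhat D ξ‖ ^ 2 ≤ K ^ 2 :=
          pow_le_pow_left₀ (norm_nonneg _) ((norm_fhat_le D ξ).trans hD) 2
        have : P / (36 * ‖ξ‖ ^ 2) ≤ K ^ 2 * (‖ξ‖ ^ 2)⁻¹ := by
          rw [div_eq_mul_inv, mul_inv, ← mul_assoc]
          gcongr
          simp only [P]; nlinarith [sq_nonneg K]
        have : 0 ≤ (M ^ 2)⁻¹ * P := by positivity
        linarith
      · push Not at h2
        rw [Set.indicator_of_notMem (fun h => absurd h.2 h2.not_ge)]
        have : P / (36 * ‖ξ‖ ^ 2) ≤ (M ^ 2)⁻¹ * P := by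
          rw [div_eq_mul_inv, mul_comm]
          gcongr
          nlinarith
        linarith
  obtain ⟨ia, va⟩ := integral_annulus hδ0 (hδ1.trans hM)
  have ib : Integrable ((closedBall (0 : ℂ) δ).indicator fun _ => Real.pi * R ^ 2 * I) := by
    rw [integrable_indicator_iff measurableSet_closedBall]
    exact integrableOn_const measure_closedBall_lt_top.ne
  have vb : ∫ ξ : ℂ, (closedBall (0 : ℂ) δ).indicator (fun _ => Real.pi * R ^ 2 * I) ξ =
      (Real.pi * δ ^ 2) * (Real.pi * R ^ 2 * I) := by
    rw [integral_indicator measurableSet_closedBall, setIntegral_const, smul_eq_mul]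
    congr 1
    simp [Measure.real, Complex.volume_closedBall, hδ0.le, mul_comm]
  have iQ := fhat_sq_integrable hQs cQ
  have iD := fhat_sq_integrable hDs cD
  have i1 := fhat_sq_integrable hH₁s cH₁
  have i2 := fhat_sq_integrable hH₂s cH₂
  have main : I ≤ (Real.pi * δ ^ 2) * (Real.pi * R ^ 2 * I) +
      K ^ 2 * (2 * Real.pi * Real.log (M / δ)) +
      (M ^ 2)⁻¹ * ((∫ z, Q z ^ 2) + 2 * ∫ z, D z ^ 2) + 2 * ((∫ z, H₁ z ^ 2) + ∫ z, H₂ z ^ 2) := by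
    have i12 := ib.fun_add (ia.const_mul (K ^ 2))
    have i3 := (iQ.fun_add (iD.const_mul 2)).const_mul (M ^ 2)⁻¹
    have i4 := (i1.fun_add i2).const_mul 2
    have := integral_mono ((fhat_sq_integrable hF₁ cF₁).fun_add (fhat_sq_integrable hF₂ cF₂))
      ((i12.fun_add i3).fun_add i4) pt
    rw [← hIfour] at this
    refine this.trans (le_of_eq ?_)
    rw [integral_add (i12.fun_add i3) i4,
      integral_add i12 i3, integral_add ib (ia.const_mul (K ^ 2)), integral_const_mul,
      integral_const_mul, integral_const_mul, integral_add iQ (iD.const_mul 2),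
      integral_add i1 i2, integral_const_mul, va, vb, integral_fhat_sq hQs cQ,
      integral_fhat_sq hDs cD, integral_fhat_sq hH₁s cH₁, integral_fhat_sq hH₂s cH₂]
  have hsmall : (Real.pi * δ ^ 2) * (Real.pi * R ^ 2 * I) ≤ I / 2 := by
    have : Real.pi * δ * R ≤ 1 / 2 := by
      rw [hδ]
      have : Real.pi * (2 * Real.pi * (R + 1))⁻¹ * R = (R / (R + 1)) / 2 := by field_simp
      rw [this]
      have : R / (R + 1) ≤ 1 := by rw [div_le_one (by positivity)]; linarith
      linarith
    have h0 : 0 ≤ Real.pi * δ * R := by positivity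
    have h2 : (Real.pi * δ * R) ^ 2 ≤ 1 / 2 :=
      (pow_le_pow_left₀ h0 this 2).trans (by norm_num)
    calc (Real.pi * δ ^ 2) * (Real.pi * R ^ 2 * I) = (Real.pi * δ * R) ^ 2 * I := by ring
      _ ≤ 1 / 2 * I := mul_le_mul_of_nonneg_right h2 hI0
      _ = I / 2 := by ring
  have hQD : (M ^ 2)⁻¹ * ((∫ z, Q z ^ 2) + 2 * ∫ z, D z ^ 2) ≤ 3 * K := by
    rw [inv_mul_le_iff₀ (by positivity)]
    linarith
  have hlog : Real.log (M / δ) ≤ Real.log M + |Real.log δ| := by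
    rw [Real.log_div (by positivity) hδ0.ne']
    linarith [neg_abs_le (Real.log δ)]
  have hlogM : 0 ≤ Real.log M := Real.log_nonneg hM
  have hk : K ^ 2 * (2 * Real.pi * Real.log (M / δ)) ≤
      K ^ 2 * (2 * Real.pi) * (Real.log M + |Real.log δ|) := by
    rw [← mul_assoc]; gcongr
  have e1 : 0 ≤ K ^ 2 * (2 * Real.pi) * |Real.log δ| * Real.log M := by positivity
  have e2 : 0 ≤ K * Real.log M := by positivity
  have e3 : 0 ≤ K ^ 2 * (2 * Real.pi) := by positivity
  linarith

/-- The planar cross product `a × b`. -/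
def crossC (a b : ℂ) : ℝ := a.re * b.im - a.im * b.re

theorem crossC_eq_im (a b : ℂ) : crossC a b = ((starRingEnd ℂ) a * b).im := by
  simp [crossC]; ring

theorem abs_crossC_le (a b : ℂ) : |crossC a b| ≤ ‖a‖ * ‖b‖ := by
  rw [crossC_eq_im]
  exact (Complex.abs_im_le_norm _).trans (by simp)

theorem continuous_crossC {X : Type*} [TopologicalSpace X] {a b : X → ℂ} (ha : Continuous a)
    (hb : Continuous b) : Continuous fun x => crossC (a x) (b x) := by
  unfold crossC; fun_prop

theorem IsPreconnected.subset_of_disjoint_frontier' {U Ω : Set ℂ} (hU : IsPreconnected U)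
    (hΩ : IsOpen Ω) (hd : Disjoint U (frontier Ω)) (hne : (U ∩ Ω).Nonempty) : U ⊆ Ω := by
  refine hU.subset_left_of_subset_union hΩ isClosed_closure.isOpen_compl
    (Set.disjoint_compl_right_iff_subset.2 subset_closure) (fun z hz => ?_) hne
  by_cases h : z ∈ closure Ω
  · left
    by_contra hzΩ
    exact Set.disjoint_left.1 hd hz (by rw [hΩ.frontier_eq]; exact ⟨h, hzΩ⟩)
  · exact Or.inr h

/-- A bounded domain, strictly star-shaped about the origin, with positively oriented
arclength parametrization `γ` of its boundary. -/
structure StarDomain (Ω : Set ℂ) (γ : ℝ → ℂ) (L c : ℝ) : Prop extends BoundaryParam Ω γ L where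
  isOpen : IsOpen Ω
  bounded : IsBounded Ω
  zero_mem : (0 : ℂ) ∈ Ω
  cpos : 0 < c
  star : ∀ s, c ≤ crossC (γ s) (deriv γ s)

namespace StarDomain

variable {Ω : Set ℂ} {γ : ℝ → ℂ} {L c : ℝ}

theorem continuous (h : StarDomain Ω γ L c) : Continuous γ := h.smooth.continuous

theorem hasDerivAt (h : StarDomain Ω γ L c) (s : ℝ) : HasDerivAt γ (deriv γ s) s :=
  (h.smooth.differentiable (by simp) s).hasDerivAt

theorem smooth_deriv (h : StarDomain Ω γ L c) : ContDiff ℝ (⊤ : ℕ∞) (deriv γ) :=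
  (contDiff_infty_iff_deriv.1 h.smooth).2

theorem continuous_deriv (h : StarDomain Ω γ L c) : Continuous (deriv γ) :=
  h.smooth_deriv.continuous

theorem periodic_deriv (h : StarDomain Ω γ L c) : Function.Periodic (deriv γ) L := by
  intro s
  have : (fun x => γ (x + L)) = γ := funext h.periodic
  rw [← deriv_comp_add_const, this]

theorem le_norm (h : StarDomain Ω γ L c) (s : ℝ) : c ≤ ‖γ s‖ := by
  have := (h.star s).trans ((le_abs_self _).trans (abs_crossC_le _ _))
  rwa [h.arclength, mul_one] at this

theorem norm_pos (h : StarDomain Ω γ L c) (s : ℝ) : 0 < ‖γ s‖ := h.cpos.trans_le (h.le_norm s)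

theorem ne_zero (h : StarDomain Ω γ L c) (s : ℝ) : γ s ≠ 0 := norm_pos_iff.1 (h.norm_pos s)

/-- A continuous logarithm of `γ` along the boundary. -/
theorem exists_log_winding (h : StarDomain Ω γ L c) :
    ∃ Λ : ℝ → ℂ, ∃ k : ℤ, Continuous Λ ∧ (∀ s, Complex.exp (Λ s) = γ s) ∧
      StrictMono (fun s => (Λ s).im) ∧ ∀ s, Λ (s + L) = Λ s + 2 * Real.pi * k * Complex.I := by
  have hq : Continuous fun s => deriv γ s / γ s := h.continuous_deriv.div h.continuous h.ne_zero
  let Λ : ℝ → ℂ := fun s => Complex.log (γ 0) + ∫ t in (0 : ℝ)..s, deriv γ t / γ t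
  have hd : ∀ s, HasDerivAt Λ (deriv γ s / γ s) s := fun s =>
    (intervalIntegral.integral_hasDerivAt_right (hq.intervalIntegrable _ _)
      (hq.stronglyMeasurableAtFilter _ _) hq.continuousAt).const_add _
  have hexp : ∀ s, Complex.exp (Λ s) = γ s := by
    have hconst : ∀ s, HasDerivAt (fun s => Complex.exp (-Λ s) * γ s) 0 s := by
      intro s
      have h1 := ((hd s).neg.cexp).mul (h.hasDerivAt s)
      have e : Complex.exp ((-Λ) s) * -(deriv γ s / γ s) * γ s +
          Complex.exp ((-Λ) s) * deriv γ s = 0 := by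
        rw [mul_assoc, neg_mul, div_mul_cancel₀ _ (h.ne_zero s)]
        ring
      rw [e] at h1
      exact h1
    intro s
    have := is_const_of_deriv_eq_zero (fun s => (hconst s).differentiableAt)
      (fun s => (hconst s).deriv) s 0
    have h0 : Λ 0 = Complex.log (γ 0) := by simp [Λ]
    simp only [h0, Complex.exp_neg, Complex.exp_log (h.ne_zero 0),
      inv_mul_cancel₀ (h.ne_zero 0)] at this
    rw [inv_mul_eq_iff_eq_mul₀ (Complex.exp_ne_zero _)] at this
    rw [this, mul_one]
  have hmono : StrictMono fun s => (Λ s).im := by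
    have hdi : ∀ s, HasDerivAt (fun s => (Λ s).im) (deriv γ s / γ s).im s := fun s =>
      Complex.imCLM.hasFDerivAt.comp_hasDerivAt s (hd s)
    refine strictMono_of_deriv_pos fun s => ?_
    rw [(hdi s).deriv]
    have h1 : (deriv γ s / γ s).im = crossC (γ s) (deriv γ s) / Complex.normSq (γ s) := by
      rw [Complex.div_im, crossC]; ring
    rw [h1]
    exact div_pos (h.cpos.trans_le (h.star s)) (Complex.normSq_pos.2 (h.ne_zero s))
  obtain ⟨k, hk⟩ := Complex.exp_eq_exp_iff_exists_int.1
    (show Complex.exp (Λ (0 + L)) = Complex.exp (Λ 0) by rw [hexp, hexp, h.periodic])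
  refine ⟨Λ, k, continuous_iff_continuousAt.2 fun s => (hd s).continuousAt, hexp, hmono,
    fun s => ?_⟩
  have hconst : ∀ s, HasDerivAt (fun s => Λ (s + L) - Λ s) 0 s := by
    intro s
    have h1 := ((hd (s + L)).comp_add_const s L).sub (hd s)
    rw [h.periodic, h.periodic_deriv, sub_self] at h1
    exact h1
  have := is_const_of_deriv_eq_zero (fun s => (hconst s).differentiableAt)
      (fun s => (hconst s).deriv) s 0
  simp only [hk] at this
  linear_combination this

/-- A continuous logarithm of `γ`, winding once. -/
theorem exists_log (h : StarDomain Ω γ L c) :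
    ∃ Λ : ℝ → ℂ, Continuous Λ ∧ (∀ s, Complex.exp (Λ s) = γ s) ∧
      StrictMono (fun s => (Λ s).im) ∧ Function.Surjective (fun s => (Λ s).im) ∧
      ∀ s, Λ (s + L) = Λ s + 2 * Real.pi * Complex.I := by
  obtain ⟨Λ, k, hc, hexp, hmono, hper⟩ := h.exists_log_winding
  have him : ∀ s, (Λ (s + L)).im = (Λ s).im + 2 * Real.pi * k := fun s => by
    rw [hper]; simp
  have hre : Function.Periodic (fun s => (Λ s).re) L := fun s => by
    simp only [hper]; simp
  have hpi := Real.pi_pos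
  have hk0 : 0 < k := by
    have h1 := hmono (show (0 : ℝ) < 0 + L by linarith [h.Lpos])
    simp only [him] at h1
    have : (0 : ℝ) < k := by nlinarith
    exact_mod_cast this
  have hn : ∀ n : ℤ, ∀ s, (Λ (s + n * L)).im = (Λ s).im + n * (2 * Real.pi * k) := by
    intro n s
    have hp : Function.Periodic (fun s => (Λ s).im - s * (2 * Real.pi * k / L)) L := by
      intro s
      have := h.Lpos.ne'
      simp only [him]; field_simp; ring
    have h1 := (hp.int_mul n) s
    have := h.Lpos.ne'
    field_simp at h1
    have h2 : L * (Λ (s + n * L)).im = L * ((Λ s).im + n * (2 * Real.pi * k)) := by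
      linear_combination h1
    exact mul_left_cancel₀ this h2
  have hci : Continuous fun s => (Λ s).im := Complex.continuous_im.comp hc
  have hk0' : (0 : ℝ) < 2 * Real.pi * k := by positivity
  have hsurj : Function.Surjective fun s => (Λ s).im := by
    intro y
    obtain ⟨n, hn1⟩ := exists_int_gt ((y - (Λ 0).im) / (2 * Real.pi * k))
    obtain ⟨m, hm1⟩ := exists_int_lt ((y - (Λ 0).im) / (2 * Real.pi * k))
    rw [div_lt_iff₀ hk0'] at hn1
    rw [lt_div_iff₀ hk0'] at hm1
    exact mem_range_of_exists_le_of_exists_ge hci ⟨0 + m * L, by rw [hn]; linarith⟩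
      ⟨0 + n * L, by rw [hn]; linarith⟩
  refine ⟨Λ, hc, hexp, hmono, hsurj, ?_⟩
  suffices k = 1 by
    intro s; rw [hper, this]; simp
  by_contra hk1
  have hk2 : (2 : ℝ) ≤ k := by exact_mod_cast (show (2 : ℤ) ≤ k by omega)
  let e : ℝ ≃o ℝ := StrictMono.orderIsoOfSurjective _ hmono hsurj
  have he : ∀ s, e s = (Λ s).im := fun s => rfl
  let σ : ℝ → ℝ := fun s => e.symm (e s + 2 * Real.pi)
  have hσ : ∀ s, (Λ (σ s)).im = (Λ s).im + 2 * Real.pi := fun s => by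
    rw [← he, ← he]; exact e.apply_symm_apply _
  have hσc : Continuous σ := e.symm.continuous.comp (e.continuous.add continuous_const)
  let ψ : ℝ → ℝ := fun s => (Λ s).re
  have hψ : Continuous ψ := Complex.continuous_re.comp hc
  obtain ⟨s₁, hs₁⟩ : ∃ s₁, ∀ s, ψ s ≤ ψ s₁ := by
    obtain ⟨s₁, -, h1⟩ := isCompact_Icc.exists_isMaxOn (Set.nonempty_Icc.2 h.Lpos.le)
      hψ.continuousOn (s := Set.Icc 0 L)
    refine ⟨s₁, fun s => ?_⟩
    obtain ⟨y, hy, hy2⟩ := hre.exists_mem_Ico₀ h.Lpos s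
    have h2 := h1 (Set.Ico_subset_Icc_self hy)
    simp only [Set.mem_ofPred_eq] at h2
    simpa [ψ, hy2] using h2
  have h1 : ψ (σ s₁) - ψ s₁ ≤ 0 := by linarith [hs₁ (σ s₁)]
  let s₂ := e.symm (e s₁ - 2 * Real.pi)
  have hs₂ : σ s₂ = s₁ := by
    simp only [σ, s₂, e.apply_symm_apply, sub_add_cancel, e.symm_apply_apply]
  have h2 : 0 ≤ ψ (σ s₂) - ψ s₂ := by rw [hs₂]; linarith [hs₁ s₂]
  obtain ⟨s, hs⟩ := mem_range_of_exists_le_of_exists_ge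
    ((hψ.comp hσc).sub hψ) ⟨s₁, h1⟩ ⟨s₂, h2⟩
  have heq : γ (σ s) = γ s := by
    rw [← hexp, ← hexp, Complex.exp_eq_exp_iff_exists_int]
    refine ⟨1, Complex.ext ?_ ?_⟩
    · have hs' : (Λ (σ s)).re - (Λ s).re = 0 := hs
      simp; linarith
    · rw [hσ]; simp
  obtain ⟨n, hn'⟩ := h.inj _ _ heq
  have hlt : s < σ s := hmono.lt_iff_lt.1 (by simp only [hσ]; linarith)
  have hlt2 : σ s < s + L := hmono.lt_iff_lt.1 (by simp only [hσ, him]; nlinarith)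
  have hL := h.Lpos
  have n0 : (0 : ℝ) < n := by by_contra hh; push Not at hh; nlinarith
  have n1 : (n : ℝ) < 1 := by by_contra hh; push Not at hh; nlinarith
  have n0' : 0 < n := by exact_mod_cast n0
  have n1' : n < 1 := by exact_mod_cast n1
  omega

theorem polar_unique (h : StarDomain Ω γ L c) {r r' s s' : ℝ} (hr : 0 < r) (hr' : 0 < r')
    (heq : (r : ℂ) * γ s = r' * γ s') : r = r' ∧ ∃ k : ℤ, s - s' = L * k := by
  obtain ⟨Λ, hc, hexp, hmono, hsurj, hper⟩ := h.exists_log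
  have hn : ∀ n : ℤ, ∀ s, (Λ (s + n * L)).im = (Λ s).im + n * (2 * Real.pi) := by
    intro n s
    have hp : Function.Periodic (fun s => (Λ s).im - s * (2 * Real.pi / L)) L := by
      intro s
      have := h.Lpos.ne'
      simp only [hper]; simp; field_simp; ring
    have h1 := (hp.int_mul n) s
    have := h.Lpos.ne'
    field_simp at h1
    have h2 : L * (Λ (s + n * L)).im = L * ((Λ s).im + n * (2 * Real.pi)) := by
      linear_combination h1
    exact mul_left_cancel₀ this h2
  have e : ∀ {r s}, 0 < r → Complex.exp (Real.log r + Λ s) = r * γ s := fun {r s} hr => by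
    rw [Complex.exp_add, hexp, ← Complex.ofReal_exp, Real.exp_log hr]
  rw [← e hr, ← e hr', Complex.exp_eq_exp_iff_exists_int] at heq
  obtain ⟨n, hn'⟩ := heq
  have him := congrArg Complex.im hn'
  simp at him
  have hs : s = s' + n * L := hmono.injective (by simp only [hn]; linarith)
  have hγ : γ s = γ s' := by rw [hs]; exact (h.periodic.int_mul n) s'
  refine ⟨?_, n, by rw [hs]; ring⟩
  have : (r : ℂ) = r' := by
    have h1 := e (s := s) hr
    have h2 := e (s := s') hr'
    have h3 : (r : ℂ) * γ s = r' * γ s' := by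
      rw [← h1, ← h2, Complex.exp_eq_exp_iff_exists_int]; exact ⟨n, hn'⟩
    rw [hγ] at h3
    exact mul_right_cancel₀ (h.ne_zero s') h3
  exact_mod_cast this

theorem polar_surj (h : StarDomain Ω γ L c) {z : ℂ} (hz : z ≠ 0) :
    ∃ r > (0 : ℝ), ∃ s ∈ Set.Ico 0 L, z = (r : ℂ) * γ s := by
  obtain ⟨Λ, hc, hexp, hmono, hsurj, hper⟩ := h.exists_log
  obtain ⟨s, hs⟩ := hsurj (Complex.log z).im
  simp only at hs
  obtain ⟨y, hy, hy2⟩ := h.periodic.exists_mem_Ico₀ h.Lpos s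
  refine ⟨Real.exp ((Complex.log z).re - (Λ s).re), Real.exp_pos _, y, hy, ?_⟩
  rw [← hy2, ← hexp, Complex.ofReal_exp, ← Complex.exp_add, ← Complex.exp_log hz]
  congr 1
  rw [Complex.exp_log hz]
  apply Complex.ext <;> simp [hs]

theorem smul_mem_of_lt (h : StarDomain Ω γ L c) {r : ℝ} (hr0 : 0 ≤ r) (hr : r < 1) (s : ℝ) :
    (r : ℂ) * γ s ∈ Ω := by
  let U : Set ℂ := (fun p : ℝ × ℝ => (p.1 : ℂ) * γ p.2) '' (Set.Ico (0 : ℝ) 1 ×ˢ Set.univ)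
  have hU : IsPreconnected U := by
    refine (isPreconnected_Ico.prod isPreconnected_univ).image _ (Continuous.continuousOn ?_)
    exact (Complex.continuous_ofReal.comp continuous_fst).mul (h.continuous.comp continuous_snd)
  have hUf : Disjoint U (frontier Ω) := by
    rw [Set.disjoint_left]
    rintro _ ⟨⟨r, s⟩, ⟨⟨h0, h1⟩, -⟩, rfl⟩ hf
    rw [← h.srange] at hf
    obtain ⟨t, ht⟩ := hf
    simp only at ht h0 h1
    rcases h0.eq_or_lt with h0 | h0
    · rw [← h0] at ht; simp [h.ne_zero] at ht
    · have := (h.polar_unique h0 one_pos (show (r : ℂ) * γ s = (1 : ℝ) * γ t by simp [ht])).1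
      linarith
  have h0 : (0 : ℂ) ∈ U := ⟨(0, 0), ⟨⟨le_rfl, one_pos⟩, trivial⟩, by simp⟩
  exact IsPreconnected.subset_of_disjoint_frontier' hU h.isOpen hUf ⟨0, h0, h.zero_mem⟩
    ⟨(r, s), ⟨⟨hr0, hr⟩, trivial⟩, rfl⟩

theorem smul_notMem_closure_of_gt (h : StarDomain Ω γ L c) {r : ℝ} (hr : 1 < r) (s : ℝ) :
    (r : ℂ) * γ s ∉ closure Ω := by
  let U : Set ℂ := (fun p : ℝ × ℝ => (p.1 : ℂ) * γ p.2) '' (Set.Ioi (1 : ℝ) ×ˢ Set.univ)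
  have hU : IsPreconnected U := by
    refine (isPreconnected_Ioi.prod isPreconnected_univ).image _ (Continuous.continuousOn ?_)
    exact (Complex.continuous_ofReal.comp continuous_fst).mul (h.continuous.comp continuous_snd)
  have hUf : Disjoint U (frontier Ω) := by
    rw [Set.disjoint_left]
    rintro _ ⟨⟨r, s⟩, ⟨h1, -⟩, rfl⟩ hf
    rw [← h.srange] at hf
    obtain ⟨t, ht⟩ := hf
    simp only [Set.mem_Ioi] at ht h1
    have := (h.polar_unique (one_pos.trans h1) one_pos
      (show (r : ℂ) * γ s = (1 : ℝ) * γ t by simp [ht])).1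
    linarith
  have hmem : ∀ r : ℝ, 1 < r → (r : ℂ) * γ s ∈ U := fun r hr => ⟨(r, s), ⟨hr, trivial⟩, rfl⟩
  intro hcl
  have hΩ : (r : ℂ) * γ s ∈ Ω := by
    by_contra hΩ
    exact Set.disjoint_left.1 hUf (hmem r hr) (by rw [h.isOpen.frontier_eq]; exact ⟨hcl, hΩ⟩)
  have hsub := IsPreconnected.subset_of_disjoint_frontier' hU h.isOpen hUf ⟨_, hmem r hr, hΩ⟩
  obtain ⟨B, hB⟩ := h.bounded.exists_norm_le
  have h1 := hB _ (hsub (hmem (|B| / c + 2) (by have := h.cpos; have : 0 ≤ |B| / c := by positivity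
                                                linarith)))
  rw [norm_mul, Complex.norm_real, Real.norm_eq_abs] at h1
  have hc := h.cpos
  have h2 : 0 ≤ |B| / c := by positivity
  rw [abs_of_pos (by linarith)] at h1
  have h3 : (|B| / c + 2) * c ≤ (|B| / c + 2) * ‖γ s‖ :=
    mul_le_mul_of_nonneg_left (h.le_norm s) (by linarith)
  have h4 : (|B| / c + 2) * c = |B| + 2 * c := by field_simp
  linarith [le_abs_self B]

theorem mem_frontier (h : StarDomain Ω γ L c) (s : ℝ) : γ s ∈ frontier Ω := by
  rw [← h.srange]; exact Set.mem_range_self s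

theorem smul_mem_iff (h : StarDomain Ω γ L c) {r : ℝ} (hr0 : 0 ≤ r) (s : ℝ) :
    (r : ℂ) * γ s ∈ Ω ↔ r < 1 := by
  refine ⟨fun hm => ?_, fun hr => h.smul_mem_of_lt hr0 hr s⟩
  rcases lt_trichotomy r 1 with h1 | h1 | h1
  · exact h1
  · have := h.mem_frontier s
    rw [h.isOpen.frontier_eq] at this
    exact absurd (by simpa [h1] using hm) this.2
  · exact absurd (subset_closure hm) (h.smul_notMem_closure_of_gt h1 s)

end StarDomain

theorem sq_le_crossC_sq {p t n : ℂ} {c : ℝ} (hc : 0 ≤ c) (ht : ‖t‖ = 1) (hn : ‖n‖ = 1)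
    (ho : n.re * t.re + n.im * t.im = 0) (h : c ≤ p.re * n.re + p.im * n.im) :
    c ^ 2 ≤ crossC p t ^ 2 := by
  have ht' : t.re * t.re + t.im * t.im = 1 := by
    rw [← Complex.normSq_apply, Complex.normSq_eq_norm_sq, ht]; norm_num
  have hn' : n.re * n.re + n.im * n.im = 1 := by
    rw [← Complex.normSq_apply, Complex.normSq_eq_norm_sq, hn]; norm_num
  have h1 : crossC p t = (p.re * n.re + p.im * n.im) * crossC n t := by
    simp only [crossC]
    linear_combination (-(p.re * t.im - p.im * t.re)) * hn' +
      (p.re * n.im - p.im * n.re) * ho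
  have h2 : crossC n t ^ 2 = 1 := by
    simp only [crossC]
    linear_combination (t.re * t.re + t.im * t.im) * hn' + ht' -
      (n.re * t.re + n.im * t.im) * ho
  rw [h1, mul_pow, h2, mul_one]
  exact pow_le_pow_left₀ hc h 2

theorem BoundaryParam.reverse {Ω : Set ℂ} {γ : ℝ → ℂ} {L : ℝ} (h : BoundaryParam Ω γ L) :
    BoundaryParam Ω (fun s => γ (-s)) L where
  Lpos := h.Lpos
  smooth := h.smooth.comp contDiff_neg
  periodic s := by
    change γ (-(s + L)) = γ (-s)
    rw [neg_add, ← sub_eq_add_neg]; exact h.periodic.sub_eq (-s)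
  arclength s := by rw [deriv_comp_neg, norm_neg, h.arclength]
  inj s t hst := by
    obtain ⟨k, hk⟩ := h.inj _ _ hst
    exact ⟨-k, by push_cast; linarith⟩
  srange := by
    rw [← h.srange]
    exact (Equiv.neg ℝ).surjective.range_comp γ

/-- Up to reversing the boundary parametrization, a strictly star-shaped domain is a
`StarDomain`. -/
theorem exists_starDomain {Ω : Set ℂ} (hΩo : IsOpen Ω) (hΩb : IsBounded Ω) (h0 : (0 : ℂ) ∈ Ω)
    {γ : ℝ → ℂ} {L : ℝ} (hγ : BoundaryParam Ω γ L) {nv : ℝ → ℂ} (hn : OutwardNormal Ω γ nv)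
    {c : ℝ} (hc : 0 < c) (hstar : ∀ s, c ≤ (γ s).re * (nv s).re + (γ s).im * (nv s).im) :
    ∃ γ' : ℝ → ℂ, StarDomain Ω γ' L c := by
  have hsq : ∀ s, c ≤ |crossC (γ s) (deriv γ s)| := fun s =>
    abs_le_of_sq_le_sq' ((sq_le_crossC_sq hc.le (hγ.arclength s) (hn.unit s) (hn.orth s)
      (hstar s)).trans_eq (sq_abs _).symm) (abs_nonneg _) |>.2
  have hcont : Continuous fun s => crossC (γ s) (deriv γ s) :=
    continuous_crossC hγ.smooth.continuous (hγ.smooth.continuous_deriv (by simp))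
  by_cases hpos : ∃ s, c ≤ crossC (γ s) (deriv γ s)
  · obtain ⟨s₀, hs₀⟩ := hpos
    refine ⟨γ, { hγ with isOpen := hΩo, bounded := hΩb, zero_mem := h0, cpos := hc, star := ?_ }⟩
    intro s
    by_contra hs
    have : crossC (γ s) (deriv γ s) ≤ 0 := by
      rcases le_abs.1 (hsq s) with h1 | h1
      · exact absurd h1 hs
      · linarith
    obtain ⟨t, ht⟩ := mem_range_of_exists_le_of_exists_ge hcont ⟨s, this⟩ ⟨s₀, hc.le.trans hs₀⟩
    have := hsq t
    simp only at ht
    rw [ht, abs_zero] at this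
    linarith
  · push Not at hpos
    refine ⟨fun s => γ (-s), { hγ.reverse with
      isOpen := hΩo, bounded := hΩb, zero_mem := h0, cpos := hc, star := ?_ }⟩
    intro s
    rw [deriv_comp_neg]
    have h1 := hpos (-s)
    rcases le_abs.1 (hsq (-s)) with h2 | h2
    · linarith
    · simp only [crossC, Complex.neg_re, Complex.neg_im] at h2 ⊢; linarith

theorem fderiv_prod_fst {F : ℝ × ℝ → ℝ} (hF : ContDiff ℝ (⊤ : ℕ∞) F) {r s D : ℝ}
    (h : HasDerivAt (fun r => F (r, s)) D r) : fderiv ℝ F (r, s) (1, 0) = D := by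
  have h1 : HasDerivAt (fun r : ℝ => (r, s)) (1, 0) r :=
    (hasDerivAt_id r).prodMk (hasDerivAt_const r s)
  have hd : DifferentiableAt ℝ F (r, s) := hF.differentiable (by simp) _
  exact (hd.hasFDerivAt.comp_hasDerivAt r h1).unique h

theorem fderiv_prod_snd {F : ℝ × ℝ → ℝ} (hF : ContDiff ℝ (⊤ : ℕ∞) F) {r s D : ℝ}
    (h : HasDerivAt (fun s => F (r, s)) D s) : fderiv ℝ F (r, s) (0, 1) = D := by
  have h1 : HasDerivAt (fun s : ℝ => (r, s)) (0, 1) s :=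
    (hasDerivAt_const s r).prodMk (hasDerivAt_id s)
  have hd : DifferentiableAt ℝ F (r, s) := hF.differentiable (by simp) _
  exact (hd.hasFDerivAt.comp_hasDerivAt s h1).unique h

/-- Green's theorem on a rectangle, with explicit partial derivatives. -/
theorem integral_box_divergence {f g fr gs : ℝ × ℝ → ℝ} (hf : ContDiff ℝ (⊤ : ℕ∞) f)
    (hg : ContDiff ℝ (⊤ : ℕ∞) g) {a b c d : ℝ} (hab : a ≤ b) (hcd : c ≤ d)
    (hfr : ∀ r s, HasDerivAt (fun r => f (r, s)) (fr (r, s)) r)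
    (hgs : ∀ r s, HasDerivAt (fun s => g (r, s)) (gs (r, s)) s) :
    ∫ p in Set.Icc a b ×ˢ Set.Icc c d, (fr p + gs p) =
      (((∫ r in a..b, g (r, d)) - ∫ r in a..b, g (r, c)) + ∫ s in c..d, f (b, s)) -
        ∫ s in c..d, f (a, s) := by
  have e : ∀ p : ℝ × ℝ, fr p + gs p = fderiv ℝ f p (1, 0) + fderiv ℝ g p (0, 1) := fun p => by
    rw [fderiv_prod_fst hf (hfr p.1 p.2), fderiv_prod_snd hg (hgs p.1 p.2)]
  simp_rw [e]
  rw [Set.Icc_prod_Icc]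
  refine integral_divergence_prod_Icc_of_hasFDerivAt_of_le f g (fderiv ℝ f) (fderiv ℝ g) (a, c)
    (b, d) ⟨hab, hcd⟩ hf.continuous.continuousOn hg.continuous.continuousOn
    (fun x _ => (hf.differentiable (by simp) x).hasFDerivAt)
    (fun x _ => (hg.differentiable (by simp) x).hasFDerivAt) ?_
  refine ContinuousOn.integrableOn_compact isCompact_Icc (Continuous.continuousOn ?_)
  exact ((hf.continuous_fderiv (by simp)).clm_apply continuous_const).add
    ((hg.continuous_fderiv (by simp)).clm_apply continuous_const)

namespace StarDomain

variable {Ω : Set ℂ} {γ : ℝ → ℂ} {L c : ℝ}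

/-- The part of the domain outside the dilated copy `aΩ`. -/
def shell (γ : ℝ → ℂ) (L a : ℝ) : Set ℂ :=
  (fun p : ℝ × ℝ => (p.1 : ℂ) * γ p.2) '' (Set.Ioo a 1 ×ˢ Set.Ico 0 L)

/-- The Jacobian density `γ × γ'` of polar coordinates adapted to `γ`. -/
def jac (γ : ℝ → ℂ) (s : ℝ) : ℝ := crossC (γ s) (deriv γ s)

theorem continuous_jac (h : StarDomain Ω γ L c) : Continuous (jac γ) :=
  continuous_crossC h.continuous h.continuous_deriv

theorem jac_pos (h : StarDomain Ω γ L c) (s : ℝ) : 0 < jac γ s := h.cpos.trans_le (h.star s)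

theorem polar_injOn (h : StarDomain Ω γ L c) :
    Set.InjOn (fun p : ℝ × ℝ => (p.1 : ℂ) * γ p.2) (Set.Ioi 0 ×ˢ Set.Ico 0 L) := by
  rintro ⟨r, s⟩ ⟨hr, hs⟩ ⟨r', s'⟩ ⟨hr', hs'⟩ heq
  simp only [Set.mem_Ioi, Set.mem_Ico] at hr hs hr' hs' heq
  obtain ⟨h1, k, hk⟩ := h.polar_unique hr hr' heq
  have hL := h.Lpos
  have k1 : (k : ℝ) < 1 := by by_contra hh; push Not at hh; nlinarith
  have k2 : (-1 : ℝ) < k := by by_contra hh; push Not at hh; nlinarith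
  have k1' : k < 1 := by exact_mod_cast k1
  have k2' : -1 < k := by exact_mod_cast k2
  have : k = 0 := by omega
  rw [this] at hk
  ext
  · exact h1
  · simp at hk; simp; linarith

theorem shell_subset (h : StarDomain Ω γ L c) {a : ℝ} (ha : 0 ≤ a) : shell γ L a ⊆ Ω := by
  rintro _ ⟨⟨r, s⟩, ⟨⟨h1, h2⟩, -⟩, rfl⟩
  exact h.smul_mem_of_lt (ha.trans h1.le) h2 s

theorem shell_zero (h : StarDomain Ω γ L c) : shell γ L 0 = Ω \ {0} := by
  ext z
  constructor
  · intro hz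
    refine ⟨h.shell_subset le_rfl hz, ?_⟩
    obtain ⟨⟨r, s⟩, ⟨⟨h1, h2⟩, -⟩, rfl⟩ := hz
    simp only [Set.mem_singleton_iff, mul_eq_zero, Complex.ofReal_eq_zero, h.ne_zero, or_false]
    exact h1.ne'
  · rintro ⟨hz, hz0⟩
    obtain ⟨r, hr, s, hs, rfl⟩ := h.polar_surj hz0
    exact ⟨(r, s), ⟨⟨hr, (h.smul_mem_iff hr.le s).1 hz⟩, hs⟩, rfl⟩

theorem shell_zero_ae_eq (h : StarDomain Ω γ L c) : shell γ L 0 =ᵐ[volume] Ω := by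
  rw [h.shell_zero]
  exact sdiff_null_ae_eq_self (measure_singleton _)

/-- Polar coordinates adapted to `γ`, in real coordinates. -/
def realPolar (γ : ℝ → ℂ) (p : ℝ × ℝ) : ℝ × ℝ := (p.1 * (γ p.2).re, p.1 * (γ p.2).im)

/-- The derivative of `realPolar`. -/
def realPolarDeriv (γ : ℝ → ℂ) (p : ℝ × ℝ) : ℝ × ℝ →L[ℝ] ℝ × ℝ :=
  (Matrix.toLin (Module.Basis.finTwoProd ℝ) (Module.Basis.finTwoProd ℝ)
    !![(γ p.2).re, p.1 * (deriv γ p.2).re;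
      (γ p.2).im, p.1 * (deriv γ p.2).im]).toContinuousLinearMap

theorem equivRealProd_symm_realPolar (p : ℝ × ℝ) :
    Complex.measurableEquivRealProd.symm (realPolar γ p) = (p.1 : ℂ) * γ p.2 := by
  apply Complex.ext <;> simp [realPolar, Complex.measurableEquivRealProd]

theorem contDiff_realPolar (h : StarDomain Ω γ L c) : ContDiff ℝ (⊤ : ℕ∞) (realPolar γ) :=
  (contDiff_fst.mul (Complex.reCLM.contDiff.comp (h.smooth.comp contDiff_snd))).prodMk
    (contDiff_fst.mul (Complex.imCLM.contDiff.comp (h.smooth.comp contDiff_snd)))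

theorem hasFDerivAt_realPolar (h : StarDomain Ω γ L c) (p : ℝ × ℝ) :
    HasFDerivAt (realPolar γ) (realPolarDeriv γ p) p := by
  have hdre : ∀ s, HasDerivAt (fun s => (γ s).re) (deriv γ s).re s := fun s =>
    Complex.reCLM.hasFDerivAt.comp_hasDerivAt s (h.hasDerivAt s)
  have hdim : ∀ s, HasDerivAt (fun s => (γ s).im) (deriv γ s).im s := fun s =>
    Complex.imCLM.hasFDerivAt.comp_hasDerivAt s (h.hasDerivAt s)
  rw [realPolarDeriv, Matrix.toLin_finTwoProd_toContinuousLinearMap]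
  convert! HasFDerivAt.prodMk (𝕜 := ℝ)
    (hasFDerivAt_fst.mul ((hdre p.2).comp_hasFDerivAt p hasFDerivAt_snd))
    (hasFDerivAt_fst.mul ((hdim p.2).comp_hasFDerivAt p hasFDerivAt_snd)) using 2 <;>
  simp [smul_smul, add_comm]

theorem det_realPolarDeriv (p : ℝ × ℝ) : (realPolarDeriv γ p).det = p.1 * jac γ p.2 := by
  simp only [realPolarDeriv, LinearMap.det_toContinuousLinearMap, LinearMap.det_toLin,
    Matrix.det_fin_two_of, jac, crossC]
  ring

theorem integral_shell (h : StarDomain Ω γ L c) {a : ℝ} (ha : 0 ≤ a) (f : ℂ → ℝ) :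
    ∫ z in shell γ L a, f z =
      ∫ p in Set.Icc a 1 ×ˢ Set.Icc 0 L, p.1 * jac γ p.2 * f ((p.1 : ℂ) * γ p.2) := by
  let e := Complex.measurableEquivRealProd
  have heP : ∀ p : ℝ × ℝ, e.symm (realPolar γ p) = (p.1 : ℂ) * γ p.2 :=
    equivRealProd_symm_realPolar
  have hS : MeasurableSet (Set.Ioo a 1 ×ˢ Set.Ico 0 L) := measurableSet_Ioo.prod measurableSet_Ico
  have hinj : Set.InjOn (realPolar γ) (Set.Ioo a 1 ×ˢ Set.Ico 0 L) := by
    intro p hp q hq hpq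
    refine h.polar_injOn ⟨ha.trans_lt hp.1.1, hp.2⟩ ⟨ha.trans_lt hq.1.1, hq.2⟩ ?_
    simp only [← heP, hpq]
  have himg : shell γ L a = e.symm '' (realPolar γ '' (Set.Ioo a 1 ×ˢ Set.Ico 0 L)) := by
    rw [← Set.image_comp]
    simp only [shell, Function.comp_def, heP]
  rw [himg, (Complex.volume_preserving_equiv_real_prod.symm e).setIntegral_image_emb
    e.symm.measurableEmbedding,
    integral_image_eq_integral_abs_det_fderiv_smul volume hS
      (fun x _ => (h.hasFDerivAt_realPolar x).hasFDerivWithinAt) hinj]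
  have hset : (Set.Ioo a 1 ×ˢ Set.Ico 0 L : Set (ℝ × ℝ)) =ᵐ[volume]
      (Set.Icc a 1 ×ˢ Set.Icc 0 L : Set (ℝ × ℝ)) :=
    Measure.set_prod_ae_eq Ioo_ae_eq_Icc Ico_ae_eq_Icc
  rw [← setIntegral_congr_set hset]
  refine setIntegral_congr_fun hS fun p hp => ?_
  simp only [heP, det_realPolarDeriv, smul_eq_mul]
  rw [abs_of_pos (mul_pos (ha.trans_lt hp.1.1) (h.jac_pos _))]

theorem integral_eq_polar (h : StarDomain Ω γ L c) (f : ℂ → ℝ) :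
    ∫ z in Ω, f z =
      ∫ p in Set.Icc (0 : ℝ) 1 ×ˢ Set.Icc 0 L, p.1 * jac γ p.2 * f ((p.1 : ℂ) * γ p.2) := by
  rw [← h.integral_shell le_rfl, setIntegral_congr_set h.shell_zero_ae_eq]

/-- The divergence theorem on a star-shaped domain. -/
theorem integral_divergence (h : StarDomain Ω γ L c) {X Y : ℂ → ℝ} (hX : Smooth X)
    (hY : Smooth Y) :
    ∫ z in Ω, (dx X z + dy Y z) =
      ∫ s in (0 : ℝ)..L, (X (γ s) * (deriv γ s).im - Y (γ s) * (deriv γ s).re) := by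
  rw [h.integral_eq_polar]
  have sγ := h.smooth
  have sγ' := h.smooth_deriv
  have s1 : ContDiff ℝ (⊤ : ℕ∞) fun p : ℝ × ℝ => (p.1 : ℂ) * γ p.2 :=
    (Complex.ofRealCLM.contDiff.comp contDiff_fst).mul (sγ.comp contDiff_snd)
  have sX : ContDiff ℝ (⊤ : ℕ∞) fun p : ℝ × ℝ => X ((p.1 : ℂ) * γ p.2) := hX.comp s1
  have sY : ContDiff ℝ (⊤ : ℕ∞) fun p : ℝ × ℝ => Y ((p.1 : ℂ) * γ p.2) := hY.comp s1
  have sre : ContDiff ℝ (⊤ : ℕ∞) fun p : ℝ × ℝ => (γ p.2).re :=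
    Complex.reCLM.contDiff.comp (sγ.comp contDiff_snd)
  have sim : ContDiff ℝ (⊤ : ℕ∞) fun p : ℝ × ℝ => (γ p.2).im :=
    Complex.imCLM.contDiff.comp (sγ.comp contDiff_snd)
  have sre' : ContDiff ℝ (⊤ : ℕ∞) fun p : ℝ × ℝ => (deriv γ p.2).re :=
    Complex.reCLM.contDiff.comp (sγ'.comp contDiff_snd)
  have sim' : ContDiff ℝ (⊤ : ℕ∞) fun p : ℝ × ℝ => (deriv γ p.2).im :=
    Complex.imCLM.contDiff.comp (sγ'.comp contDiff_snd)
  have cr : ∀ r s : ℝ, HasDerivAt (fun r : ℝ => (r : ℂ) * γ s) (γ s) r := fun r s => by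
    simpa using (Complex.ofRealCLM.hasDerivAt (x := r)).mul_const (γ s)
  have cs : ∀ r s : ℝ, HasDerivAt (fun s : ℝ => (r : ℂ) * γ s) ((r : ℂ) * deriv γ s) s :=
    fun r s => (h.hasDerivAt s).const_mul _
  have hdre : ∀ s, HasDerivAt (fun s => (γ s).re) (deriv γ s).re s := fun s =>
    Complex.reCLM.hasFDerivAt.comp_hasDerivAt s (h.hasDerivAt s)
  have hdim : ∀ s, HasDerivAt (fun s => (γ s).im) (deriv γ s).im s := fun s =>
    Complex.imCLM.hasFDerivAt.comp_hasDerivAt s (h.hasDerivAt s)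
  have key := integral_box_divergence (a := 0) (b := 1) (c := 0) (d := L)
    (f := fun p => p.1 * (X ((p.1 : ℂ) * γ p.2) * (deriv γ p.2).im -
      Y ((p.1 : ℂ) * γ p.2) * (deriv γ p.2).re))
    (g := fun p => Y ((p.1 : ℂ) * γ p.2) * (γ p.2).re - X ((p.1 : ℂ) * γ p.2) * (γ p.2).im)
    (fr := fun p => (X ((p.1 : ℂ) * γ p.2) * (deriv γ p.2).im -
      Y ((p.1 : ℂ) * γ p.2) * (deriv γ p.2).re) + p.1 *
        (((γ p.2).re * dx X ((p.1 : ℂ) * γ p.2) + (γ p.2).im * dy X ((p.1 : ℂ) * γ p.2)) *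
          (deriv γ p.2).im -
        ((γ p.2).re * dx Y ((p.1 : ℂ) * γ p.2) + (γ p.2).im * dy Y ((p.1 : ℂ) * γ p.2)) *
          (deriv γ p.2).re))
    (gs := fun p =>
      ((((p.1 : ℂ) * deriv γ p.2).re * dx Y ((p.1 : ℂ) * γ p.2) +
        ((p.1 : ℂ) * deriv γ p.2).im * dy Y ((p.1 : ℂ) * γ p.2)) * (γ p.2).re +
        Y ((p.1 : ℂ) * γ p.2) * (deriv γ p.2).re) -
      ((((p.1 : ℂ) * deriv γ p.2).re * dx X ((p.1 : ℂ) * γ p.2) +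
        ((p.1 : ℂ) * deriv γ p.2).im * dy X ((p.1 : ℂ) * γ p.2)) * (γ p.2).im +
        X ((p.1 : ℂ) * γ p.2) * (deriv γ p.2).im))
    (contDiff_fst.mul ((sX.mul sim').sub (sY.mul sre'))) ((sY.mul sre).sub (sX.mul sim))
    zero_le_one h.Lpos.le
    (fun r s => by
      have := (hasDerivAt_id r).mul (((hasDerivAt_comp_curve hX (cr r s)).mul_const
        (deriv γ s).im).sub ((hasDerivAt_comp_curve hY (cr r s)).mul_const (deriv γ s).re))
      rw [one_mul] at this
      exact this)
    (fun r s => ((hasDerivAt_comp_curve hY (cs r s)).mul (hdre s)).sub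
        ((hasDerivAt_comp_curve hX (cs r s)).mul (hdim s)))
  have hL : γ L = γ 0 := by simpa using h.periodic 0
  simp only [Complex.ofReal_zero, zero_mul, intervalIntegral.integral_zero, sub_zero,
    Complex.ofReal_one, one_mul, hL, sub_self, zero_add] at key
  rw [← key]
  congr 1
  funext p
  simp only [jac, crossC, Complex.mul_re, Complex.mul_im, Complex.ofReal_re, Complex.ofReal_im,
    zero_mul, sub_zero, add_zero]
  ring

end StarDomain

/-- The inverse function theorem, as the existence of a smooth local right inverse. -/
theorem exists_local_right_inverse {E : Type*} [NormedAddCommGroup E] [NormedSpace ℝ E]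
    [CompleteSpace E] {f : E → E} (hf : ContDiff ℝ (⊤ : ℕ∞) f) {f' : E ≃L[ℝ] E} {a : E}
    (hf' : HasFDerivAt f (f' : E →L[ℝ] E) a) :
    ∃ q : E → E, ContDiffAt ℝ (⊤ : ℕ∞) q (f a) ∧ q (f a) = a ∧ ∀ᶠ y in 𝓝 (f a), f (q y) = y :=
  ⟨hf.contDiffAt.localInverse hf' (by simp), hf.contDiffAt.to_localInverse hf' (by simp),
    hf.contDiffAt.localInverse_apply_image hf' (by simp),
    (hf.contDiffAt.hasStrictFDerivAt' hf' (by simp)).eventually_right_inverse⟩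

namespace StarDomain

variable {Ω : Set ℂ} {γ : ℝ → ℂ} {L c : ℝ}

/-- The gauge (Minkowski functional) of a star domain: homogeneous, and smooth off the origin. -/
theorem exists_gauge (h : StarDomain Ω γ L c) :
    ∃ ρ : ℂ → ℝ, (∀ r : ℝ, 0 ≤ r → ∀ s, ρ ((r : ℂ) * γ s) = r) ∧
      ∀ z : ℂ, z ≠ 0 → ContDiffAt ℝ (⊤ : ℕ∞) ρ z := by
  choose! R hR S hS hRS using fun (z : ℂ) (hz : z ≠ 0) => h.polar_surj hz
  let ρ : ℂ → ℝ := fun z => if z = 0 then 0 else R z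
  have hρ : ∀ r : ℝ, 0 ≤ r → ∀ s, ρ ((r : ℂ) * γ s) = r := by
    intro r hr s
    rcases hr.eq_or_lt with rfl | hr
    · simp [ρ]
    · have hz : (r : ℂ) * γ s ≠ 0 := mul_ne_zero (by exact_mod_cast hr.ne') (h.ne_zero s)
      simp only [ρ, if_neg hz]
      exact (h.polar_unique hr (hR _ hz) (hRS _ hz)).1.symm
  refine ⟨ρ, hρ, fun z hz => ?_⟩
  obtain ⟨r, hr, s, -, rfl⟩ := h.polar_surj hz
  have hdet : (realPolarDeriv γ (r, s)).det ≠ 0 := by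
    rw [det_realPolarDeriv]
    exact (mul_pos hr (h.jac_pos s)).ne'
  obtain ⟨q, hq, hqa, hqr⟩ := exists_local_right_inverse h.contDiff_realPolar
    (f' := (realPolarDeriv γ (r, s)).toContinuousLinearEquivOfDetNeZero hdet) (a := (r, s))
    (by rw [ContinuousLinearMap.coe_toContinuousLinearEquivOfDetNeZero]
        exact h.hasFDerivAt_realPolar _)
  have heq : ∀ z : ℂ, equivRealProdCLM z = (z.re, z.im) := fun z => rfl
  have hP : equivRealProdCLM ((r : ℂ) * γ s) = realPolar γ (r, s) := by
    simp [heq, realPolar]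
  have hq' : ContDiffAt ℝ (⊤ : ℕ∞) (fun z => (q (equivRealProdCLM z)).1) ((r : ℂ) * γ s) := by
    refine contDiff_fst.contDiffAt.comp _ (ContDiffAt.comp _ ?_
      equivRealProdCLM.contDiff.contDiffAt)
    rw [hP]; exact hq
  refine hq'.congr_of_eventuallyEq ?_
  have hcont : Tendsto (fun z => equivRealProdCLM z) (𝓝 ((r : ℂ) * γ s))
      (𝓝 (realPolar γ (r, s))) := by
    rw [← hP]; exact equivRealProdCLM.continuous.continuousAt
  have hpos : ∀ᶠ y in 𝓝 (realPolar γ (r, s)), 0 < (q y).1 := by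
    have h1 : Tendsto (fun y => (q y).1) (𝓝 (realPolar γ (r, s))) (𝓝 r) := by
      have h2 := hq.continuousAt.fst
      rw [ContinuousAt, hqa] at h2
      exact h2
    exact h1.eventually (lt_mem_nhds hr)
  filter_upwards [hcont.eventually hqr, hcont.eventually hpos] with z h1 h2
  have h3 : z = ((q (equivRealProdCLM z)).1 : ℂ) * γ (q (equivRealProdCLM z)).2 := by
    have h4 := equivRealProd_symm_realPolar (γ := γ) (q (equivRealProdCLM z))
    rw [h1] at h4
    rw [← h4]
    rfl
  conv_lhs => rw [h3]
  exact hρ _ h2.le _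

/-- The derivative of `Real.smoothTransition` is bounded. -/
theorem exists_deriv_smoothTransition_bound : ∃ B : ℝ, 0 ≤ B ∧
    ∀ t, |deriv Real.smoothTransition t| ≤ B := by
  have h1 : Continuous (deriv Real.smoothTransition) :=
    (Real.smoothTransition.contDiff (n := 1)).continuous_deriv (by simp)
  have h2 : HasCompactSupport (deriv Real.smoothTransition) := by
    refine HasCompactSupport.intro (isCompact_Icc (a := (0 : ℝ)) (b := 1)) fun t ht => ?_
    simp only [Set.mem_Icc, not_and_or, not_le] at ht
    rcases ht with ht | ht
    · have : Real.smoothTransition =ᶠ[𝓝 t] fun _ => 0 := by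
        filter_upwards [gt_mem_nhds ht] with x hx
        exact Real.smoothTransition.zero_of_nonpos hx.le
      rw [this.deriv_eq, deriv_const]
    · have : Real.smoothTransition =ᶠ[𝓝 t] fun _ => 1 := by
        filter_upwards [lt_mem_nhds ht] with x hx
        exact Real.smoothTransition.one_of_one_le hx.le
      rw [this.deriv_eq, deriv_const]
  obtain ⟨B, hB⟩ := h2.exists_bound_of_continuous h1
  exact ⟨B, (norm_nonneg _).trans (hB 0), hB⟩

theorem exists_cutoff (h : StarDomain Ω γ L c) : ∃ B : ℝ, 0 ≤ B ∧ ∀ δ : ℝ, 0 < δ → δ ≤ 1 / 2 →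
    ∃ η : ℂ → ℝ, Smooth η ∧ (∀ z, 0 ≤ η z) ∧ (∀ z, η z ≤ 1) ∧
      (∀ z, |dx η z| ≤ B / δ) ∧ (∀ z, |dy η z| ≤ B / δ) ∧
      (∀ z, z ∉ Ω → η z = 0 ∧ dx η z = 0 ∧ dy η z = 0) ∧
      (∀ z ∈ Ω, z ∉ shell γ L (1 - δ) → η z = 1 ∧ dx η z = 0 ∧ dy η z = 0) := by
  obtain ⟨ρ, hρ, hρs⟩ := h.exists_gauge
  obtain ⟨B₁, hB₁, hψ⟩ := exists_deriv_smoothTransition_bound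
  let K : Set ℂ := (fun p : ℝ × ℝ => (p.1 : ℂ) * γ p.2) '' (Set.Icc (1 / 2) 1 ×ˢ Set.Icc 0 L)
  have hKc : IsCompact K := by
    refine (isCompact_Icc.prod isCompact_Icc).image ?_
    exact (Complex.continuous_ofReal.comp continuous_fst).mul (h.continuous.comp continuous_snd)
  have hfd : ∀ z : ℂ, z ≠ 0 → ContinuousAt (fderiv ℝ ρ) z := fun z hz =>
    ((hρs z hz).fderiv_right (m := 0) (by simp)).continuousAt
  have hK0 : ∀ z ∈ K, z ≠ 0 := by
    rintro _ ⟨p, ⟨⟨hp, -⟩, -⟩, rfl⟩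
    refine mul_ne_zero ?_ (h.ne_zero _)
    have : (0 : ℝ) < p.1 := lt_of_lt_of_le (by norm_num) hp
    exact_mod_cast this.ne'
  obtain ⟨B₂, hB₂⟩ := hKc.exists_bound_of_continuousOn
    (fun z hz => (hfd z (hK0 z hz)).continuousWithinAt)
  refine ⟨B₁ * (2 * |B₂|), by positivity, fun δ hδ hδ2 => ?_⟩
  let η : ℂ → ℝ := fun z => Real.smoothTransition (2 * (1 - ρ z) / δ - 1)
  have hη0 : ∀ z, 0 ≤ η z := fun z => Real.smoothTransition.nonneg _
  have hη1 : ∀ z, η z ≤ 1 := fun z => Real.smoothTransition.le_one _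
  have one_of : ∀ r : ℝ, 0 ≤ r → r ≤ 1 - δ → ∀ s, η ((r : ℂ) * γ s) = 1 := by
    intro r hr hr1 s
    refine Real.smoothTransition.one_of_one_le ?_
    rw [hρ r hr, le_sub_iff_add_le, le_div_iff₀ hδ]
    linarith
  have zero_of : ∀ r : ℝ, 1 ≤ r → ∀ s, η ((r : ℂ) * γ s) = 0 := by
    intro r hr1 s
    refine Real.smoothTransition.zero_of_nonpos ?_
    rw [hρ r (by linarith), sub_nonpos, div_le_one hδ]
    linarith
  have hη00 : η 0 = 1 := by simpa using one_of 0 le_rfl (by linarith) 0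
  have hηs : Smooth η := by
    refine contDiff_iff_contDiffAt.2 fun z => ?_
    by_cases hz : z = 0
    · subst hz
      refine (contDiffAt_const (c := (1 : ℝ))).congr_of_eventuallyEq ?_
      filter_upwards [Metric.ball_mem_nhds (0 : ℂ) (half_pos h.cpos)] with z hz
      by_cases hz0 : z = 0
      · rw [hz0, hη00]
      · obtain ⟨r, hr, s, -, rfl⟩ := h.polar_surj hz0
        refine one_of r hr.le ?_ s
        rw [mem_ball_zero_iff, norm_mul, Complex.norm_real, Real.norm_of_nonneg hr.le] at hz
        have h1 := mul_le_mul_of_nonneg_left (h.le_norm s) hr.le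
        have h2 : r < 1 / 2 := by
          by_contra hh
          push Not at hh
          have := mul_le_mul_of_nonneg_right hh h.cpos.le
          linarith
        linarith
    · refine ContDiffAt.comp z Real.smoothTransition.contDiff.contDiffAt ?_
      exact ((contDiffAt_const.mul (contDiffAt_const.sub (hρs z hz))).div_const _).sub
        contDiffAt_const
  have crit0 : ∀ z, η z = 0 → fderiv ℝ η z = 0 := fun z hz =>
    IsLocalMin.fderiv_eq_zero (Filter.Eventually.of_forall fun w => by rw [hz]; exact hη0 w)
  have crit1 : ∀ z, η z = 1 → fderiv ℝ η z = 0 := fun z hz =>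
    IsLocalMax.fderiv_eq_zero (Filter.Eventually.of_forall fun w => by rw [hz]; exact hη1 w)
  have hbd : ∀ z v : ℂ, ‖v‖ = 1 → |fderiv ℝ η z v| ≤ B₁ * (2 * |B₂|) / δ := by
    intro z v hv
    have triv : fderiv ℝ η z = 0 → |fderiv ℝ η z v| ≤ B₁ * (2 * |B₂|) / δ := fun h0 => by
      rw [h0]; simp only [zero_apply, abs_zero]; positivity
    by_cases hz : z = 0
    · exact triv (crit1 z (hz ▸ hη00))
    obtain ⟨r, hr, s, hs, hzr⟩ := h.polar_surj hz
    rcases lt_or_ge r (1 / 2) with h1 | h1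
    · exact triv (crit1 z (by rw [hzr]; exact one_of r hr.le (by linarith) s))
    rcases lt_or_ge 1 r with h2 | h2
    · exact triv (crit0 z (by rw [hzr]; exact zero_of r h2.le s))
    have hzK : z ∈ K := ⟨(r, s), ⟨⟨h1, h2⟩, ⟨hs.1, hs.2.le⟩⟩, hzr.symm⟩
    have hd : HasFDerivAt (fun z => 2 * (1 - ρ z) / δ - 1)
        ((δ⁻¹ : ℝ) • (2 : ℝ) • (-fderiv ℝ ρ z)) z := by
      have := ((((hρs z hz).differentiableAt (by simp)).hasFDerivAt.const_sub 1).const_mul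
        2).mul_const δ⁻¹
      exact this.sub_const 1
    have hd2 := (Real.smoothTransition.contDiffAt (n := 1) 
      (x := 2 * (1 - ρ z) / δ - 1)).differentiableAt
      (by simp) |>.hasDerivAt.comp_hasFDerivAt z hd
    rw [show fderiv ℝ η z = _ from hd2.fderiv]
    simp only [smul_apply, neg_apply, smul_eq_mul, abs_mul,
      abs_neg, abs_inv, abs_of_pos hδ, abs_two]
    have h3 : |fderiv ℝ ρ z v| ≤ |B₂| := by
      have := (fderiv ℝ ρ z).le_opNorm v
      rw [hv, mul_one, Real.norm_eq_abs] at this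
      exact (this.trans (hB₂ z hzK)).trans (le_abs_self _)
    calc |deriv Real.smoothTransition (2 * (1 - ρ z) / δ - 1)| * (δ⁻¹ * (2 * |fderiv ℝ ρ z v|))
        ≤ B₁ * (δ⁻¹ * (2 * |B₂|)) := by
          gcongr
          exact hψ _
      _ = B₁ * (2 * |B₂|) / δ := by field_simp
  refine ⟨η, hηs, hη0, hη1, fun z => hbd z 1 (by simp), fun z => hbd z I (by simp), ?_, ?_⟩
  · intro z hz
    have h1 : η z = 0 := by
      have hz0 : z ≠ 0 := fun h0 => hz (h0 ▸ h.zero_mem)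
      obtain ⟨r, hr, s, -, rfl⟩ := h.polar_surj hz0
      rw [h.smul_mem_iff hr.le, not_lt] at hz
      exact zero_of r hz s
    simp [h1, dx, dy, crit0 z h1]
  · intro z hz hz2
    have h1 : η z = 1 := by
      by_cases hz0 : z = 0
      · rw [hz0, hη00]
      obtain ⟨r, hr, s, hs, rfl⟩ := h.polar_surj hz0
      rw [h.smul_mem_iff hr.le] at hz
      refine one_of r hr.le ?_ s
      by_contra hh
      exact hz2 ⟨(r, s), ⟨⟨not_le.1 hh, hz⟩, hs⟩, rfl⟩
    simp [h1, dx, dy, crit1 z h1]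

theorem exists_norm_le (h : StarDomain Ω γ L c) : ∃ M : ℝ, 0 < M ∧ ∀ s, ‖γ s‖ ≤ M := by
  obtain ⟨M, hM⟩ := h.bounded.closure.exists_norm_le
  have h1 : ∀ s, ‖γ s‖ ≤ M := fun s => hM _ (frontier_subset_closure (h.mem_frontier s))
  exact ⟨M, (h.norm_pos 0).trans_le (h1 0), h1⟩

theorem jac_le_norm (h : StarDomain Ω γ L c) (s : ℝ) : jac γ s ≤ ‖γ s‖ := by
  have := abs_crossC_le (γ s) (deriv γ s)
  rw [h.arclength, mul_one] at this
  exact (le_abs_self _).trans this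

/-- A Poincaré-type inequality in a thin boundary layer. -/
theorem exists_layer_bound (h : StarDomain Ω γ L c) : ∃ B : ℝ, 0 ≤ B ∧ ∀ δ : ℝ, 0 < δ → δ ≤ 1 / 2 →
    ∀ V : ℂ → ℝ, Smooth V → ∫ z in shell γ L (1 - δ), V z ^ 2 ≤
      B * (δ * (∫ s in (0 : ℝ)..L, V (γ s) ^ 2) +
        δ ^ 2 * ∫ z in shell γ L (1 - δ), (dx V z ^ 2 + dy V z ^ 2)) := by
  obtain ⟨M, hM, hγM⟩ := h.exists_norm_le
  refine ⟨2 * M + 8 * M ^ 2, by positivity, fun δ hδ hδ2 V hV => ?_⟩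
  have s1 : ContDiff ℝ (⊤ : ℕ∞) fun p : ℝ × ℝ => (p.1 : ℂ) * γ p.2 :=
    (Complex.ofRealCLM.contDiff.comp contDiff_fst).mul (h.smooth.comp contDiff_snd)
  have sV : ContDiff ℝ (⊤ : ℕ∞) fun p : ℝ × ℝ => V ((p.1 : ℂ) * γ p.2) := hV.comp s1
  have sx : ContDiff ℝ (⊤ : ℕ∞) fun p : ℝ × ℝ => dx V ((p.1 : ℂ) * γ p.2) := hV.dx.comp s1
  have sy : ContDiff ℝ (⊤ : ℕ∞) fun p : ℝ × ℝ => dy V ((p.1 : ℂ) * γ p.2) := hV.dy.comp s1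
  have sre : ContDiff ℝ (⊤ : ℕ∞) fun p : ℝ × ℝ => (γ p.2).re :=
    Complex.reCLM.contDiff.comp (h.smooth.comp contDiff_snd)
  have sim : ContDiff ℝ (⊤ : ℕ∞) fun p : ℝ × ℝ => (γ p.2).im :=
    Complex.imCLM.contDiff.comp (h.smooth.comp contDiff_snd)
  have sj : ContDiff ℝ (⊤ : ℕ∞) fun p : ℝ × ℝ => jac γ p.2 :=
    (sre.mul (Complex.imCLM.contDiff.comp (h.smooth_deriv.comp contDiff_snd))).sub
      (sim.mul (Complex.reCLM.contDiff.comp (h.smooth_deriv.comp contDiff_snd)))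
  let D : ℝ × ℝ → ℝ := fun p =>
    (γ p.2).re * dx V ((p.1 : ℂ) * γ p.2) + (γ p.2).im * dy V ((p.1 : ℂ) * γ p.2)
  let a := 1 - δ
  let fr : ℝ × ℝ → ℝ := fun p => jac γ p.2 * V ((p.1 : ℂ) * γ p.2) ^ 2 +
    (p.1 - a) * jac γ p.2 * (2 * V ((p.1 : ℂ) * γ p.2) * D p)
  have cr : ∀ r s : ℝ, HasDerivAt (fun r : ℝ => (r : ℂ) * γ s) (γ s) r := fun r s => by
    simpa using (Complex.ofRealCLM.hasDerivAt (x := r)).mul_const (γ s)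
  have key := integral_box_divergence (a := a) (b := 1) (c := 0) (d := L)
    (f := fun p => (p.1 - a) * jac γ p.2 * V ((p.1 : ℂ) * γ p.2) ^ 2) (g := fun _ => 0)
    (fr := fr) (gs := fun _ => 0)
    (((contDiff_fst.sub contDiff_const).mul sj).mul (sV.pow 2)) contDiff_const
    (by simp only [a]; linarith) h.Lpos.le
    (fun r s => by
      have := (((hasDerivAt_id r).sub_const a).mul_const (jac γ s)).mul
        ((hasDerivAt_comp_curve hV (cr r s)).pow 2)
      convert! this using 1
      simp only [fr, D, one_mul, Nat.cast_ofNat, Nat.add_one_sub_one, pow_one, id, Pi.pow_apply])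
    (fun r s => hasDerivAt_const _ _)
  simp only [add_zero, sub_self, zero_mul, intervalIntegral.integral_zero, sub_zero, zero_add,
    Complex.ofReal_one, one_mul] at key
  have e1 : (1 : ℝ) - a = δ := by simp [a]
  simp only [e1] at key
  have hbc : IsCompact (Set.Icc a 1 ×ˢ Set.Icc 0 L) := isCompact_Icc.prod isCompact_Icc
  have cfr : Continuous fr :=
    (sj.continuous.mul (sV.continuous.pow 2)).add
      (((continuous_fst.sub continuous_const).mul sj.continuous).mul
        ((continuous_const.mul sV.continuous).mul
          ((sre.continuous.mul sx.continuous).add (sim.continuous.mul sy.continuous))))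
  have cG : Continuous fun p : ℝ × ℝ => p.1 * jac γ p.2 *
      (dx V ((p.1 : ℂ) * γ p.2) ^ 2 + dy V ((p.1 : ℂ) * γ p.2) ^ 2) :=
    (continuous_fst.mul sj.continuous).mul ((sx.continuous.pow 2).add (sy.continuous.pow 2))
  have ha : 0 ≤ a := by simp only [a]; linarith
  have bdry : ∫ s in (0 : ℝ)..L, δ * jac γ s * V (γ s) ^ 2 ≤
      M * (δ * ∫ s in (0 : ℝ)..L, V (γ s) ^ 2) := by
    rw [← mul_assoc, ← intervalIntegral.integral_const_mul]
    have cV : Continuous fun s => V (γ s) ^ 2 := (hV.continuous.comp h.continuous).pow 2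
    refine intervalIntegral.integral_mono_on h.Lpos.le
      (((continuous_const.mul h.continuous_jac).mul cV).intervalIntegrable _ _)
      ((continuous_const.mul cV).intervalIntegrable _ _) fun s _ => ?_
    have := (h.jac_le_norm s).trans (hγM s)
    rw [mul_comm δ]
    gcongr
  have pw : ∀ p ∈ Set.Icc a 1 ×ˢ Set.Icc 0 L, p.1 * jac γ p.2 * V ((p.1 : ℂ) * γ p.2) ^ 2 ≤
      2 * fr p + 8 * M ^ 2 * δ ^ 2 * (p.1 * jac γ p.2 *
      (dx V ((p.1 : ℂ) * γ p.2) ^ 2 + dy V ((p.1 : ℂ) * γ p.2) ^ 2)) := by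
    rintro ⟨r, s⟩ ⟨⟨hr1, hr2⟩, -⟩
    simp only [fr, D]
    set v := V ((r : ℂ) * γ s)
    set p := dx V ((r : ℂ) * γ s)
    set q := dy V ((r : ℂ) * γ s)
    have hj := h.jac_pos s
    set j := jac γ s
    set x := (γ s).re
    set y := (γ s).im
    have hr1' : 1 - δ ≤ r := hr1
    have hr2' : r ≤ 1 := hr2
    have hn : x ^ 2 + y ^ 2 ≤ M ^ 2 := by
      have h1 : ‖γ s‖ ^ 2 = x ^ 2 + y ^ 2 := by
        rw [← Complex.normSq_eq_norm_sq, Complex.normSq_apply]; ring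
      rw [← h1]
      exact pow_le_pow_left₀ (norm_nonneg _) (hγM s) 2
    have hD : (x * p + y * q) ^ 2 ≤ M ^ 2 * (p ^ 2 + q ^ 2) := by
      calc (x * p + y * q) ^ 2 ≤ (x ^ 2 + y ^ 2) * (p ^ 2 + q ^ 2) := by
            nlinarith [sq_nonneg (x * q - y * p)]
        _ ≤ _ := by gcongr
    have ht : (r - a) ^ 2 ≤ δ ^ 2 := by
      refine pow_le_pow_left₀ (by linarith) ?_ 2
      simp only [a]; linarith
    have hT : (r - a) ^ 2 * (x * p + y * q) ^ 2 ≤ δ ^ 2 * (M ^ 2 * (2 * r * (p ^ 2 + q ^ 2))) := by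
      refine mul_le_mul ht (hD.trans ?_) (sq_nonneg _) (sq_nonneg _)
      gcongr
      have : 0 ≤ p ^ 2 + q ^ 2 := by positivity
      nlinarith
    have hY : v ^ 2 ≤ 2 * (v ^ 2 + (r - a) * (2 * v * (x * p + y * q))) +
        4 * ((r - a) ^ 2 * (x * p + y * q) ^ 2) := by
      nlinarith [sq_nonneg (v + 2 * ((r - a) * (x * p + y * q)))]
    calc r * j * v ^ 2 ≤ j * v ^ 2 := by
          have : 0 ≤ j * v ^ 2 := by positivity
          nlinarith
      _ ≤ j * (2 * (v ^ 2 + (r - a) * (2 * v * (x * p + y * q))) +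
        4 * (δ ^ 2 * (M ^ 2 * (2 * r * (p ^ 2 + q ^ 2))))) := by
          gcongr
          linarith
      _ = _ := by ring
  have sP : ContinuousOn (fun p : ℝ × ℝ => p.1 * jac γ p.2 * V ((p.1 : ℂ) * γ p.2) ^ 2)
      (Set.Icc a 1 ×ˢ Set.Icc 0 L) :=
    ((continuous_fst.mul sj.continuous).mul (sV.continuous.pow 2)).continuousOn
  have hI1 : IntegrableOn (fun p => 2 * fr p) (Set.Icc a 1 ×ˢ Set.Icc 0 L) :=
    (continuous_const.mul cfr).continuousOn.integrableOn_compact hbc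
  have hI2 : IntegrableOn (fun p : ℝ × ℝ => 8 * M ^ 2 * δ ^ 2 * (p.1 * jac γ p.2 *
      (dx V ((p.1 : ℂ) * γ p.2) ^ 2 + dy V ((p.1 : ℂ) * γ p.2) ^ 2)))
      (Set.Icc a 1 ×ˢ Set.Icc 0 L) :=
    (continuous_const.mul cG).continuousOn.integrableOn_compact hbc
  have hm := setIntegral_mono_on (μ := volume) (sP.integrableOn_compact hbc)
    (hI1.fun_add hI2) hbc.measurableSet pw
  rw [integral_add hI1 hI2, integral_const_mul, integral_const_mul, key] at hm
  rw [h.integral_shell ha, h.integral_shell ha (fun z => dx V z ^ 2 + dy V z ^ 2)]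
  set J := ∫ p in Set.Icc a 1 ×ˢ Set.Icc 0 L, p.1 * jac γ p.2 *
      (dx V ((p.1 : ℂ) * γ p.2) ^ 2 + dy V ((p.1 : ℂ) * γ p.2) ^ 2)
  have hJ : 0 ≤ J := by
    refine setIntegral_nonneg hbc.measurableSet fun p hp => ?_
    have h1 := ha.trans hp.1.1
    have h2 := (h.jac_pos p.2).le
    positivity
  have hS : 0 ≤ ∫ s in (0 : ℝ)..L, V (γ s) ^ 2 :=
    intervalIntegral.integral_nonneg h.Lpos.le fun s _ => sq_nonneg _
  have h3 : 0 ≤ M * (δ ^ 2 * J) := by positivity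
  have h4 : 0 ≤ M ^ 2 * (δ * ∫ s in (0 : ℝ)..L, V (γ s) ^ 2) := by positivity
  linarith

end StarDomain

/-- The Laplacian of a real function, in coordinates. -/
def lap (f : ℂ → ℝ) (z : ℂ) : ℝ := dx (dx f) z + dy (dy f) z

/-- The squared length of the gradient of a real function. -/
def gsq (f : ℂ → ℝ) (z : ℂ) : ℝ := dx f z ^ 2 + dy f z ^ 2

@[fun_prop]
theorem contDiff_lap {f : ℂ → ℝ} (hf : ContDiff ℝ (⊤ : ℕ∞) f) : ContDiff ℝ (⊤ : ℕ∞) (lap f) := by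
  unfold lap; fun_prop

@[fun_prop]
theorem contDiff_gsq {f : ℂ → ℝ} (hf : ContDiff ℝ (⊤ : ℕ∞) f) : ContDiff ℝ (⊤ : ℕ∞) (gsq f) := by
  unfold gsq; fun_prop

theorem gsq_nonneg (f : ℂ → ℝ) (z : ℂ) : 0 ≤ gsq f z := by unfold gsq; positivity

theorem gsq_sub_le {f g : ℂ → ℝ} (hf : Smooth f) (hg : Smooth g) (z : ℂ) :
    gsq (fun w => f w - g w) z ≤ 2 * gsq f z + 2 * gsq g z := by
  simp only [gsq, dx_sub hf hg, dy_sub hf hg]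
  linarith [sq_nonneg (dx f z + dx g z), sq_nonneg (dy f z + dy g z)]

theorem lap_sub {f g : ℂ → ℝ} (hf : Smooth f) (hg : Smooth g) (z : ℂ) :
    lap (fun w => f w - g w) z = lap f z - lap g z := by
  have h1 : dx (fun w => f w - g w) = fun w => dx f w - dx g w := funext (dx_sub hf hg)
  have h2 : dy (fun w => f w - g w) = fun w => dy f w - dy g w := funext (dy_sub hf hg)
  rw [lap, h1, h2, dx_sub hf.dx hg.dx, dy_sub hf.dy hg.dy]
  simp only [lap]; ring

namespace StarDomain

variable {Ω : Set ℂ} {γ : ℝ → ℂ} {L c : ℝ}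

theorem integrableOn (h : StarDomain Ω γ L c) {f : ℂ → ℝ} (hf : Continuous f) :
    IntegrableOn f Ω :=
  (hf.continuousOn.integrableOn_compact h.bounded.isCompact_closure).mono_set subset_closure

theorem intervalIntegrable (h : StarDomain Ω γ L c) {f : ℂ → ℝ} (hf : Continuous f) :
    IntervalIntegrable (fun s => f (γ s)) volume 0 L :=
  (hf.comp h.continuous).intervalIntegrable _ _

/-- The tangential derivative along the boundary only depends on the boundary values. -/
theorem tangential_eq (h : StarDomain Ω γ L c) {f g : ℂ → ℝ} (hf : Smooth f) (hg : Smooth g)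
    (hfg : ∀ s, f (γ s) = g (γ s)) (s : ℝ) :
    (deriv γ s).re * dx f (γ s) + (deriv γ s).im * dy f (γ s) =
      (deriv γ s).re * dx g (γ s) + (deriv γ s).im * dy g (γ s) := by
  have h1 := hasDerivAt_comp_curve hf (h.hasDerivAt s)
  have e : (fun t => f (γ t)) = fun t => g (γ t) := funext hfg
  rw [e] at h1
  exact h1.unique (hasDerivAt_comp_curve hg (h.hasDerivAt s))

theorem deriv_sq (h : StarDomain Ω γ L c) (s : ℝ) :
    (deriv γ s).re ^ 2 + (deriv γ s).im ^ 2 = 1 := by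
  have := h.arclength s
  have h1 : ‖deriv γ s‖ ^ 2 = (deriv γ s).re ^ 2 + (deriv γ s).im ^ 2 := by
    rw [← Complex.normSq_eq_norm_sq, Complex.normSq_apply]; ring
  rw [← h1, this, one_pow]

/-- The Rellich–Pohozaev estimate for a function with prescribed boundary values. -/
theorem exists_rellich_bound (h : StarDomain Ω γ L c) {g : ℂ → ℝ} (hg : Smooth g) :
    ∃ C : ℝ, ∀ f : ℂ → ℝ, Smooth f → (∀ s, f (γ s) = g (γ s)) →
      c / 4 * ∫ s in (0 : ℝ)..L, gsq f (γ s) ≤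
        (∫ z in Ω, (z.re * dx f z + z.im * dy f z) * lap f z) + C := by
  obtain ⟨M, hM, hγM⟩ := h.exists_norm_le
  refine ⟨(c / 4 + M ^ 2 / c + M / 2) * ∫ s in (0 : ℝ)..L, gsq g (γ s), fun f hf hfg => ?_⟩
  have hX : Smooth fun z => (z.re * dx f z + z.im * dy f z) * dx f z - z.re * (1 / 2) *
    (dx f z * dx f z + dy f z * dy f z) := by unfold Smooth; fun_prop
  have hY : Smooth fun z => (z.re * dx f z + z.im * dy f z) * dy f z - z.im * (1 / 2) *
    (dx f z * dx f z + dy f z * dy f z) := by unfold Smooth; fun_prop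
  have key := h.integral_divergence hX hY
  have e1 : ∀ z, dx (fun z => (z.re * dx f z + z.im * dy f z) * dx f z - z.re * (1 / 2) *
      (dx f z * dx f z + dy f z * dy f z)) z + dy (fun z => (z.re * dx f z + z.im * dy f z) *
      dy f z - z.im * (1 / 2) * (dx f z * dx f z + dy f z * dy f z)) z =
      (z.re * dx f z + z.im * dy f z) * lap f z := by
    intro z
    simp (disch := fun_prop) only [dx_mul, dx_sub, dx_add, dx_re, dx_im, dx_const, dy_mul, dy_sub,
      dy_add, dy_re, dy_im, dy_const, dy_dx_comm hf, lap]
    ring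
  simp only [e1] at key
  rw [key, ← intervalIntegral.integral_const_mul, ← intervalIntegral.integral_const_mul,
    ← intervalIntegral.integral_add]
  rotate_left
  · exact ((hX.continuous.comp h.continuous).mul (Complex.continuous_im.comp
      h.continuous_deriv)).sub ((hY.continuous.comp h.continuous).mul (Complex.continuous_re.comp
      h.continuous_deriv)) |>.intervalIntegrable _ _
  · exact (h.intervalIntegrable (contDiff_gsq hg).continuous).const_mul _
  refine intervalIntegral.integral_mono_on h.Lpos.le
    ((h.intervalIntegrable (contDiff_gsq hf).continuous).const_mul _) ?_ fun s _ => ?_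
  · exact (((hX.continuous.comp h.continuous).mul (Complex.continuous_im.comp
      h.continuous_deriv)).sub ((hY.continuous.comp h.continuous).mul (Complex.continuous_re.comp
      h.continuous_deriv)) |>.intervalIntegrable _ _).add
      ((h.intervalIntegrable (contDiff_gsq hg).continuous).const_mul _)
  have ht := h.tangential_eq hf hg hfg s
  have hT := h.deriv_sq s
  have hj := h.star s
  have hjM : crossC (γ s) (deriv γ s) ≤ M := (h.jac_le_norm s).trans (hγM s)
  have hn : (γ s).re ^ 2 + (γ s).im ^ 2 ≤ M ^ 2 := by
    have h1 : ‖γ s‖ ^ 2 = (γ s).re ^ 2 + (γ s).im ^ 2 := by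
      rw [← Complex.normSq_eq_norm_sq, Complex.normSq_apply]; ring
    rw [← h1]
    exact pow_le_pow_left₀ (norm_nonneg _) (hγM s) 2
  simp only [gsq]
  have hcp := h.cpos
  simp only [crossC] at hj hjM
  generalize (deriv γ s).re = t₁ at *
  generalize (deriv γ s).im = t₂ at *
  generalize (γ s).re = x at *
  generalize (γ s).im = y at *
  generalize dx f (γ s) = p at *
  generalize dy f (γ s) = q at *
  generalize dx g (γ s) = p' at *
  generalize dy g (γ s) = q' at *
  obtain ⟨a, ha⟩ : ∃ a, a = p * t₂ - q * t₁ := ⟨_, rfl⟩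
  obtain ⟨b, hb⟩ : ∃ b, b = t₁ * p + t₂ * q := ⟨_, rfl⟩
  obtain ⟨j, hj'⟩ : ∃ j, j = x * t₂ - y * t₁ := ⟨_, rfl⟩
  obtain ⟨m, hm⟩ : ∃ m, m = x * t₁ + y * t₂ := ⟨_, rfl⟩
  have hpq : p ^ 2 + q ^ 2 = a ^ 2 + b ^ 2 := by
    rw [ha, hb]; linear_combination (-(p ^ 2 + q ^ 2)) * hT
  have hrew : ((x * p + y * q) * p - x * (1 / 2) * (p * p + q * q)) * t₂ -
      ((x * p + y * q) * q - y * (1 / 2) * (p * p + q * q)) * t₁ =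
      1 / 2 * j * a ^ 2 + a * b * m - 1 / 2 * j * b ^ 2 := by
    have e2 : x * p + y * q = a * j + b * m := by
      rw [ha, hb, hj', hm]; linear_combination (-(x * p + y * q)) * hT
    calc _ = (x * p + y * q) * (p * t₂ - q * t₁) - 1 / 2 * (p ^ 2 + q ^ 2) * (x * t₂ - y * t₁) := by
          ring
      _ = _ := by rw [e2, hpq, ← ha, ← hj']; ring
  have hb' : b ^ 2 ≤ p' ^ 2 + q' ^ 2 := by
    rw [hb, ht]
    calc (t₁ * p' + t₂ * q') ^ 2 ≤ (t₁ ^ 2 + t₂ ^ 2) * (p' ^ 2 + q' ^ 2) := by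
          linarith [sq_nonneg (t₁ * q' - t₂ * p')]
      _ = _ := by rw [hT, one_mul]
  have hm2 : m ^ 2 ≤ M ^ 2 := by
    refine le_trans ?_ hn
    calc m ^ 2 ≤ (t₁ ^ 2 + t₂ ^ 2) * (x ^ 2 + y ^ 2) := by
          rw [hm]; linarith [sq_nonneg (t₁ * y - t₂ * x)]
      _ = _ := by rw [hT, one_mul]
  rw [← hj'] at hj hjM
  rw [hrew, hpq]
  have k1 : c * a ^ 2 ≤ j * a ^ 2 := by gcongr
  have k2 : j * b ^ 2 ≤ M * b ^ 2 := by gcongr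
  have k3 : -(a * b * m) ≤ c / 4 * a ^ 2 + M ^ 2 / c * b ^ 2 := by
    have e3 : m ^ 2 * b ^ 2 ≤ M ^ 2 * b ^ 2 := by gcongr
    have e4 : M ^ 2 / c * b ^ 2 = M ^ 2 * b ^ 2 / c := by ring
    rw [e4, ← sub_nonneg]
    have : c / 4 * a ^ 2 + M ^ 2 * b ^ 2 / c - -(a * b * m) =
      ((c * a / 2 + b * m) ^ 2 + (M ^ 2 * b ^ 2 - m ^ 2 * b ^ 2)) / c := by field_simp; ring
    rw [this]
    exact div_nonneg (by linarith [sq_nonneg (c * a / 2 + b * m)]) hcp.le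
  have k4 : (c / 4 + M ^ 2 / c + M / 2) * b ^ 2 ≤
    (c / 4 + M ^ 2 / c + M / 2) * (p' ^ 2 + q' ^ 2) := by gcongr
  linarith

end StarDomain

/-- The squared length of the Hessian of a real function. -/
def hsq (f : ℂ → ℝ) (z : ℂ) : ℝ := gsq (dx f) z + gsq (dy f) z

@[fun_prop]
theorem contDiff_hsq {f : ℂ → ℝ} (hf : ContDiff ℝ (⊤ : ℕ∞) f) : ContDiff ℝ (⊤ : ℕ∞) (hsq f) := by
  unfold hsq; fun_prop

theorem hsq_nonneg (f : ℂ → ℝ) (z : ℂ) : 0 ≤ hsq f z := add_nonneg (gsq_nonneg _ _) (gsq_nonneg _ _)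

namespace StarDomain

variable {Ω : Set ℂ} {γ : ℝ → ℂ} {L c : ℝ}

theorem continuous_deriv_deriv (h : StarDomain Ω γ L c) : Continuous (deriv (deriv γ)) :=
  h.smooth_deriv.continuous_deriv (by simp)

theorem exists_curvature_bound (h : StarDomain Ω γ L c) :
    ∃ K : ℝ, 0 ≤ K ∧ ∀ s ∈ Set.Icc 0 L, ‖deriv (deriv γ) s‖ ≤ K := by
  obtain ⟨K, hK⟩ := (isCompact_Icc (a := (0 : ℝ)) (b := L)).exists_bound_of_continuousOn
    h.continuous_deriv_deriv.continuousOn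
  exact ⟨K, (norm_nonneg _).trans (hK 0 ⟨le_rfl, h.Lpos.le⟩), hK⟩

/-- The Hessian of a function vanishing on the boundary is controlled by its Laplacian. -/
theorem exists_hessian_bound (h : StarDomain Ω γ L c) :
    ∃ K : ℝ, 0 ≤ K ∧ ∀ v : ℂ → ℝ, Smooth v → (∀ s, v (γ s) = 0) →
      ∫ z in Ω, hsq v z ≤ (∫ z in Ω, lap v z ^ 2) + K * ∫ s in (0 : ℝ)..L, gsq v (γ s) := by
  obtain ⟨K, hK, hKb⟩ := h.exists_curvature_bound
  refine ⟨K, hK, fun v hv hv0 => ?_⟩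
  have hX : Smooth fun z => dx v z * dy (dy v) z - dy v z * dx (dy v) z := by
    unfold Smooth; fun_prop
  have hY : Smooth fun z => dy v z * dx (dx v) z - dx v z * dx (dy v) z := by
    unfold Smooth; fun_prop
  have key := h.integral_divergence hX hY
  have e1 : ∀ z, dx (fun z => dx v z * dy (dy v) z - dy v z * dx (dy v) z) z +
      dy (fun z => dy v z * dx (dx v) z - dx v z * dx (dy v) z) z = lap v z ^ 2 - hsq v z := by
    intro z
    have e2 : dy (dx (dx v)) z = dx (dx (dy v)) z := by
      rw [dy_dx_comm hv.dx]; congr 1; exact funext (dy_dx_comm hv)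
    have e3 : dy (dx (dy v)) z = dx (dy (dy v)) z := dy_dx_comm hv.dy z
    simp (disch := fun_prop) only [dx_mul, dx_sub, dy_mul, dy_sub, e2, e3, hsq, gsq, lap,
      dy_dx_comm hv]
    ring
  simp only [e1] at key
  rw [integral_sub (h.integrableOn (by fun_prop)) (h.integrableOn (contDiff_hsq hv).continuous)]
    at key
  have hb : -(K * ∫ s in (0 : ℝ)..L, gsq v (γ s)) ≤ ∫ s in (0 : ℝ)..L,
      ((dx v (γ s) * dy (dy v) (γ s) - dy v (γ s) * dx (dy v) (γ s)) * (deriv γ s).im -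
        (dy v (γ s) * dx (dx v) (γ s) - dx v (γ s) * dx (dy v) (γ s)) * (deriv γ s).re) := by
    rw [← intervalIntegral.integral_const_mul, ← intervalIntegral.integral_neg]
    refine intervalIntegral.integral_mono_on h.Lpos.le
      ((h.intervalIntegrable (contDiff_gsq hv).continuous).const_mul _).neg ?_ fun s hs => ?_
    · exact ((hX.continuous.comp h.continuous).mul (Complex.continuous_im.comp
        h.continuous_deriv)).sub ((hY.continuous.comp h.continuous).mul (Complex.continuous_re.comp
        h.continuous_deriv)) |>.intervalIntegrable _ _
    have tan : ∀ s, (deriv γ s).re * dx v (γ s) + (deriv γ s).im * dy v (γ s) = 0 := fun s => by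
      have := h.tangential_eq hv (g := fun _ => 0) contDiff_const hv0 s
      simpa only [dx_const, dy_const, mul_zero, add_zero] using this
    have hdd : HasDerivAt (deriv γ) (deriv (deriv γ) s) s :=
      (h.smooth_deriv.differentiable (by simp) s).hasDerivAt
    have hdre : HasDerivAt (fun s => (deriv γ s).re) (deriv (deriv γ) s).re s :=
      Complex.reCLM.hasFDerivAt.comp_hasDerivAt s hdd
    have hdim : HasDerivAt (fun s => (deriv γ s).im) (deriv (deriv γ) s).im s :=
      Complex.imCLM.hasFDerivAt.comp_hasDerivAt s hdd
    have hP := hasDerivAt_comp_curve hv.dx (h.hasDerivAt s)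
    have hQ := hasDerivAt_comp_curve hv.dy (h.hasDerivAt s)
    have hz := (hdre.mul hP).add (hdim.mul hQ)
    have hz' : HasDerivAt (fun s => (deriv γ s).re * dx v (γ s) + (deriv γ s).im * dy v (γ s))
        0 s := by
      rw [show (fun s => (deriv γ s).re * dx v (γ s) + (deriv γ s).im * dy v (γ s)) = fun _ => 0
        from funext tan]
      exact hasDerivAt_const _ _
    have hrel := hz.unique hz'
    have hT := h.deriv_sq s
    have ht := tan s
    have hk : (deriv (deriv γ) s).re ^ 2 + (deriv (deriv γ) s).im ^ 2 ≤ K ^ 2 := by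
      have h1 : ‖deriv (deriv γ) s‖ ^ 2 = (deriv (deriv γ) s).re ^ 2 +
          (deriv (deriv γ) s).im ^ 2 := by
        rw [← Complex.normSq_eq_norm_sq, Complex.normSq_apply]; ring
      rw [← h1]
      exact pow_le_pow_left₀ (norm_nonneg _) (hKb s hs) 2
    rw [dy_dx_comm hv] at hrel
    simp only [gsq]
    generalize (deriv (deriv γ) s).re = k₁ at *
    generalize (deriv (deriv γ) s).im = k₂ at *
    generalize (deriv γ s).re = t₁ at *
    generalize (deriv γ s).im = t₂ at *
    generalize dx v (γ s) = p at *
    generalize dy v (γ s) = q at *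
    generalize dx (dx v) (γ s) = A at *
    generalize dx (dy v) (γ s) = B at *
    generalize dy (dy v) (γ s) = D at *
    obtain ⟨l, hl⟩ : ∃ l, l = p * t₂ - q * t₁ := ⟨_, rfl⟩
    have hp : p = l * t₂ := by rw [hl]; linear_combination (-p) * hT + t₁ * ht
    have hq : q = -(l * t₁) := by rw [hl]; linear_combination (-q) * hT + t₂ * ht
    have e4 : (p * D - q * B) * t₂ - (q * A - p * B) * t₁ = -(l * (p * k₁ + q * k₂)) := by
      have e5 : (p * D - q * B) * t₂ - (q * A - p * B) * t₁ =
        p * (D * t₂ + B * t₁) - q * (B * t₂ + A * t₁) := by ring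
      rw [e5]
      nth_rewrite 1 [hp]
      nth_rewrite 1 [hq]
      linear_combination l * hrel
    have hl2 : p ^ 2 + q ^ 2 = l ^ 2 := by rw [hp, hq]; linear_combination l ^ 2 * hT
    rw [e4, hl2, neg_le_neg_iff]
    have e6 : (p * k₁ + q * k₂) ^ 2 ≤ (l * K) ^ 2 := by
      calc (p * k₁ + q * k₂) ^ 2 ≤ (p ^ 2 + q ^ 2) * (k₁ ^ 2 + k₂ ^ 2) := by
            linarith [sq_nonneg (p * k₂ - q * k₁)]
        _ ≤ l ^ 2 * K ^ 2 := by rw [hl2]; gcongr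
        _ = _ := by ring
    have e7 : |p * k₁ + q * k₂| ≤ |l| * K := by
      have := sq_le_sq.1 e6
      rwa [abs_mul l, abs_of_nonneg hK] at this
    calc l * (p * k₁ + q * k₂) ≤ |l| * |p * k₁ + q * k₂| := by
          rw [← abs_mul]; exact le_abs_self _
      _ ≤ |l| * (|l| * K) := by gcongr
      _ = K * l ^ 2 := by rw [← sq_abs l]; ring
  linarith

/-- An `L⁴` interpolation estimate for bounded functions vanishing on the boundary. -/
theorem integral_gsq_sq_le (h : StarDomain Ω γ L c) {v : ℂ → ℝ} (hv : Smooth v)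
    (hv0 : ∀ s, v (γ s) = 0) {m : ℝ} (hm : ∀ z ∈ Ω, |v z| ≤ m) :
    ∫ z in Ω, gsq v z ^ 2 ≤ 20 * m ^ 2 * ∫ z in Ω, hsq v z := by
  have hX : Smooth fun z => v z * (gsq v z * dx v z) := by unfold Smooth; fun_prop
  have hY : Smooth fun z => v z * (gsq v z * dy v z) := by unfold Smooth; fun_prop
  have key := h.integral_divergence hX hY
  simp only [hv0, zero_mul, sub_zero, intervalIntegral.integral_zero] at key
  have cd : Continuous fun z => dx (fun z => v z * (gsq v z * dx v z)) z +
      dy (fun z => v z * (gsq v z * dy v z)) z := hX.dx.continuous.add hY.dy.continuous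
  have pw : ∀ z ∈ Ω, 1 / 2 * gsq v z ^ 2 ≤ (dx (fun z => v z * (gsq v z * dx v z)) z +
      dy (fun z => v z * (gsq v z * dy v z)) z) + 10 * m ^ 2 * hsq v z := by
    intro z hz
    have hxg : dx (gsq v) z = 2 * dx v z * dx (dx v) z + 2 * dy v z * dx (dy v) z := by
      unfold gsq; simp (disch := fun_prop) only [dx_add, dx_sq]
    have hyg : dy (gsq v) z = 2 * dx v z * dx (dy v) z + 2 * dy v z * dy (dy v) z := by
      unfold gsq; simp (disch := fun_prop) only [dy_add, dy_sq, dy_dx_comm hv]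
    simp (disch := fun_prop) only [dx_mul, dy_mul, hxg, hyg]
    have hmz := hm z hz
    simp only [hsq, gsq, dy_dx_comm hv]
    generalize dx v z = p at *
    generalize dy v z = q at *
    generalize dx (dx v) z = A at *
    generalize dx (dy v) z = B at *
    generalize dy (dy v) z = D at *
    generalize v z = w at *
    have hm0 : 0 ≤ m := (abs_nonneg _).trans hmz
    obtain ⟨S, hS⟩ : ∃ S, S = p ^ 2 + q ^ 2 := ⟨_, rfl⟩
    have hS0 : 0 ≤ S := by rw [hS]; positivity
    obtain ⟨E, hE⟩ : ∃ E, E = A * (S + 2 * p ^ 2) + B * (4 * (p * q)) + D * (S + 2 * q ^ 2) :=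
      ⟨_, rfl⟩
    have hEb : |E| ≤ S * (3 * |A| + 2 * |B| + 3 * |D|) := by
      have b1 : |A * (S + 2 * p ^ 2)| ≤ |A| * (3 * S) := by
        rw [abs_mul, abs_of_nonneg (by positivity : 0 ≤ S + 2 * p ^ 2)]
        gcongr
        linarith [sq_nonneg q]
      have b2 : |D * (S + 2 * q ^ 2)| ≤ |D| * (3 * S) := by
        rw [abs_mul, abs_of_nonneg (by positivity : 0 ≤ S + 2 * q ^ 2)]
        gcongr
        linarith [sq_nonneg p]
      have b3 : |B * (4 * (p * q))| ≤ |B| * (2 * S) := by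
        rw [abs_mul]
        gcongr
        rw [abs_le]
        constructor <;> linarith [sq_nonneg (p + q), sq_nonneg (p - q)]
      have := abs_add_three (A * (S + 2 * p ^ 2)) (B * (4 * (p * q))) (D * (S + 2 * q ^ 2))
      rw [hE]
      linarith
    have hk : (3 * |A| + 2 * |B| + 3 * |D|) ^ 2 ≤ 20 * (A ^ 2 + B ^ 2 + (B ^ 2 + D ^ 2)) := by
      have := sq_abs A
      have := sq_abs B
      have := sq_abs D
      nlinarith [sq_nonneg (3 * |B| - |A|), sq_nonneg (|A| - |D|), sq_nonneg (3 * |B| - |D|)]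
    obtain ⟨k, hk'⟩ : ∃ k, k = 3 * |A| + 2 * |B| + 3 * |D| := ⟨_, rfl⟩
    rw [← hk'] at hk hEb
    have hwE : -(w * E) ≤ 1 / 2 * S ^ 2 + 10 * m ^ 2 * (A ^ 2 + B ^ 2 + (B ^ 2 + D ^ 2)) := by
      calc -(w * E) ≤ |w| * |E| := by rw [← abs_mul]; exact neg_le_abs _
        _ ≤ m * (S * k) := by gcongr
        _ ≤ 1 / 2 * S ^ 2 + 1 / 2 * (m ^ 2 * k ^ 2) := by linarith [sq_nonneg (S - m * k)]
        _ ≤ 1 / 2 * S ^ 2 + 1 / 2 * (m ^ 2 * (20 * (A ^ 2 + B ^ 2 + (B ^ 2 + D ^ 2)))) := by gcongr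
        _ = _ := by ring
    rw [← hS]
    have e : w * (S * A + (2 * p * A + 2 * q * B) * p) + p * (S * p) +
        (w * (S * D + (2 * p * B + 2 * q * D) * q) + q * (S * q)) = S ^ 2 + w * E := by
      rw [hE, hS]; ring
    rw [e]
    linarith
  have i1 : IntegrableOn (fun z => 10 * m ^ 2 * hsq v z) Ω := h.integrableOn (by fun_prop)
  have hmono := setIntegral_mono_on (h.integrableOn (f := fun z => 1 / 2 * gsq v z ^ 2)
    (by fun_prop)) ((h.integrableOn cd).fun_add i1) h.isOpen.measurableSet pw
  rw [integral_add (h.integrableOn cd) i1, key, integral_const_mul, integral_const_mul] at hmono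
  linarith

theorem integral_gsq_eq (h : StarDomain Ω γ L c) {v : ℂ → ℝ} (hv : Smooth v)
    (hv0 : ∀ s, v (γ s) = 0) : ∫ z in Ω, gsq v z = -∫ z in Ω, v z * lap v z := by
  have hX : Smooth fun z => v z * dx v z := by unfold Smooth; fun_prop
  have hY : Smooth fun z => v z * dy v z := by unfold Smooth; fun_prop
  have key := h.integral_divergence hX hY
  simp only [hv0, zero_mul, sub_zero, intervalIntegral.integral_zero] at key
  have e : ∀ z, dx (fun z => v z * dx v z) z + dy (fun z => v z * dy v z) z =
      gsq v z + v z * lap v z := fun z => by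
    simp (disch := fun_prop) only [dx_mul, dy_mul, gsq, lap]; ring
  simp only [e] at key
  rw [integral_add (h.integrableOn (by fun_prop)) (h.integrableOn (by fun_prop))] at key
  linarith

end StarDomain

/-- A smooth function with a local maximum has nonpositive second derivatives there. -/
theorem deriv_deriv_nonpos_of_isLocalMax {f : ℝ → ℝ} {x : ℝ} (hf : ContinuousAt f x)
    (h : IsLocalMax f x) : deriv (deriv f) x ≤ 0 := by
  by_contra hh
  push Not at hh
  have h1 := isLocalMin_of_deriv_deriv_pos hh h.deriv_eq_zero hf
  have h2 : f =ᶠ[𝓝 x] fun _ => f x := by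
    filter_upwards [h, h1] with y hy hy'
    exact le_antisymm hy hy'
  have h3 : deriv f =ᶠ[𝓝 x] fun _ => 0 := by
    have := h2.deriv
    simpa using this
  rw [h3.deriv_eq] at hh
  simp at hh

theorem lap_nonpos_of_isLocalMax {f : ℂ → ℝ} (hf : Smooth f) {z : ℂ} (h : IsLocalMax f z) :
    lap f z ≤ 0 := by
  have key : ∀ v : ℂ, fderiv ℝ (fun y => fderiv ℝ f y v) z v ≤ 0 := by
    intro v
    have hc : ∀ t : ℝ, HasDerivAt (fun t : ℝ => z + (t : ℂ) * v) v t := fun t => by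
      simpa using ((Complex.ofRealCLM.hasDerivAt (x := t)).mul_const v).const_add z
    have h1 : ∀ g : ℂ → ℝ, Smooth g → ∀ t : ℝ, HasDerivAt (fun t : ℝ => g (z + (t : ℂ) * v))
        (fderiv ℝ g (z + (t : ℂ) * v) v) t := fun g hg t =>
      (hg.diffAt _).hasFDerivAt.comp_hasDerivAt t (hc t)
    have h2 : deriv (fun t : ℝ => f (z + (t : ℂ) * v)) =
        fun t : ℝ => fderiv ℝ f (z + (t : ℂ) * v) v := funext fun t => (h1 f hf t).deriv
    have h3 : deriv (deriv (fun t : ℝ => f (z + (t : ℂ) * v))) 0 =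
        fderiv ℝ (fun y => fderiv ℝ f y v) z v := by
      rw [h2, (h1 _ (hf.fderiv_dir v) 0).deriv]
      simp
    rw [← h3]
    refine deriv_deriv_nonpos_of_isLocalMax (h1 f hf 0).continuousAt ?_
    have hcont : Tendsto (fun t : ℝ => z + (t : ℂ) * v) (𝓝 0) (𝓝 z) := by
      have := (hc 0).continuousAt
      simpa [ContinuousAt] using this
    have := hcont.eventually h
    filter_upwards [this] with t ht
    simpa using ht
  exact add_nonpos (key 1) (key I)

theorem norm_sq_eq_re_im (z : ℂ) : ‖z‖ ^ 2 = z.re ^ 2 + z.im ^ 2 := by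
  rw [← Complex.normSq_eq_norm_sq, Complex.normSq_apply]; ring

namespace ArcParam

variable {Γ : Set ℂ} {τ : ℝ → ℂ}

theorem isCompact (h : ArcParam Γ τ) : IsCompact Γ := by
  rw [← h.srange, ← h.periodic.image_Icc Real.two_pi_pos 0]
  exact isCompact_Icc.image h.smooth.continuous

theorem nonempty (h : ArcParam Γ τ) : Γ.Nonempty := by
  rw [← h.srange]; exact Set.range_nonempty _

theorem mem (h : ArcParam Γ τ) (s : ℝ) : τ s ∈ Γ := by rw [← h.srange]; exact Set.mem_range_self s

end ArcParam

namespace PotentialHyp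

variable {Γ : Set ℂ} {τ : ℝ → ℂ} {W : ℂ → ℝ} {R₀ : ℝ}

theorem eq_zero_iff (hW : PotentialHyp Γ W R₀) (z : ℂ) : W z = 0 ↔ z ∈ Γ := by
  rw [← hW.zeros]; rfl

theorem R0_pos (hΓ : ArcParam Γ τ) (hW : PotentialHyp Γ W R₀) : 0 < R₀ :=
  (norm_nonneg _).trans_lt (hW.R0_large _ (hΓ.mem 0))

theorem fderiv_eq_zero (hW : PotentialHyp Γ W R₀) {z : ℂ} (hz : z ∈ Γ) : fderiv ℝ W z = 0 :=
  IsLocalMin.fderiv_eq_zero (Filter.Eventually.of_forall fun w => by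
    rw [(hW.eq_zero_iff z).2 hz]; exact hW.nonneg w)

/-- The potential controls the squared distance to its zero set, on the ball of radius `R₀`. -/
theorem exists_infDist_sq_le (hW : PotentialHyp Γ W R₀) :
    ∃ B : ℝ, 0 ≤ B ∧ ∀ z, ‖z‖ ≤ R₀ → Metric.infDist z Γ ^ 2 ≤ B * W z := by
  obtain ⟨μ, hμ, δ, hδ, hnd⟩ := hW.nondeg
  let K : Set ℂ := Metric.closedBall 0 R₀ ∩ {z | δ ≤ Metric.infDist z Γ}
  have hK : IsCompact K := (isCompact_closedBall 0 R₀).inter_right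
    (isClosed_le continuous_const (Metric.continuous_infDist_pt Γ))
  have hpos : ∀ z ∈ K, 0 < W z := by
    rintro z ⟨-, hz⟩
    refine lt_of_le_of_ne (hW.nonneg z) fun h0 => ?_
    have := Metric.infDist_zero_of_mem ((hW.eq_zero_iff z).1 h0.symm)
    rw [Set.mem_ofPred_eq, this] at hz
    linarith
  have cont : ContinuousOn (fun z => Metric.infDist z Γ ^ 2 / W z) K :=
    ((Metric.continuous_infDist_pt Γ).pow 2).continuousOn.div hW.smooth.continuous.continuousOn
      fun z hz => (hpos z hz).ne'
  obtain ⟨B, hB⟩ := hK.exists_bound_of_continuousOn cont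
  refine ⟨max (1 / μ) B, le_max_of_le_left (by positivity), fun z hz => ?_⟩
  rcases lt_or_ge (Metric.infDist z Γ) δ with h1 | h1
  · calc Metric.infDist z Γ ^ 2 ≤ 1 / μ * W z := by
          rw [one_div, inv_mul_eq_div, le_div_iff₀ hμ, mul_comm]; exact hnd z h1
      _ ≤ _ := mul_le_mul_of_nonneg_right (le_max_left _ _) (hW.nonneg z)
  · have hzK : z ∈ K := ⟨by simpa using hz, h1⟩
    have := (le_abs_self _).trans (hB z hzK)
    rw [div_le_iff₀ (hpos z hzK)] at this
    exact this.trans (mul_le_mul_of_nonneg_right (le_max_right _ _) (hW.nonneg z))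

theorem mem_ball (hW : PotentialHyp Γ W R₀) {z : ℂ} (hz : z ∈ Γ) :
    z ∈ Metric.closedBall (0 : ℂ) R₀ := by simpa using (hW.R0_large z hz).le

theorem exists_fderiv_bound {F : ℂ → ℝ} (hF : Smooth F) (R : ℝ) :
    ∃ B : ℝ, 0 ≤ B ∧ ∀ z ∈ Metric.closedBall (0 : ℂ) R, ‖fderiv ℝ F z‖ ≤ B := by
  obtain ⟨B, hB⟩ := (isCompact_closedBall (0 : ℂ) R).exists_bound_of_continuousOn
    (hF.continuous_fderiv (by simp)).continuousOn
  exact ⟨max B 0, le_max_right _ _, fun z hz => (hB z hz).trans (le_max_left _ _)⟩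

/-- A smooth function vanishing on `Γ` is `O(√W)`. -/
theorem exists_sq_le (hΓ : ArcParam Γ τ) (hW : PotentialHyp Γ W R₀) {F : ℂ → ℝ} (hF : Smooth F)
    (hF0 : ∀ z ∈ Γ, F z = 0) : ∃ B : ℝ, 0 ≤ B ∧ ∀ z, ‖z‖ ≤ R₀ → F z ^ 2 ≤ B * W z := by
  obtain ⟨B, hB, hBW⟩ := hW.exists_infDist_sq_le
  obtain ⟨D, hD, hDF⟩ := exists_fderiv_bound hF R₀
  refine ⟨D ^ 2 * B, by positivity, fun z hz => ?_⟩
  obtain ⟨p, hp, hpz⟩ := hΓ.isCompact.exists_infDist_eq_dist hΓ.nonempty z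
  have h1 := (convex_closedBall (0 : ℂ) R₀).norm_image_sub_le_of_norm_fderiv_le
    (fun w _ => hF.diffAt w) hDF (hW.mem_ball hp) (by simpa using hz : z ∈ Metric.closedBall 0 R₀)
  rw [hF0 p hp, sub_zero, ← dist_eq_norm, ← hpz, Real.norm_eq_abs] at h1
  calc F z ^ 2 = |F z| ^ 2 := (sq_abs _).symm
    _ ≤ (D * Metric.infDist z Γ) ^ 2 := by gcongr
    _ = D ^ 2 * Metric.infDist z Γ ^ 2 := by ring
    _ ≤ D ^ 2 * (B * W z) := by gcongr; exact hBW z hz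
    _ = _ := by ring

/-- A smooth function vanishing to second order on `Γ` is `O(W)`. -/
theorem exists_abs_le (hΓ : ArcParam Γ τ) (hW : PotentialHyp Γ W R₀) {F : ℂ → ℝ} (hF : Smooth F)
    (hF0 : ∀ z ∈ Γ, F z = 0) (hFx : ∀ z ∈ Γ, dx F z = 0) (hFy : ∀ z ∈ Γ, dy F z = 0) :
    ∃ B : ℝ, 0 ≤ B ∧ ∀ z, ‖z‖ ≤ R₀ → |F z| ≤ B * W z := by
  obtain ⟨B, hB, hBW⟩ := hW.exists_infDist_sq_le
  obtain ⟨D, hD⟩ := (isCompact_closedBall (0 : ℂ) R₀).exists_bound_of_continuousOn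
    ((hF.fderiv_right (m := (⊤ : ℕ∞)) (by simp)).continuous_fderiv (by simp)).continuousOn
  refine ⟨|D| * B, by positivity, fun z hz => ?_⟩
  obtain ⟨p, hp, hpz⟩ := hΓ.isCompact.exists_infDist_eq_dist hΓ.nonempty z
  have hzb : z ∈ Metric.closedBall (0 : ℂ) R₀ := by simpa using hz
  have hfd0 : fderiv ℝ F p = 0 := by
    ext v
    rw [fderiv_apply_eq_dx_dy, hFx p hp, hFy p hp]
    simp
  have hseg : segment ℝ p z ⊆ Metric.closedBall (0 : ℂ) R₀ :=
    (convex_closedBall (0 : ℂ) R₀).segment_subset (hW.mem_ball hp) hzb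
  have hlip : ∀ w ∈ segment ℝ p z, ‖fderiv ℝ F w‖ ≤ |D| * ‖z - p‖ := by
    intro w hw
    have h1 := (convex_closedBall (0 : ℂ) R₀).norm_image_sub_le_of_norm_fderiv_le
      (fun w _ => (hF.fderiv_right (m := (⊤ : ℕ∞)) (by simp)).differentiable (by simp) w)
      (fun w hw => (hD w hw).trans (le_abs_self D)) (hW.mem_ball hp) (hseg hw)
    rw [hfd0, sub_zero] at h1
    refine h1.trans ?_
    gcongr
    obtain ⟨t, ⟨ht0, ht1⟩, rfl⟩ := segment_eq_image' ℝ p z ▸ hw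
    rw [add_sub_cancel_left, norm_smul, Real.norm_of_nonneg ht0]
    exact mul_le_of_le_one_left (norm_nonneg _) ht1
  have h2 := (convex_segment p z).norm_image_sub_le_of_norm_fderiv_le
    (fun w _ => hF.diffAt w) hlip (left_mem_segment ℝ p z) (right_mem_segment ℝ p z)
  rw [hF0 p hp, sub_zero, ← dist_eq_norm, ← hpz, Real.norm_eq_abs] at h2
  calc |F z| ≤ |D| * Metric.infDist z Γ ^ 2 := by rw [pow_two, ← mul_assoc]; exact h2
    _ ≤ |D| * (B * W z) := by gcongr; exact hBW z hz
    _ = _ := by ring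

end PotentialHyp

/-- The real part of a map. -/
def rp (u : ℂ → ℂ) (z : ℂ) : ℝ := (u z).re

/-- The imaginary part of a map. -/
def ip (u : ℂ → ℂ) (z : ℂ) : ℝ := (u z).im

@[fun_prop]
theorem contDiff_rp {u : ℂ → ℂ} (hu : ContDiff ℝ (⊤ : ℕ∞) u) : ContDiff ℝ (⊤ : ℕ∞) (rp u) :=
  smooth_re_comp hu

@[fun_prop]
theorem contDiff_ip {u : ℂ → ℂ} (hu : ContDiff ℝ (⊤ : ℕ∞) u) : ContDiff ℝ (⊤ : ℕ∞) (ip u) :=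
  smooth_im_comp hu

/-- The squared length of the differential of a map, in coordinates. -/
def tsq (u : ℂ → ℂ) (z : ℂ) : ℝ := gsq (rp u) z + gsq (ip u) z

@[fun_prop]
theorem contDiff_tsq {u : ℂ → ℂ} (hu : ContDiff ℝ (⊤ : ℕ∞) u) : ContDiff ℝ (⊤ : ℕ∞) (tsq u) := by
  unfold tsq; fun_prop

theorem tsq_nonneg (u : ℂ → ℂ) (z : ℂ) : 0 ≤ tsq u z := add_nonneg (gsq_nonneg _ _) (gsq_nonneg _ _)

theorem dx_comp' {F : ℂ → ℝ} {u : ℂ → ℂ} (hF : ContDiff ℝ (⊤ : ℕ∞) F)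
    (hu : ContDiff ℝ (⊤ : ℕ∞) u) (z : ℂ) :
    dx (fun w => F (u w)) z = dx F (u z) * dx (rp u) z + dy F (u z) * dx (ip u) z :=
  dx_comp hF hu z

theorem dy_comp' {F : ℂ → ℝ} {u : ℂ → ℂ} (hF : ContDiff ℝ (⊤ : ℕ∞) F)
    (hu : ContDiff ℝ (⊤ : ℕ∞) u) (z : ℂ) :
    dy (fun w => F (u w)) z = dx F (u z) * dy (rp u) z + dy F (u z) * dy (ip u) z :=
  dy_comp hF hu z

theorem lap_sq {f : ℂ → ℝ} (hf : Smooth f) (z : ℂ) :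
    lap (fun w => f w ^ 2) z = 2 * gsq f z + 2 * f z * lap f z := by
  have h1 : dx (fun w => f w ^ 2) = fun w => 2 * (f w * dx f w) :=
    funext fun w => by rw [dx_sq hf]; ring
  have h2 : dy (fun w => f w ^ 2) = fun w => 2 * (f w * dy f w) :=
    funext fun w => by rw [dy_sq hf]; ring
  unfold lap gsq
  rw [h1, h2]
  simp (disch := fun_prop) only [dx_mul, dy_mul, dx_const, dy_const]
  ring

theorem lap_add {f g : ℂ → ℝ} (hf : Smooth f) (hg : Smooth g) (z : ℂ) :
    lap (fun w => f w + g w) z = lap f z + lap g z := by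
  have h1 : dx (fun w => f w + g w) = fun w => dx f w + dx g w := funext (dx_add hf hg)
  have h2 : dy (fun w => f w + g w) = fun w => dy f w + dy g w := funext (dy_add hf hg)
  rw [lap, h1, h2, dx_add hf.dx hg.dx, dy_add hf.dy hg.dy]
  simp only [lap]; ring

theorem lap_const_mul {f : ℂ → ℝ} (hf : Smooth f) (a : ℝ) (z : ℂ) :
    lap (fun w => a * f w) z = a * lap f z := by
  have h1 : dx (fun w => a * f w) = fun w => a * dx f w :=
    funext fun w => by rw [dx_mul contDiff_const hf, dx_const]; ring
  have h2 : dy (fun w => a * f w) = fun w => a * dy f w :=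
    funext fun w => by rw [dy_mul contDiff_const hf, dy_const]; ring
  rw [lap, h1, h2, dx_mul contDiff_const hf.dx, dy_mul contDiff_const hf.dy, dx_const, dy_const]
  simp only [lap]; ring

theorem hsq_le_two {f g : ℂ → ℝ} (hf : Smooth f) (hg : Smooth g) (z : ℂ) :
    hsq f z ≤ 2 * hsq (fun w => f w - g w) z + 2 * hsq g z := by
  have h1 : dx (fun w => f w - g w) = fun w => dx f w - dx g w := funext (dx_sub hf hg)
  have h2 : dy (fun w => f w - g w) = fun w => dy f w - dy g w := funext (dy_sub hf hg)
  unfold hsq gsq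
  rw [h1, h2]
  simp (disch := fun_prop) only [dx_sub, dy_sub]
  nlinarith [sq_nonneg (dx (dx f) z - 2 * dx (dx g) z), sq_nonneg (dx (dy f) z - 2 * dx (dy g) z),
    sq_nonneg (dy (dx f) z - 2 * dy (dx g) z), sq_nonneg (dy (dy f) z - 2 * dy (dy g) z)]

theorem gsq_le_two {f g : ℂ → ℝ} (hf : Smooth f) (hg : Smooth g) (z : ℂ) :
    gsq f z ≤ 2 * gsq (fun w => f w - g w) z + 2 * gsq g z := by
  unfold gsq
  simp (disch := fun_prop) only [dx_sub, dy_sub]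
  nlinarith [sq_nonneg (dx f z - 2 * dx g z), sq_nonneg (dy f z - 2 * dy g z)]

namespace StarDomain

variable {Ω : Set ℂ} {γ : ℝ → ℂ} {L c : ℝ}

theorem setIntegral_mono (h : StarDomain Ω γ L c) {f g : ℂ → ℝ} (hf : Continuous f)
    (hg : Continuous g) (hfg : ∀ z ∈ Ω, f z ≤ g z) : ∫ z in Ω, f z ≤ ∫ z in Ω, g z :=
  setIntegral_mono_on (h.integrableOn hf) (h.integrableOn hg) h.isOpen.measurableSet hfg

theorem integral_add (h : StarDomain Ω γ L c) {f g : ℂ → ℝ} (hf : Continuous f)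
    (hg : Continuous g) : ∫ z in Ω, (f z + g z) = (∫ z in Ω, f z) + ∫ z in Ω, g z :=
  MeasureTheory.integral_add (h.integrableOn hf) (h.integrableOn hg)

theorem setIntegral_congr (h : StarDomain Ω γ L c) {f g : ℂ → ℝ} (hfg : ∀ z ∈ Ω, f z = g z) :
    ∫ z in Ω, f z = ∫ z in Ω, g z :=
  setIntegral_congr_fun h.isOpen.measurableSet hfg

theorem setIntegral_nonneg (h : StarDomain Ω γ L c) {f : ℂ → ℝ} (hf : ∀ z ∈ Ω, 0 ≤ f z) :
    0 ≤ ∫ z in Ω, f z :=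
  MeasureTheory.setIntegral_nonneg h.isOpen.measurableSet hf

theorem intervalIntegral_mono (h : StarDomain Ω γ L c) {f g : ℂ → ℝ} (hf : Continuous f)
    (hg : Continuous g) (hfg : ∀ z, f z ≤ g z) :
    ∫ s in (0 : ℝ)..L, f (γ s) ≤ ∫ s in (0 : ℝ)..L, g (γ s) :=
  intervalIntegral.integral_mono_on h.Lpos.le (h.intervalIntegrable hf) (h.intervalIntegrable hg)
    fun _ _ => hfg _

theorem intervalIntegral_nonneg (h : StarDomain Ω γ L c) {f : ℂ → ℝ} (hf : ∀ z, 0 ≤ f z) :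
    0 ≤ ∫ s in (0 : ℝ)..L, f (γ s) :=
  intervalIntegral.integral_nonneg h.Lpos.le fun _ _ => hf _

theorem exists_abs_le (h : StarDomain Ω γ L c) {f : ℂ → ℝ} (hf : Continuous f) :
    ∃ B : ℝ, 0 ≤ B ∧ ∀ z ∈ closure Ω, |f z| ≤ B := by
  obtain ⟨B, hB⟩ := h.bounded.isCompact_closure.exists_bound_of_continuousOn hf.continuousOn
  exact ⟨max B 0, le_max_right _ _, fun z hz => (hB z hz).trans (le_max_left _ _)⟩

theorem shell_integral_le (h : StarDomain Ω γ L c) {a : ℝ} (ha : 0 ≤ a) {f : ℂ → ℝ}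
    (hf : Continuous f) (hf0 : ∀ z, 0 ≤ f z) : ∫ z in shell γ L a, f z ≤ ∫ z in Ω, f z :=
  setIntegral_mono_set (h.integrableOn hf) (Filter.Eventually.of_forall hf0)
    (h.shell_subset ha).eventuallyLE

set_option maxHeartbeats 1000000 in
/-- Estimates for a function with prescribed boundary values from `L²` control of its Laplacian
and of its gradient on the boundary. -/
theorem exists_component_bound (h : StarDomain Ω γ L c) {f₀ : ℂ → ℝ} (hf₀ : Smooth f₀) {A : ℝ}
    (hA : 0 ≤ A) : ∃ C : ℝ, 0 ≤ C ∧ ∀ f : ℂ → ℝ, Smooth f → (∀ s, f (γ s) = f₀ (γ s)) →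
      (∀ z ∈ Ω, |f z| ≤ A) → ∀ ε : ℝ, 0 < ε → ∫ z in Ω, lap f z ^ 2 ≤ A * (ε ^ 2)⁻¹ →
      ∫ s in (0 : ℝ)..L, gsq f (γ s) ≤ A →
      ∫ z in Ω, gsq f z ^ 2 ≤ C * (1 + (ε ^ 2)⁻¹) ∧
      (ε ≤ 1 → ∫ z in shell γ L (1 - ε ^ 2 / 2), gsq f z ≤ C * ε ^ 2) ∧
      (1 ≤ ε → ∫ z in Ω, gsq f z ≤ C) := by
  obtain ⟨K, hK, hHess⟩ := h.exists_hessian_bound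
  obtain ⟨B, hB, hLayer⟩ := h.exists_layer_bound
  obtain ⟨m₀, hm₀, hm⟩ := h.exists_abs_le hf₀.continuous
  have c0 : Continuous (lap f₀) := (contDiff_lap hf₀).continuous
  have c1 : Continuous (gsq f₀) := (contDiff_gsq hf₀).continuous
  have c2 : Continuous (hsq f₀) := (contDiff_hsq hf₀).continuous
  set I₁ := ∫ z in Ω, lap f₀ z ^ 2 with hI₁
  set I₂ := ∫ s in (0 : ℝ)..L, gsq f₀ (γ s) with hI₂
  set I₃ := ∫ z in Ω, hsq f₀ z with hI₃
  set I₄ := ∫ z in Ω, gsq f₀ z ^ 2 with hI₄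
  set I₅ := ∫ z in Ω, gsq f₀ z with hI₅
  set I₆ := ∫ z in Ω, (1 : ℝ) with hI₆
  have p1 : 0 ≤ I₁ := h.setIntegral_nonneg fun z _ => sq_nonneg _
  have p2 : 0 ≤ I₂ := h.intervalIntegral_nonneg (gsq_nonneg f₀)
  have p3 : 0 ≤ I₃ := h.setIntegral_nonneg fun z _ => hsq_nonneg f₀ z
  have p4 : 0 ≤ I₄ := h.setIntegral_nonneg fun z _ => sq_nonneg _
  have p5 : 0 ≤ I₅ := h.setIntegral_nonneg fun z _ => gsq_nonneg f₀ z
  have p6 : 0 ≤ I₆ := h.setIntegral_nonneg fun z _ => zero_le_one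
  set C₁ := 2 * A + 2 * I₁ + K * (2 * A + 2 * I₂) with hC₁
  have hC₁0 : 0 ≤ C₁ := by positivity
  set C₂ := 160 * (A + m₀) ^ 2 * C₁ + 8 * I₄ with hC₂
  have hC₂0 : 0 ≤ C₂ := by positivity
  set C₃ := B * (A + 2 * C₁ + 2 * I₃) with hC₃
  have hC₃0 : 0 ≤ C₃ := by positivity
  set C₄ := (A + m₀) ^ 2 * I₆ + 2 * A + 2 * I₁ + 2 * I₅ with hC₄
  have hC₄0 : 0 ≤ C₄ := by positivity
  clear_value C₄ C₃ C₂ C₁ I₁ I₂ I₃ I₄ I₅ I₆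
  refine ⟨C₂ + C₃ + C₄, by positivity, fun f hf hff₀ hfA ε hε hlap hbd => ?_⟩
  have e1 : 0 < (ε ^ 2)⁻¹ := by positivity
  have d0 : Continuous (lap f) := (contDiff_lap hf).continuous
  have d1 : Continuous (gsq f) := (contDiff_gsq hf).continuous
  have d2 : Continuous (hsq f) := (contDiff_hsq hf).continuous
  have hv : Smooth fun z => f z - f₀ z := hf.sub hf₀
  have v0 : Continuous (lap fun z => f z - f₀ z) := (contDiff_lap hv).continuous
  have v1 : Continuous (gsq fun z => f z - f₀ z) := (contDiff_gsq hv).continuous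
  have v2 : Continuous (hsq fun z => f z - f₀ z) := (contDiff_hsq hv).continuous
  have hv0 : ∀ s, (fun z => f z - f₀ z) (γ s) = 0 := fun s => by simp [hff₀ s]
  have hvA : ∀ z ∈ Ω, |(fun z => f z - f₀ z) z| ≤ A + m₀ := fun z hz =>
    (abs_sub _ _).trans (add_le_add (hfA z hz) (hm z (subset_closure hz)))
  have l1 : ∫ z in Ω, lap (fun z => f z - f₀ z) z ^ 2 ≤ 2 * (A * (ε ^ 2)⁻¹) + 2 * I₁ := by
    calc _ ≤ ∫ z in Ω, (2 * lap f z ^ 2 + 2 * lap f₀ z ^ 2) := by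
          refine h.setIntegral_mono (by fun_prop) (by fun_prop) fun z _ => ?_
          rw [lap_sub hf hf₀]
          linarith [sq_nonneg (lap f z + lap f₀ z)]
      _ ≤ _ := by
          rw [h.integral_add (by fun_prop) (by fun_prop), integral_const_mul, integral_const_mul]
          linarith
  have l2 : ∫ s in (0 : ℝ)..L, gsq (fun z => f z - f₀ z) (γ s) ≤ 2 * A + 2 * I₂ := by
    calc _ ≤ ∫ s in (0 : ℝ)..L, (2 * gsq f (γ s) + 2 * gsq f₀ (γ s)) :=
          h.intervalIntegral_mono v1 (g := fun z => 2 * gsq f z + 2 * gsq f₀ z) (by fun_prop)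
            fun z => gsq_sub_le hf hf₀ z
      _ ≤ _ := by
          rw [intervalIntegral.integral_add ((h.intervalIntegrable d1).const_mul 2)
            ((h.intervalIntegrable c1).const_mul 2), intervalIntegral.integral_const_mul,
            intervalIntegral.integral_const_mul]
          linarith
  have l3 : ∫ z in Ω, hsq (fun z => f z - f₀ z) z ≤ C₁ * (1 + (ε ^ 2)⁻¹) := by
    have := hHess _ hv hv0
    have h5 := mul_le_mul_of_nonneg_left l2 hK
    have h6 : 0 ≤ (ε ^ 2)⁻¹ * I₁ := by positivity
    have h7 : 0 ≤ (ε ^ 2)⁻¹ * (K * (2 * A + 2 * I₂)) := by positivity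
    rw [hC₁]
    linarith
  have l4 : ∫ z in Ω, hsq f z ≤ (2 * C₁ + 2 * I₃) * (1 + (ε ^ 2)⁻¹) := by
    calc _ ≤ ∫ z in Ω, (2 * hsq (fun z => f z - f₀ z) z + 2 * hsq f₀ z) :=
          h.setIntegral_mono d2 (by fun_prop) fun z _ => hsq_le_two hf hf₀ z
      _ ≤ _ := by
          rw [h.integral_add (by fun_prop) (by fun_prop), integral_const_mul, integral_const_mul]
          have h6 : 0 ≤ (ε ^ 2)⁻¹ * I₃ := by positivity
          linarith
  refine ⟨?_, fun hε1 => ?_, fun hε1 => ?_⟩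
  · have h1 := h.integral_gsq_sq_le hv hv0 hvA
    have h2 : ∫ z in Ω, gsq f z ^ 2 ≤
        8 * (20 * (A + m₀) ^ 2 * (C₁ * (1 + (ε ^ 2)⁻¹))) + 8 * I₄ := by
      calc _ ≤ ∫ z in Ω, (8 * gsq (fun z => f z - f₀ z) z ^ 2 + 8 * gsq f₀ z ^ 2) := by
            refine h.setIntegral_mono (by fun_prop) (by fun_prop) fun z _ => ?_
            have h3 := gsq_le_two hf hf₀ z
            have h4 := pow_le_pow_left₀ (gsq_nonneg f z) h3 2
            linarith [sq_nonneg (gsq (fun z => f z - f₀ z) z - gsq f₀ z)]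
        _ ≤ _ := by
            rw [h.integral_add (by fun_prop) (by fun_prop), integral_const_mul,
              integral_const_mul]
            have := h1.trans (mul_le_mul_of_nonneg_left l3 (by positivity))
            linarith
    have h6 : 0 ≤ (ε ^ 2)⁻¹ * I₄ := by positivity
    have h7 : 0 ≤ (C₃ + C₄) * (1 + (ε ^ 2)⁻¹) := by positivity
    rw [hC₂]
    linarith
  · have hε2 : ε ^ 2 ≤ 1 := pow_le_one₀ hε.le hε1
    have key : ∀ V : ℂ → ℝ, Smooth V → ∫ z in shell γ L (1 - ε ^ 2 / 2), V z ^ 2 ≤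
        B * (ε ^ 2 / 2 * (∫ s in (0 : ℝ)..L, V (γ s) ^ 2) +
          (ε ^ 2 / 2) ^ 2 * ∫ z in Ω, gsq V z) := by
      intro V hV
      refine (hLayer (ε ^ 2 / 2) (by positivity) (by linarith) V hV).trans ?_
      gcongr
      exact h.shell_integral_le (by linarith) (contDiff_gsq hV).continuous (gsq_nonneg V)
    have cx : Continuous (dx f) := hf.dx.continuous
    have cy : Continuous (dy f) := hf.dy.continuous
    have is : ∀ g : ℂ → ℝ, Continuous g → IntegrableOn g (shell γ L (1 - ε ^ 2 / 2)) :=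
      fun g hg => (h.integrableOn hg).mono_set (h.shell_subset (by linarith))
    have s1 : ∫ z in shell γ L (1 - ε ^ 2 / 2), gsq f z =
        (∫ z in shell γ L (1 - ε ^ 2 / 2), dx f z ^ 2) +
          ∫ z in shell γ L (1 - ε ^ 2 / 2), dy f z ^ 2 :=
      MeasureTheory.integral_add (is _ (cx.pow 2)) (is _ (cy.pow 2))
    have s2 : ∫ s in (0 : ℝ)..L, gsq f (γ s) =
        (∫ s in (0 : ℝ)..L, dx f (γ s) ^ 2) + ∫ s in (0 : ℝ)..L, dy f (γ s) ^ 2 :=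
      intervalIntegral.integral_add (h.intervalIntegrable (cx.pow 2))
        (h.intervalIntegrable (cy.pow 2))
    have s3 : ∫ z in Ω, hsq f z = (∫ z in Ω, gsq (dx f) z) + ∫ z in Ω, gsq (dy f) z :=
      h.integral_add (contDiff_gsq hf.dx).continuous (contDiff_gsq hf.dy).continuous
    have h1 := key _ hf.dx
    have h2 := key _ hf.dy
    have h3 : ∫ z in shell γ L (1 - ε ^ 2 / 2), gsq f z ≤
        B * (ε ^ 2 / 2 * A + (ε ^ 2 / 2) ^ 2 * ((2 * C₁ + 2 * I₃) * (1 + (ε ^ 2)⁻¹))) := by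
      calc _ ≤ B * (ε ^ 2 / 2 * (∫ s in (0 : ℝ)..L, gsq f (γ s)) +
            (ε ^ 2 / 2) ^ 2 * ∫ z in Ω, hsq f z) := by rw [s1, s2, s3]; linarith
        _ ≤ _ := by gcongr
    have h4 : (ε ^ 2 / 2) ^ 2 * ((2 * C₁ + 2 * I₃) * (1 + (ε ^ 2)⁻¹)) =
        (2 * C₁ + 2 * I₃) * (ε ^ 2 * (ε ^ 2 + 1) / 4) := by field_simp; ring
    have h5 : (2 * C₁ + 2 * I₃) * (ε ^ 2 * (ε ^ 2 + 1) / 4) ≤ (2 * C₁ + 2 * I₃) * ε ^ 2 := by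
      gcongr
      nlinarith [sq_nonneg ε]
    rw [h4] at h3
    have h6 : B * (ε ^ 2 / 2 * A + (2 * C₁ + 2 * I₃) * (ε ^ 2 * (ε ^ 2 + 1) / 4)) ≤
        B * (ε ^ 2 * A + (2 * C₁ + 2 * I₃) * ε ^ 2) := by
      gcongr
      linarith [sq_nonneg ε]
    have h7 : 0 ≤ (C₂ + C₄) * ε ^ 2 := by positivity
    have h8 : C₃ * ε ^ 2 = B * (ε ^ 2 * A + (2 * C₁ + 2 * I₃) * ε ^ 2) := by rw [hC₃]; ring
    linarith
  · have hi1 : (ε ^ 2)⁻¹ ≤ 1 := inv_le_one_of_one_le₀ (one_le_pow₀ hε1)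
    have h1 : ∫ z in Ω, gsq (fun z => f z - f₀ z) z ≤
        (1 / 2) * ((A + m₀) ^ 2 * I₆) + (1 / 2) * (2 * (A * (ε ^ 2)⁻¹) + 2 * I₁) := by
      rw [h.integral_gsq_eq hv hv0, ← MeasureTheory.integral_neg]
      calc _ ≤ ∫ z in Ω, ((1 / 2) * ((A + m₀) ^ 2 * 1) +
            (1 / 2) * lap (fun z => f z - f₀ z) z ^ 2) := by
            refine h.setIntegral_mono (by fun_prop) (by fun_prop) fun z hz => ?_
            have h3 := hvA z hz
            have h4 := sq_le_sq' (neg_le_of_abs_le h3) (le_of_abs_le h3)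
            simp only at h4 ⊢
            linarith [sq_nonneg ((f z - f₀ z) + lap (fun z => f z - f₀ z) z)]
        _ ≤ _ := by
            rw [h.integral_add (by fun_prop) (by fun_prop), integral_const_mul,
              integral_const_mul, integral_const_mul, ← hI₆]
            linarith
    calc _ ≤ ∫ z in Ω, (2 * gsq (fun z => f z - f₀ z) z + 2 * gsq f₀ z) :=
          h.setIntegral_mono d1 (by fun_prop) fun z _ => gsq_le_two hf hf₀ z
      _ ≤ _ := by
          rw [h.integral_add (by fun_prop) (by fun_prop), integral_const_mul, integral_const_mul]
          have : A * (ε ^ 2)⁻¹ ≤ A * 1 := mul_le_mul_of_nonneg_left hi1 hA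
          rw [hC₄]
          linarith

end StarDomain

/-- The data of the boundary value problem: domain, target curve, potential, boundary map. -/
structure GLData (Γ : Set ℂ) (τ : ℝ → ℂ) (W : ℂ → ℝ) (R₀ : ℝ) (Ω : Set ℂ) (γ : ℝ → ℂ) (L c : ℝ)
    (g : ℂ → ℂ) : Prop where
  arc : ArcParam Γ τ
  pot : PotentialHyp Γ W R₀
  dom : StarDomain Ω γ L c
  bdry_smooth : ContDiff ℝ (⊤ : ℕ∞) g
  bdry_mem : ∀ s, g (γ s) ∈ Γ

/-- Solutions of the boundary value problem, in coordinates. -/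
structure GLSolution (W : ℂ → ℝ) (Ω : Set ℂ) (γ : ℝ → ℂ) (g : ℂ → ℂ) (ε : ℝ) (u : ℂ → ℂ) :
    Prop where
  pos : 0 < ε
  smooth : ContDiff ℝ (⊤ : ℕ∞) u
  lap_rp : ∀ z ∈ Ω, lap (rp u) z = (ε ^ 2)⁻¹ * dx W (u z)
  lap_ip : ∀ z ∈ Ω, lap (ip u) z = (ε ^ 2)⁻¹ * dy W (u z)
  bdry : ∀ s, u (γ s) = g (γ s)

namespace GLData

variable {Γ : Set ℂ} {τ : ℝ → ℂ} {W : ℂ → ℝ} {R₀ : ℝ} {Ω : Set ℂ} {γ : ℝ → ℂ} {L c : ℝ}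
  {g : ℂ → ℂ}

theorem bdry_W (D : GLData Γ τ W R₀ Ω γ L c g) {ε : ℝ} {u : ℂ → ℂ}
    (hu : GLSolution W Ω γ g ε u) (s : ℝ) : u (γ s) ∈ Γ := by
  rw [hu.bdry]; exact D.bdry_mem s

/-- The maximum principle: solutions take values in the ball of radius `R₀`. -/
theorem norm_le (D : GLData Γ τ W R₀ Ω γ L c g) {ε : ℝ} {u : ℂ → ℂ}
    (hu : GLSolution W Ω γ g ε u) {z : ℂ} (hz : z ∈ closure Ω) : ‖u z‖ ≤ R₀ := by
  have hR := PotentialHyp.R0_pos D.arc D.pot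
  have su := hu.smooth
  obtain ⟨M, hM0, hM⟩ := D.dom.exists_abs_le (f := fun z => z.re ^ 2 + z.im ^ 2)
    (by fun_prop)
  have hu2 : ∀ z, ‖u z‖ ^ 2 = rp u z ^ 2 + ip u z ^ 2 := fun z => norm_sq_eq_re_im _
  have key : ∀ η > (0 : ℝ), ‖u z‖ ^ 2 ≤ R₀ ^ 2 + η * M := by
    intro η hη
    obtain ⟨z₀, hz₀, hmax⟩ := D.dom.bounded.isCompact_closure.exists_isMaxOn ⟨z, hz⟩
      (f := fun z => (rp u z ^ 2 + ip u z ^ 2) + η * (z.re ^ 2 + z.im ^ 2))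
      (Continuous.continuousOn (by
        have := (contDiff_rp su).continuous
        have := (contDiff_ip su).continuous
        fun_prop))
    have hle : ‖u z₀‖ ≤ R₀ := by
      by_cases hin : z₀ ∈ Ω
      · have hloc := hmax.isLocalMax (mem_of_superset (D.dom.isOpen.mem_nhds hin) subset_closure)
        have hl := lap_nonpos_of_isLocalMax (by unfold Smooth; fun_prop) hloc
        rw [lap_add (by unfold Smooth; fun_prop) (by unfold Smooth; fun_prop),
          lap_add (by unfold Smooth; fun_prop) (by unfold Smooth; fun_prop),
          lap_const_mul (by unfold Smooth; fun_prop), lap_add (by unfold Smooth; fun_prop)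
          (by unfold Smooth; fun_prop), lap_sq (contDiff_rp su), lap_sq (contDiff_ip su),
          lap_sq smooth_re, lap_sq smooth_im, hu.lap_rp _ hin, hu.lap_ip _ hin] at hl
        have e1 : dx Complex.re = fun _ => 1 := funext dx_re
        have e2 : dy Complex.re = fun _ => 0 := funext dy_re
        have e3 : dx Complex.im = fun _ => 0 := funext dx_im
        have e4 : dy Complex.im = fun _ => 1 := funext dy_im
        simp only [lap, gsq, e1, e2, e3, e4, dx_const, dy_const] at hl
        by_contra hcon
        have hco := D.pot.coercive _ (not_le.1 hcon)
        have e5 : (gradW W (u z₀)).re = dx W (u z₀) := by simp [gradW, dx]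
        have e6 : (gradW W (u z₀)).im = dy W (u z₀) := by simp [gradW, dy]
        rw [e5, e6] at hco
        have h1 : 0 ≤ (ε ^ 2)⁻¹ * (dx W (u z₀) * (u z₀).re + dy W (u z₀) * (u z₀).im) := by
          have := hu.pos
          positivity
        have h2 := sq_nonneg (dx (rp u) z₀)
        have h3 := sq_nonneg (dy (rp u) z₀)
        have h4 := sq_nonneg (dx (ip u) z₀)
        have h5 := sq_nonneg (dy (ip u) z₀)
        simp only [rp, ip] at hl h2 h3 h4 h5
        linarith
      · have hf : z₀ ∈ frontier Ω := by
          rw [D.dom.isOpen.frontier_eq]; exact ⟨hz₀, hin⟩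
        rw [← D.dom.srange] at hf
        obtain ⟨s, rfl⟩ := hf
        exact (D.pot.R0_large _ (D.bdry_W hu s)).le
    have h1 : (rp u z ^ 2 + ip u z ^ 2) + η * (z.re ^ 2 + z.im ^ 2) ≤
      (rp u z₀ ^ 2 + ip u z₀ ^ 2) + η * (z₀.re ^ 2 + z₀.im ^ 2) := hmax hz
    rw [← hu2, ← hu2] at h1
    have h2 := mul_le_mul_of_nonneg_left ((le_abs_self _).trans (hM z₀ hz₀)) hη.le
    have h3 := pow_le_pow_left₀ (norm_nonneg _) hle 2
    have h4 : 0 ≤ η * (z.re ^ 2 + z.im ^ 2) := by positivity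
    linarith
  have hlim : Tendsto (fun η : ℝ => R₀ ^ 2 + η * M) (𝓝[>] 0) (𝓝 (R₀ ^ 2 + 0 * M)) :=
    ((continuous_const.add (continuous_id.mul continuous_const)).tendsto 0).mono_left
      nhdsWithin_le_nhds
  have := ge_of_tendsto hlim (eventually_mem_nhdsWithin.mono fun η hη => key η hη)
  rw [zero_mul, add_zero] at this
  exact le_of_sq_le_sq this hR.le

/-- The Pohozaev identity. -/
theorem exists_pohozaev (D : GLData Γ τ W R₀ Ω γ L c g) : ∃ C : ℝ, 0 ≤ C ∧ ∀ ε u,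
    GLSolution W Ω γ g ε u → ∫ z in Ω, W (u z) ≤ C * ε ^ 2 ∧
      ∫ s in (0 : ℝ)..L, tsq u (γ s) ≤ C := by
  have h := D.dom
  obtain ⟨C₁, hC₁⟩ := h.exists_rellich_bound (contDiff_rp D.bdry_smooth)
  obtain ⟨C₂, hC₂⟩ := h.exists_rellich_bound (contDiff_ip D.bdry_smooth)
  have hc := h.cpos
  refine ⟨max (C₁ + C₂) 0 / 2 + max (C₁ + C₂) 0 / (c / 4), by positivity, fun ε u hu => ?_⟩
  have hε := hu.pos
  have su := hu.smooth
  have sW := D.pot.smooth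
  have sWu : Smooth fun z => W (u z) := sW.comp su
  have cW : Continuous fun z => W (u z) := sWu.continuous
  have h1 := hC₁ _ (contDiff_rp su) fun s => by simp only [rp, hu.bdry]
  have h2 := hC₂ _ (contDiff_ip su) fun s => by simp only [ip, hu.bdry]
  have hdiv := h.integral_divergence (X := fun z => z.re * W (u z)) (Y := fun z => z.im * W (u z))
    (by unfold Smooth; fun_prop) (by unfold Smooth; fun_prop)
  have hz : ∀ s, W (u (γ s)) = 0 := fun s => (D.pot.eq_zero_iff _).2 (D.bdry_W hu s)
  simp only [hz, mul_zero, zero_mul, sub_zero, intervalIntegral.integral_zero] at hdiv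
  have crp := contDiff_rp su
  have cip := contDiff_ip su
  have c1 : Continuous fun z => (z.re * dx (rp u) z + z.im * dy (rp u) z) * lap (rp u) z :=
    ContDiff.continuous (𝕜 := ℝ) (n := (⊤ : ℕ∞)) (by fun_prop)
  have c2 : Continuous fun z => (z.re * dx (ip u) z + z.im * dy (ip u) z) * lap (ip u) z :=
    ContDiff.continuous (𝕜 := ℝ) (n := (⊤ : ℕ∞)) (by fun_prop)
  have c3 : Continuous fun z => dx (fun z => z.re * W (u z)) z + dy (fun z => z.im * W (u z)) z :=
    ContDiff.continuous (𝕜 := ℝ) (n := (⊤ : ℕ∞)) (by fun_prop)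
  have h3 : (∫ z in Ω, (z.re * dx (rp u) z + z.im * dy (rp u) z) * lap (rp u) z) +
      (∫ z in Ω, (z.re * dx (ip u) z + z.im * dy (ip u) z) * lap (ip u) z) =
      (ε ^ 2)⁻¹ * (-2 * ∫ z in Ω, W (u z)) := by
    rw [← h.integral_add c1 c2]
    calc _ = ∫ z in Ω, ((ε ^ 2)⁻¹ * (dx (fun z => z.re * W (u z)) z +
          dy (fun z => z.im * W (u z)) z)
          + (ε ^ 2)⁻¹ * (-2 * W (u z))) := by
          refine h.setIntegral_congr fun z hz => ?_
          rw [hu.lap_rp z hz, hu.lap_ip z hz, dx_mul smooth_re sWu, dy_mul smooth_im sWu, dx_re,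
            dy_im, dx_comp' sW su, dy_comp' sW su]
          ring
      _ = _ := by
          rw [h.integral_add (by fun_prop) (by fun_prop), integral_const_mul, integral_const_mul,
            integral_const_mul, hdiv]
          ring
  have h4 : ∫ s in (0 : ℝ)..L, tsq u (γ s) =
      (∫ s in (0 : ℝ)..L, gsq (rp u) (γ s)) + ∫ s in (0 : ℝ)..L, gsq (ip u) (γ s) :=
    intervalIntegral.integral_add (h.intervalIntegrable (contDiff_gsq crp).continuous)
      (h.intervalIntegrable (contDiff_gsq cip).continuous)
  have h5 : 0 ≤ ∫ z in Ω, W (u z) := h.setIntegral_nonneg fun z _ => D.pot.nonneg _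
  have h6 : 0 ≤ ∫ s in (0 : ℝ)..L, tsq u (γ s) := h.intervalIntegral_nonneg (tsq_nonneg u)
  set w := ∫ z in Ω, W (u z)
  set b := ∫ s in (0 : ℝ)..L, tsq u (γ s)
  have h7 : c / 4 * b + 2 * ((ε ^ 2)⁻¹ * w) ≤ max (C₁ + C₂) 0 := by
    have := le_max_left (C₁ + C₂) 0
    rw [h4]
    linarith
  have h8 : 0 ≤ (ε ^ 2)⁻¹ * w := by positivity
  have h9 : 0 ≤ c / 4 * b := by positivity
  constructor
  · have h10 : (ε ^ 2)⁻¹ * w ≤ max (C₁ + C₂) 0 / 2 := by linarith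
    rw [inv_mul_le_iff₀ (by positivity)] at h10
    have : 0 ≤ max (C₁ + C₂) 0 / (c / 4) * ε ^ 2 := by positivity
    linarith
  · have h10 : b ≤ max (C₁ + C₂) 0 / (c / 4) := by
      rw [le_div_iff₀ (by positivity)]; linarith
    have : 0 ≤ max (C₁ + C₂) 0 / 2 := by positivity
    linarith

/-- The a priori estimates for solutions. -/
theorem exists_estimates (D : GLData Γ τ W R₀ Ω γ L c g) : ∃ C : ℝ, 0 ≤ C ∧ ∀ ε u,
    GLSolution W Ω γ g ε u → ∫ z in Ω, W (u z) ≤ C * ε ^ 2 ∧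
      ∫ z in Ω, tsq u z ^ 2 ≤ C * (1 + (ε ^ 2)⁻¹) ∧
      (ε ≤ 1 → ∫ z in StarDomain.shell γ L (1 - ε ^ 2 / 2), tsq u z ≤ C * ε ^ 2) ∧
      (1 ≤ ε → ∫ z in Ω, tsq u z ≤ C) := by
  have h := D.dom
  have sW := D.pot.smooth
  have sx : Smooth (dx W) := Smooth.dx sW
  have sy : Smooth (dy W) := Smooth.dy sW
  obtain ⟨C₀, hC₀, hP⟩ := D.exists_pohozaev
  obtain ⟨B₁, hB₁, hW₁⟩ := D.pot.exists_sq_le D.arc sx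
    (fun z hz => by simp [dx, D.pot.fderiv_eq_zero hz])
  obtain ⟨B₂, hB₂, hW₂⟩ := D.pot.exists_sq_le D.arc sy
    (fun z hz => by simp [dy, D.pot.fderiv_eq_zero hz])
  have hR := PotentialHyp.R0_pos D.arc D.pot
  set A := R₀ + C₀ + B₁ * C₀ + B₂ * C₀ with hA
  have n1 : 0 ≤ B₁ * C₀ := by positivity
  have n2 : 0 ≤ B₂ * C₀ := by positivity
  have hA0 : 0 ≤ A := by positivity
  obtain ⟨C₁, hC₁, hb₁⟩ := h.exists_component_bound (contDiff_rp D.bdry_smooth) hA0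
  obtain ⟨C₂, hC₂, hb₂⟩ := h.exists_component_bound (contDiff_ip D.bdry_smooth) hA0
  refine ⟨C₀ + 2 * C₁ + 2 * C₂, by positivity, fun ε u hu => ?_⟩
  obtain ⟨hPW, hPb⟩ := hP ε u hu
  have hε := hu.pos
  have su := hu.smooth
  have crp := contDiff_rp su
  have cip := contDiff_ip su
  have g1 : Continuous (gsq (rp u)) := (contDiff_gsq crp).continuous
  have g2 : Continuous (gsq (ip u)) := (contDiff_gsq cip).continuous
  have cW : Continuous fun z => W (u z) := sW.continuous.comp su.continuous
  have hlap : ∀ (f F : ℂ → ℝ) (B : ℝ), Smooth f → 0 ≤ B → B * C₀ ≤ A →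
      (∀ z ∈ Ω, lap f z = (ε ^ 2)⁻¹ * F (u z)) → (∀ z, ‖z‖ ≤ R₀ → F z ^ 2 ≤ B * W z) →
      ∫ z in Ω, lap f z ^ 2 ≤ A * (ε ^ 2)⁻¹ := by
    intro f F B hf hB hBA hfF hFB
    have := (contDiff_lap hf).continuous
    calc _ ≤ ∫ z in Ω, (((ε ^ 2)⁻¹) ^ 2 * B) * W (u z) := by
          refine h.setIntegral_mono (by fun_prop) (by fun_prop) fun z hz => ?_
          rw [hfF z hz, mul_pow, mul_assoc]
          gcongr
          exact hFB _ (D.norm_le hu (subset_closure hz))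
      _ = (((ε ^ 2)⁻¹) ^ 2 * B) * ∫ z in Ω, W (u z) := integral_const_mul _ _
      _ ≤ (((ε ^ 2)⁻¹) ^ 2 * B) * (C₀ * ε ^ 2) := by gcongr
      _ = (B * C₀) * (ε ^ 2)⁻¹ := by field_simp
      _ ≤ _ := by gcongr
  have hbd : (∫ s in (0 : ℝ)..L, gsq (rp u) (γ s)) ≤ A ∧
      (∫ s in (0 : ℝ)..L, gsq (ip u) (γ s)) ≤ A := by
    have e : C₀ ≤ A := by linarith
    constructor
    · exact ((h.intervalIntegral_mono g1 (contDiff_tsq su).continuous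
        fun z => le_add_of_nonneg_right (gsq_nonneg _ z)).trans hPb).trans e
    · exact ((h.intervalIntegral_mono g2 (contDiff_tsq su).continuous
        fun z => le_add_of_nonneg_left (gsq_nonneg _ z)).trans hPb).trans e
  have hRA : R₀ ≤ A := by linarith
  obtain ⟨a1, a2, a3⟩ := hb₁ _ crp (fun s => by simp only [rp, hu.bdry])
    (fun z hz => ((Complex.abs_re_le_norm _).trans (D.norm_le hu (subset_closure hz))).trans hRA)
    ε hε (hlap _ _ B₁ crp hB₁ (by linarith) hu.lap_rp hW₁) hbd.1
  obtain ⟨b1, b2, b3⟩ := hb₂ _ cip (fun s => by simp only [ip, hu.bdry])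
    (fun z hz => ((Complex.abs_im_le_norm _).trans (D.norm_le hu (subset_closure hz))).trans hRA)
    ε hε (hlap _ _ B₂ cip hB₂ (by linarith) hu.lap_ip hW₂) hbd.2
  refine ⟨?_, ?_, fun hε1 => ?_, fun hε1 => ?_⟩
  · have : 0 ≤ (2 * C₁ + 2 * C₂) * ε ^ 2 := by positivity
    linarith
  · calc ∫ z in Ω, tsq u z ^ 2 ≤ ∫ z in Ω, (2 * gsq (rp u) z ^ 2 + 2 * gsq (ip u) z ^ 2) := by
          refine h.setIntegral_mono ((contDiff_tsq su).continuous.pow 2) (by fun_prop)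
            fun z _ => ?_
          unfold tsq
          linarith [sq_nonneg (gsq (rp u) z - gsq (ip u) z)]
      _ ≤ _ := by
          rw [h.integral_add (by fun_prop) (by fun_prop), integral_const_mul, integral_const_mul]
          have : 0 ≤ C₀ * (1 + (ε ^ 2)⁻¹) := by positivity
          linarith
  · have hε2 : ε ^ 2 ≤ 1 := pow_le_one₀ hε.le hε1
    have is : ∀ g : ℂ → ℝ, Continuous g →
        IntegrableOn g (StarDomain.shell γ L (1 - ε ^ 2 / 2)) :=
      fun g hg => (h.integrableOn hg).mono_set (h.shell_subset (by linarith))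
    have e : ∫ z in StarDomain.shell γ L (1 - ε ^ 2 / 2), tsq u z =
      (∫ z in StarDomain.shell γ L (1 - ε ^ 2 / 2), gsq (rp u) z) +
        ∫ z in StarDomain.shell γ L (1 - ε ^ 2 / 2), gsq (ip u) z :=
      MeasureTheory.integral_add (is _ g1) (is _ g2)
    have := a2 hε1
    have := b2 hε1
    have : 0 ≤ (C₀ + C₁ + C₂) * ε ^ 2 := by positivity
    linarith
  · have e : ∫ z in Ω, tsq u z = (∫ z in Ω, gsq (rp u) z) + ∫ z in Ω, gsq (ip u) z :=
      h.integral_add g1 g2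
    have := a3 hε1
    have := b3 hε1
    linarith

/-- Quantities vanishing on the target curve are negligible when integrated against `|∇u|²`. -/
theorem exists_negligible (D : GLData Γ τ W R₀ Ω γ L c g) {F : ℂ → ℝ} (hF : Continuous F) {B : ℝ}
    (hB : 0 ≤ B) (hFB : ∀ z, ‖z‖ ≤ R₀ → F z ^ 2 ≤ B * W z) : ∃ C : ℝ, 0 ≤ C ∧ ∀ ε u,
    GLSolution W Ω γ g ε u → ε ≤ 1 → ∫ z in Ω, |F (u z)| * tsq u z ≤ C := by
  have h := D.dom
  obtain ⟨C, hC, hest⟩ := D.exists_estimates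
  refine ⟨B * C + C, by positivity, fun ε u hu hε1 => ?_⟩
  obtain ⟨h1, h2, -⟩ := hest ε u hu
  have hε := hu.pos
  have su := hu.smooth
  have hε2 : ε ^ 2 ≤ 1 := pow_le_one₀ hε.le hε1
  have ct : Continuous (tsq u) := (contDiff_tsq su).continuous
  have cF : Continuous fun z => F (u z) := hF.comp su.continuous
  have cW : Continuous fun z => W (u z) := D.pot.smooth.continuous.comp su.continuous
  have c1 : Continuous fun z => (1 / 2 * B * (ε ^ 2)⁻¹) * W (u z) := continuous_const.mul cW
  have c2 : Continuous fun z => (1 / 2 * ε ^ 2) * tsq u z ^ 2 := continuous_const.mul (ct.pow 2)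
  calc ∫ z in Ω, |F (u z)| * tsq u z
      ≤ ∫ z in Ω, ((1 / 2 * B * (ε ^ 2)⁻¹) * W (u z) + (1 / 2 * ε ^ 2) * tsq u z ^ 2) := by
        refine h.setIntegral_mono (cF.abs.mul ct) (c1.add c2) fun z hz => ?_
        have h3 := hFB _ (D.norm_le hu (subset_closure hz))
        have h4 : 2 * (|F (u z)| * tsq u z) ≤ (ε ^ 2)⁻¹ * F (u z) ^ 2 + ε ^ 2 * tsq u z ^ 2 := by
          rw [← sq_abs (F (u z))]
          have h5 := sq_nonneg (ε⁻¹ * |F (u z)| - ε * tsq u z)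
          have h6 : (ε⁻¹ * |F (u z)| - ε * tsq u z) ^ 2 =
            (ε ^ 2)⁻¹ * |F (u z)| ^ 2 + ε ^ 2 * tsq u z ^ 2 - 2 * (|F (u z)| * tsq u z) := by
            field_simp; ring
          linarith
        have h7 := mul_le_mul_of_nonneg_left h3 (by positivity : 0 ≤ (ε ^ 2)⁻¹)
        linarith
    _ ≤ (1 / 2 * B * (ε ^ 2)⁻¹) * (C * ε ^ 2) + (1 / 2 * ε ^ 2) * (C * (1 + (ε ^ 2)⁻¹)) := by
        rw [h.integral_add c1 c2, integral_const_mul, integral_const_mul]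
        gcongr
    _ = 1 / 2 * B * C + 1 / 2 * C * (ε ^ 2 + 1) := by field_simp
    _ ≤ _ := by nlinarith [mul_nonneg hB hC]

end GLData

namespace ArcParam

variable {Γ : Set ℂ} {τ : ℝ → ℂ}

theorem hasDerivAt (h : ArcParam Γ τ) (s : ℝ) : HasDerivAt τ (deriv τ s) s :=
  (h.smooth.differentiable (by simp) s).hasDerivAt

theorem deriv_sq (h : ArcParam Γ τ) (s : ℝ) : (deriv τ s).re ^ 2 + (deriv τ s).im ^ 2 = 1 := by
  rw [← norm_sq_eq_re_im, h.arclength, one_pow]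

/-- Near `τ s₀`, the curve `Γ` consists of points with parameter near `s₀`. -/
theorem exists_local_param (h : ArcParam Γ τ) {s₀ : ℝ} {U : Set ℝ} (hU : U ∈ 𝓝 s₀) :
    ∃ m > 0, ∀ z ∈ Γ, ‖z - τ s₀‖ < m → ∃ s ∈ U, τ s = z := by
  obtain ⟨V, hVU, hVo, hV⟩ := _root_.mem_nhds_iff.1 hU
  let K := τ '' (Set.Icc (s₀ - Real.pi) (s₀ + Real.pi) \ V)
  have hK : IsCompact K := (isCompact_Icc.diff hVo).image h.smooth.continuous
  have hp : τ s₀ ∈ Kᶜ := by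
    rintro ⟨s, ⟨hs, hsV⟩, hss⟩
    obtain ⟨k, hk⟩ := h.inj _ _ hss
    have hπ := Real.pi_pos
    have h1 : (k : ℝ) * 2 ≤ 1 := by nlinarith [hs.2]
    have h2 : -1 ≤ (k : ℝ) * 2 := by nlinarith [hs.1]
    have h3 : k = 0 := by
      have h1' : k * 2 ≤ 1 := by exact_mod_cast h1
      have h2' : -1 ≤ k * 2 := by exact_mod_cast h2
      omega
    rw [h3] at hk
    have : s = s₀ := by simp at hk; linarith
    exact hsV (this ▸ hV)
  obtain ⟨m, hm, hmK⟩ := Metric.isOpen_iff.1 hK.isClosed.isOpen_compl _ hp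
  refine ⟨m, hm, fun z hz hzm => ?_⟩
  have hzK : z ∉ K := hmK (by rwa [mem_ball_iff_norm])
  rw [← h.srange, ← h.periodic.image_Icc Real.two_pi_pos (s₀ - Real.pi)] at hz
  obtain ⟨s, hs, rfl⟩ := hz
  rw [show s₀ - Real.pi + 2 * Real.pi = s₀ + Real.pi by ring] at hs
  refine ⟨s, hVU ?_, rfl⟩
  by_contra hsV
  exact hzK ⟨s, ⟨hs, hsV⟩, rfl⟩

/-- The distance to the curve grows linearly in the normal direction. -/
theorem eventually_le_infDist (h : ArcParam Γ τ) (s₀ : ℝ) :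
    ∀ᶠ r : ℝ in 𝓝 0, |r| / 2 ≤ Metric.infDist (τ s₀ + r * (I * deriv τ s₀)) Γ := by
  have hd := (hasDerivAt_iff_isLittleO.1 (h.hasDerivAt s₀)).def (show (0 : ℝ) < 1 / 6 by norm_num)
  obtain ⟨m, hm, hmU⟩ := h.exists_local_param hd
  filter_upwards [Metric.ball_mem_nhds (0 : ℝ) (half_pos hm)] with r hr
  rw [Metric.mem_ball, dist_zero_right, Real.norm_eq_abs] at hr
  refine (Metric.le_infDist h.nonempty).2 fun z hz => ?_
  have hν : ‖(r : ℂ) * (I * deriv τ s₀)‖ = |r| := by simp [h.arclength]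
  rw [dist_eq_norm]
  rcases lt_or_ge ‖z - τ s₀‖ m with h1 | h1
  · obtain ⟨s, hs, rfl⟩ := hmU z hz h1
    simp only [Set.mem_ofPred_eq] at hs
    set x := s - s₀
    set e := τ s - τ s₀ - x • deriv τ s₀ with he
    have h2 : τ s₀ + (r : ℂ) * (I * deriv τ s₀) - τ s =
        ((-x : ℝ) + (r : ℝ) * I) * deriv τ s₀ - e := by
      rw [he, Complex.real_smul]; push_cast; ring
    have h3 : ‖((-x : ℝ) + (r : ℝ) * I) * deriv τ s₀‖ = Real.sqrt (x ^ 2 + r ^ 2) := by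
      rw [norm_mul, h.arclength, mul_one, Complex.norm_add_mul_I]
      congr 1; ring
    have h4 : 2 / 3 * |x| + |r| / 2 - |x| / 2 ≤ Real.sqrt (x ^ 2 + r ^ 2) := by
      apply Real.le_sqrt_of_sq_le
      rw [← sq_abs x, ← sq_abs r]
      nlinarith [sq_nonneg (|x| - |r|), abs_nonneg x, abs_nonneg r, sq_nonneg (|x|),
        sq_nonneg (|r|)]
    rw [h2]
    have h5 := norm_sub_norm_le (((-x : ℝ) + (r : ℝ) * I) * deriv τ s₀) e
    rw [h3] at h5
    rw [Real.norm_eq_abs] at hs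
    linarith
  · have h2 : z - τ s₀ = (r : ℂ) * (I * deriv τ s₀) - (τ s₀ + (r : ℂ) * (I * deriv τ s₀) - z) := by
      ring
    have h3 := norm_sub_le ((r : ℂ) * (I * deriv τ s₀)) (τ s₀ + (r : ℂ) * (I * deriv τ s₀) - z)
    rw [← h2, hν] at h3
    linarith [abs_nonneg r]

open scoped Manifold in
/-- The unit tangent field of the curve extends to a smooth field on the plane. -/
theorem exists_tangent (h : ArcParam Γ τ) :
    ∃ T : ℂ → ℂ, ContDiff ℝ (⊤ : ℕ∞) T ∧ ∀ s, T (τ s) = deriv τ s := by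
  have hloc : ∀ z : ℂ, ∃ U ∈ 𝓝 z, ∃ f : ℂ → ℂ, ContMDiffOn 𝓘(ℝ, ℂ) 𝓘(ℝ, ℂ) (⊤ : ℕ∞) f U ∧
      ∀ y ∈ U, f y ∈ {w : ℂ | ∀ s, τ s = y → w = deriv τ s} := by
    intro z
    by_cases hz : z ∈ Γ
    · rw [← h.srange] at hz
      obtain ⟨s₀, rfl⟩ := hz
      set t := deriv τ s₀
      let k : ℝ → ℝ := fun s => (τ s).re * t.re + (τ s).im * t.im
      have hτ := h.smooth
      have hk : ContDiff ℝ (⊤ : ℕ∞) k := by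
        have h1 : ContDiff ℝ (⊤ : ℕ∞) fun s => (τ s).re := Complex.reCLM.contDiff.comp hτ
        have h2 : ContDiff ℝ (⊤ : ℕ∞) fun s => (τ s).im := Complex.imCLM.contDiff.comp hτ
        exact (h1.mul contDiff_const).add (h2.mul contDiff_const)
      have hk' : HasDerivAt k 1 s₀ := by
        have h1 := Complex.reCLM.hasFDerivAt.comp_hasDerivAt s₀ (h.hasDerivAt s₀)
        have h2 := Complex.imCLM.hasFDerivAt.comp_hasDerivAt s₀ (h.hasDerivAt s₀)
        have h3 := (h1.mul_const t.re).add (h2.mul_const t.im)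
        convert! h3 using 1
        have := h.deriv_sq s₀
        simp only [Complex.reCLM_apply, Complex.imCLM_apply]
        linarith
      have hk'' : HasFDerivAt k ((ContinuousLinearEquiv.refl ℝ ℝ : ℝ ≃L[ℝ] ℝ) : ℝ →L[ℝ] ℝ) s₀ := by
        convert! hk'.hasFDerivAt using 1
        ext; simp
      let e := hk.contDiffAt.toOpenPartialHomeomorph k hk'' (by simp)
      let q : ℝ → ℝ := e.symm
      have hs₀ : s₀ ∈ e.source := hk.contDiffAt.mem_toOpenPartialHomeomorph_source hk'' (by simp)
      have hqs : ∀ᶠ s in 𝓝 s₀, q (k s) = s := e.eventually_left_inverse hs₀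
      have hq0 : q (k s₀) = s₀ := e.left_inv hs₀
      have htgt : k s₀ ∈ e.target := e.map_source hs₀
      have hq : ∀ᶠ y in 𝓝 (k s₀), ContDiffAt ℝ (⊤ : ℕ∞) q y := by
        have hqc : Tendsto q (𝓝 (k s₀)) (𝓝 s₀) := by
          have := (e.symm.continuousAt htgt).tendsto
          rwa [show e.symm (k s₀) = s₀ from hq0] at this
        have h1 : ∀ᶠ s in 𝓝 s₀, deriv k s ≠ 0 :=
          (hk.continuous_deriv (by simp)).continuousAt.eventually_ne (by rw [hk'.deriv]; simp)
        filter_upwards [hqc.eventually h1, e.open_target.mem_nhds htgt] with y hy hyt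
        exact e.contDiffAt_symm_deriv hy hyt
          (hk.differentiable (by simp) _).hasDerivAt hk.contDiffAt
      obtain ⟨m, hm, hmU⟩ := h.exists_local_param hqs
      let κ : ℂ → ℝ := fun z => z.re * t.re + z.im * t.im
      have hκ : ContDiff ℝ (⊤ : ℕ∞) κ := by fun_prop
      have h1 : ContDiff ℝ (⊤ : ℕ∞) (deriv τ) := (contDiff_infty_iff_deriv.1 hτ).2
      obtain ⟨V, hV, hVq⟩ := (hκ.continuous.tendsto (τ s₀)).eventually hq |>.exists_mem
      refine ⟨V ∩ Metric.ball (τ s₀) m, inter_mem hV (Metric.ball_mem_nhds _ hm),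
        fun z => deriv τ (q (κ z)), ?_, ?_⟩
      · exact contMDiffOn_iff_contDiffOn.2 fun y hy => (h1.contDiffAt.comp y
          (ContDiffAt.comp y (f := κ) (g := q) (hVq y hy.1) hκ.contDiffAt)).contDiffWithinAt
      · rintro y ⟨-, hy⟩ s rfl
        obtain ⟨s', hs', hss'⟩ := hmU (τ s) (h.mem s) (by rwa [← mem_ball_iff_norm])
        obtain ⟨n, hn⟩ := h.inj _ _ hss'
        have h1 : q (κ (τ s)) = s' := by rw [← hss']; exact hs'
        have h2 : Function.Periodic (deriv τ) (2 * Real.pi) := by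
          intro s
          have : (fun x => τ (x + 2 * Real.pi)) = τ := funext h.periodic
          rw [← deriv_comp_add_const, this]
        change deriv τ (q (κ (τ s))) = deriv τ s
        rw [h1, show s' = s + n * (2 * Real.pi) by linarith]
        exact h2.int_mul n s
    · refine ⟨Γᶜ, h.isCompact.isClosed.isOpen_compl.mem_nhds hz, fun _ => 0,
        contMDiffOn_const, ?_⟩
      rintro y hy s rfl
      exact absurd (h.mem s) hy
  have hconv : ∀ y, Convex ℝ {w : ℂ | ∀ s, τ s = y → w = deriv τ s} := by
    intro y v hv w hw a b ha hb hab s hs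
    rw [hv s hs, hw s hs, ← add_smul, hab, one_smul]
  obtain ⟨T, hT⟩ := exists_contMDiffMap_forall_mem_convex_of_local 𝓘(ℝ, ℂ) hconv hloc
  exact ⟨T, T.contMDiff.contDiff, fun s => hT (τ s) s rfl⟩

end ArcParam

namespace ArcParam

variable {Γ : Set ℂ} {τ : ℝ → ℂ}

theorem dx_dy_tangent_eq_zero (h : ArcParam Γ τ) {F : ℂ → ℝ} (hF : Smooth F)
    (hF0 : ∀ z ∈ Γ, F z = 0) (s : ℝ) :
    (deriv τ s).re * dx F (τ s) + (deriv τ s).im * dy F (τ s) = 0 := by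
  have h1 := hasDerivAt_comp_curve hF (h.hasDerivAt s)
  have h2 : (fun t => F (τ t)) = fun _ => 0 := funext fun t => hF0 _ (h.mem t)
  rw [h2] at h1
  exact h1.unique (hasDerivAt_const _ _)

end ArcParam

namespace PotentialHyp

variable {Γ : Set ℂ} {τ : ℝ → ℂ} {W : ℂ → ℝ} {R₀ : ℝ}

theorem dx_eq_zero (hW : PotentialHyp Γ W R₀) {z : ℂ} (hz : z ∈ Γ) : dx W z = 0 := by
  rw [dx, hW.fderiv_eq_zero hz]; rfl

theorem dy_eq_zero (hW : PotentialHyp Γ W R₀) {z : ℂ} (hz : z ∈ Γ) : dy W z = 0 := by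
  rw [dy, hW.fderiv_eq_zero hz]; rfl

/-- On the zero set the Hessian of `W` is a multiple of `ν ⊗ ν`, with `ν` the unit normal. -/
theorem hessian_eq (hΓ : ArcParam Γ τ) (hW : PotentialHyp Γ W R₀) (s : ℝ) :
    dx (dx W) (τ s) = lap W (τ s) * (deriv τ s).im ^ 2 ∧
    dx (dy W) (τ s) = -(lap W (τ s) * ((deriv τ s).re * (deriv τ s).im)) ∧
    dy (dy W) (τ s) = lap W (τ s) * (deriv τ s).re ^ 2 := by
  have hs : Smooth W := hW.smooth
  have h1 := hΓ.dx_dy_tangent_eq_zero hs.dx (fun z hz => hW.dx_eq_zero hz) s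
  have h2 := hΓ.dx_dy_tangent_eq_zero hs.dy (fun z hz => hW.dy_eq_zero hz) s
  rw [dy_dx_comm hs] at h1
  have h3 := hΓ.deriv_sq s
  rw [lap]
  set a := (deriv τ s).re
  set b := (deriv τ s).im
  refine ⟨?_, ?_, ?_⟩
  · linear_combination -dx (dx W) (τ s) * h3 + a * h1 - b * h2
  · linear_combination -dx (dy W) (τ s) * h3 + b * h1 + a * h2
  · linear_combination -dy (dy W) (τ s) * h3 - a * h1 + b * h2

theorem exists_le_lap (hΓ : ArcParam Γ τ) (hW : PotentialHyp Γ W R₀) :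
    ∃ l > 0, ∀ z ∈ Γ, l ≤ lap W z := by
  obtain ⟨μ, hμ, δ, hδ, h⟩ := hW.nondeg
  refine ⟨μ / 2, half_pos hμ, fun z hz => ?_⟩
  rw [← hΓ.srange] at hz
  obtain ⟨s, rfl⟩ := hz
  have hs : Smooth W := hW.smooth
  set a := (deriv τ s).re with ha
  set b := (deriv τ s).im with hb
  let p : ℝ → ℂ := fun r => τ s + r * (I * deriv τ s)
  have hp : ∀ r, HasDerivAt p (I * deriv τ s) r := fun r => by
    have h1 := ((hasDerivAt_id (r : ℂ)).comp_ofReal.mul_const (I * deriv τ s)).const_add (τ s)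
    simpa [p] using h1
  have hp0 : p 0 = τ s := by simp [p]
  have hre : (I * deriv τ s).re = -b := by simp [hb]
  have him : (I * deriv τ s).im = a := by simp [ha]
  let k : ℝ → ℝ := fun r => μ / 4 * r ^ 2 - W (p r)
  have hk1 : ∀ r, HasDerivAt k (μ / 2 * r - (-b * dx W (p r) + a * dy W (p r))) r := fun r => by
    have h1 := hasDerivAt_comp_curve hs (hp r)
    rw [hre, him] at h1
    have h2 := (((hasDerivAt_id r).pow 2).const_mul (μ / 4)).sub h1
    convert! h2 using 1
    simp; ring
  have hk2 : HasDerivAt (deriv k) (μ / 2 - lap W (τ s)) 0 := by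
    have h1 := hasDerivAt_comp_curve hs.dx (hp 0)
    have h2 := hasDerivAt_comp_curve hs.dy (hp 0)
    have h3 := ((hasDerivAt_id (0 : ℝ)).const_mul (μ / 2)).sub
      ((h1.const_mul (-b)).add (h2.const_mul a))
    rw [funext fun r => (hk1 r).deriv]
    convert! h3 using 1
    obtain ⟨e1, e2, e3⟩ := hW.hessian_eq hΓ s
    have h4 := hΓ.deriv_sq s
    rw [hre, him, hp0, dy_dx_comm hs, e1, e2, e3, ← ha, ← hb]
    rw [← ha, ← hb] at h4
    linear_combination lap W (τ s) * (1 + (a ^ 2 + b ^ 2)) * h4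
  have hmax : IsLocalMax k 0 := by
    have hc : Tendsto (fun r => |r|) (𝓝 (0 : ℝ)) (𝓝 0) := by
      simpa using (continuous_abs.tendsto (0 : ℝ))
    have hnear : ∀ᶠ r : ℝ in 𝓝 0, Metric.infDist (p r) Γ < δ := by
      have hc : Continuous fun r => Metric.infDist (p r) Γ :=
        (Metric.continuous_infDist_pt Γ).comp
          (continuous_iff_continuousAt.2 fun r => (hp r).continuousAt)
      refine hc.continuousAt.eventually_lt continuousAt_const ?_
      rw [hp0, Metric.infDist_zero_of_mem (hΓ.mem s)]
      exact hδ
    filter_upwards [hnear, hΓ.eventually_le_infDist s] with r h1 h2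
    have h3 := h _ h1
    have h4 : W (p 0) = 0 := by rw [hp0]; exact (hW.eq_zero_iff _).2 (hΓ.mem s)
    have h5 : (|r| / 2) ^ 2 ≤ Metric.infDist (p r) Γ ^ 2 := by
      exact pow_le_pow_left₀ (by positivity) h2 2
    simp only [k, h4]
    have h6 : (|r| / 2) ^ 2 = r ^ 2 / 4 := by rw [div_pow, sq_abs]; norm_num
    nlinarith
  have := deriv_deriv_nonpos_of_isLocalMax (hk1 0).continuousAt hmax
  rw [hk2.deriv] at this
  linarith

end PotentialHyp

/-- Smooth vector fields on the plane adapted to `W` along its zero set `Γ`: `(a, b)`,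
`(A₁, A₂)` and `(B₁, B₂)` all restrict to the unit tangent; the second one is curl free along
`Γ`, and the third one has vanishing symmetrized derivative along `Γ`. -/
structure AdaptedFields (Γ : Set ℂ) (W a b A₁ A₂ B₁ B₂ : ℂ → ℝ) : Prop where
  smooth_a : Smooth a
  smooth_b : Smooth b
  smooth_A₁ : Smooth A₁
  smooth_A₂ : Smooth A₂
  smooth_B₁ : Smooth B₁
  smooth_B₂ : Smooth B₂
  unit : ∀ z ∈ Γ, a z ^ 2 + b z ^ 2 = 1
  A₁_eq : ∀ z ∈ Γ, A₁ z = a z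
  A₂_eq : ∀ z ∈ Γ, A₂ z = b z
  B₁_eq : ∀ z ∈ Γ, B₁ z = a z
  B₂_eq : ∀ z ∈ Γ, B₂ z = b z
  curl_A : ∀ z ∈ Γ, dx A₂ z - dy A₁ z = 0
  dx_B₁ : ∀ z ∈ Γ, dx B₁ z = 0
  dxy_B : ∀ z ∈ Γ, dy B₁ z + dx B₂ z = 0
  dy_B₂ : ∀ z ∈ Γ, dy B₂ z = 0
  dx_dx : ∀ z ∈ Γ, dx (dx W) z = lap W z * b z ^ 2
  dx_dy : ∀ z ∈ Γ, dx (dy W) z = -(lap W z * (a z * b z))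
  dy_dy : ∀ z ∈ Γ, dy (dy W) z = lap W z * a z ^ 2

theorem exists_adaptedFields {Γ : Set ℂ} {τ : ℝ → ℂ} {W : ℂ → ℝ} {R₀ : ℝ}
    (hΓ : ArcParam Γ τ) (hW : PotentialHyp Γ W R₀) :
    ∃ a b A₁ A₂ B₁ B₂, AdaptedFields Γ W a b A₁ A₂ B₁ B₂ := by
  have sW : Smooth W := hW.smooth
  obtain ⟨T, hT, hTτ⟩ := hΓ.exists_tangent
  obtain ⟨l, hl, hlap⟩ := hW.exists_le_lap hΓ
  obtain ⟨a, ha⟩ : ∃ a : ℂ → ℝ, a = rp T := ⟨_, rfl⟩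
  obtain ⟨b, hb⟩ : ∃ b : ℂ → ℝ, b = ip T := ⟨_, rfl⟩
  have sa : Smooth a := by rw [ha]; exact smooth_re_comp hT
  have sb : Smooth b := by rw [hb]; exact smooth_im_comp hT
  have haτ : ∀ s, a (τ s) = (deriv τ s).re := fun s => by rw [ha, rp, hTτ]
  have hbτ : ∀ s, b (τ s) = (deriv τ s).im := fun s => by rw [hb, ip, hTτ]
  have forall_mem : ∀ P : ℂ → Prop, (∀ s, P (τ s)) → ∀ z ∈ Γ, P z := by
    intro P hP z hz
    rw [← hΓ.srange] at hz
    obtain ⟨s, rfl⟩ := hz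
    exact hP s
  have unit : ∀ z ∈ Γ, a z ^ 2 + b z ^ 2 = 1 := forall_mem _ fun s => by
    rw [haτ, hbτ]; exact hΓ.deriv_sq s
  have hxx : ∀ z ∈ Γ, dx (dx W) z = lap W z * b z ^ 2 := forall_mem _ fun s => by
    rw [hbτ]; exact (hW.hessian_eq hΓ s).1
  have hxy : ∀ z ∈ Γ, dx (dy W) z = -(lap W z * (a z * b z)) := forall_mem _ fun s => by
    rw [haτ, hbτ]; exact (hW.hessian_eq hΓ s).2.1
  have hyy : ∀ z ∈ Γ, dy (dy W) z = lap W z * a z ^ 2 := forall_mem _ fun s => by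
    rw [haτ]; exact (hW.hessian_eq hΓ s).2.2
  have hTT : ∀ z ∈ Γ, a z ^ 2 * dx a z + a z * b z * (dy a z + dx b z) + b z ^ 2 * dy b z = 0 :=
    forall_mem _ fun s => by
      have h1 := hΓ.dx_dy_tangent_eq_zero (F := fun z => a z ^ 2 + b z ^ 2 - 1)
        (by unfold Smooth; fun_prop)
        (fun z hz => by rw [unit z hz, sub_self]) s
      simp (disch := fun_prop) only [dx_sub, dy_sub, dx_add, dy_add, dx_sq, dy_sq, dx_const,
        dy_const] at h1
      rw [← haτ, ← hbτ] at h1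
      linear_combination h1 / 2
  -- a defining function of `Γ` with unit gradient along `Γ`
  obtain ⟨d, sd, hd, hdx, hdy⟩ : ∃ d, Smooth d ∧ (∀ z ∈ Γ, d z = 0) ∧ (∀ z ∈ Γ, dx d z = -b z) ∧
      ∀ z ∈ Γ, dy d z = a z := by
    obtain ⟨N, hN⟩ : ∃ N : ℂ → ℝ, N = fun z => a z * dy W z - b z * dx W z := ⟨_, rfl⟩
    obtain ⟨ρ, hρ⟩ : ∃ ρ : ℂ → ℝ, ρ = fun z => lap W z / (lap W z ^ 2 + W z) := ⟨_, rfl⟩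
    have sN : Smooth N := by rw [hN]; unfold Smooth; fun_prop
    have hpos : ∀ z, lap W z ^ 2 + W z ≠ 0 := fun z => by
      by_cases hz : z ∈ Γ
      · have := hlap z hz
        have := hW.nonneg z
        nlinarith
      · have h1 : W z ≠ 0 := fun h => hz ((hW.eq_zero_iff _).1 h)
        have h2 := (hW.nonneg z).lt_of_ne' h1
        positivity
    have slap : Smooth (lap W) := by unfold Smooth; fun_prop
    have sρ : Smooth ρ := by rw [hρ]; exact slap.div ((slap.pow 2).add sW) hpos
    have hN0 : ∀ z ∈ Γ, N z = 0 := fun z hz => by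
      rw [hN]; simp [hW.dx_eq_zero hz, hW.dy_eq_zero hz]
    have hρΓ : ∀ z ∈ Γ, ρ z * lap W z = 1 := fun z hz => by
      have h1 := hlap z hz
      have h2 : lap W z ≠ 0 := by linarith
      simp only [hρ]
      rw [(hW.eq_zero_iff _).2 hz]
      field_simp
      ring
    refine ⟨fun z => N z * ρ z, sN.mul sρ, fun z hz => by simp [hN0 z hz], fun z hz => ?_,
      fun z hz => ?_⟩
    · rw [dx_mul sN sρ, hN0 z hz]
      have : dx N z = -b z * lap W z := by
        rw [hN]
        simp (disch := fun_prop) only [dx_sub, dx_mul]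
        rw [hW.dx_eq_zero hz, hW.dy_eq_zero hz, hxx z hz, hxy z hz]
        linear_combination -b z * lap W z * unit z hz
      rw [this]
      linear_combination -b z * hρΓ z hz
    · rw [dy_mul sN sρ, hN0 z hz]
      have : dy N z = a z * lap W z := by
        rw [hN]
        simp (disch := fun_prop) only [dy_sub, dy_mul]
        rw [hW.dx_eq_zero hz, hW.dy_eq_zero hz, dy_dx_comm sW, hyy z hz, hxy z hz]
        linear_combination a z * lap W z * unit z hz
      rw [this]
      linear_combination a z * hρΓ z hz
  obtain ⟨S, hS⟩ : ∃ S : ℂ → ℝ, S = fun z => -2 * (-(a z * b z) * dx a z +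
    (a z ^ 2 - b z ^ 2) * ((dy a z + dx b z) / 2) + a z * b z * dy b z) := ⟨_, rfl⟩
  obtain ⟨Q, hQ⟩ : ∃ Q : ℂ → ℝ, Q = fun z => -(b z ^ 2 * dx a z -
    2 * (a z * b z) * ((dy a z + dx b z) / 2) + a z ^ 2 * dy b z) := ⟨_, rfl⟩
  have sS : Smooth S := by rw [hS]; unfold Smooth; fun_prop
  have sQ : Smooth Q := by rw [hQ]; unfold Smooth; fun_prop
  obtain ⟨V₁, hV₁⟩ : ∃ V : ℂ → ℝ, V = fun z => S z * a z - Q z * b z := ⟨_, rfl⟩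
  obtain ⟨V₂, hV₂⟩ : ∃ V : ℂ → ℝ, V = fun z => S z * b z + Q z * a z := ⟨_, rfl⟩
  have sV₁ : Smooth V₁ := by rw [hV₁]; unfold Smooth; fun_prop
  have sV₂ : Smooth V₂ := by rw [hV₂]; unfold Smooth; fun_prop
  obtain ⟨φ, hφ⟩ : ∃ φ : ℂ → ℝ, φ = fun z => 1 + d z * (dx b z - dy a z) := ⟨_, rfl⟩
  have sφ : Smooth φ := by rw [hφ]; unfold Smooth; fun_prop
  have hφ1 : ∀ z ∈ Γ, φ z = 1 := fun z hz => by simp [hφ, hd z hz]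
  have hφx : ∀ z ∈ Γ, dx φ z = -b z * (dx b z - dy a z) := fun z hz => by
    rw [hφ]
    simp (disch := fun_prop) only [dx_add, dx_mul, dx_const, dx_sub]
    rw [hd z hz, hdx z hz]; ring
  have hφy : ∀ z ∈ Γ, dy φ z = a z * (dx b z - dy a z) := fun z hz => by
    rw [hφ]
    simp (disch := fun_prop) only [dy_add, dy_mul, dy_const, dy_sub]
    rw [hd z hz, hdy z hz]; ring
  refine ⟨a, b, fun z => φ z * a z, fun z => φ z * b z, fun z => a z + d z * V₁ z,
    fun z => b z + d z * V₂ z, ⟨sa, sb, sφ.mul sa, sφ.mul sb, sa.add (sd.mul sV₁),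
    sb.add (sd.mul sV₂), unit, fun z hz => by simp [hφ1 z hz], fun z hz => by simp [hφ1 z hz],
    fun z hz => by simp [hd z hz], fun z hz => by simp [hd z hz], fun z hz => ?_, fun z hz => ?_,
    fun z hz => ?_, fun z hz => ?_, hxx, hxy, hyy⟩⟩
  · simp (disch := fun_prop) only [dx_mul, dy_mul]
    rw [hφ1 z hz, hφx z hz, hφy z hz]
    linear_combination -(dx b z - dy a z) * unit z hz
  · simp (disch := fun_prop) only [dx_mul, dx_add]
    rw [hd z hz, hdx z hz, hV₁]
    simp only [hS, hQ]
    linear_combination a z ^ 2 * hTT z hz - dx a z * (1 + a z ^ 2 + b z ^ 2) * unit z hz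
  · simp (disch := fun_prop) only [dx_mul, dx_add, dy_mul, dy_add]
    rw [hd z hz, hdx z hz, hdy z hz, hV₁, hV₂]
    simp only [hS, hQ]
    linear_combination 2 * a z * b z * hTT z hz -
      (dy a z + dx b z) * (1 + a z ^ 2 + b z ^ 2) * unit z hz
  · simp (disch := fun_prop) only [dy_mul, dy_add]
    rw [hd z hz, hdy z hz, hV₂]
    simp only [hS, hQ]
    linear_combination b z ^ 2 * hTT z hz - dy b z * (1 + a z ^ 2 + b z ^ 2) * unit z hz

theorem exists_abs_le_closedBall {F : ℂ → ℝ} (hF : Continuous F) (R : ℝ) :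
    ∃ B : ℝ, 0 ≤ B ∧ ∀ z, ‖z‖ ≤ R → |F z| ≤ B := by
  obtain ⟨B, hB⟩ := (isCompact_closedBall (0 : ℂ) R).exists_bound_of_continuousOn hF.continuousOn
  exact ⟨max B 0, le_max_right _ _, fun z hz =>
    (hB z (by simpa using hz)).trans (le_max_left _ _)⟩

/-- A continuous function bounded by a multiple of `√W` on the ball of radius `R`. -/
structure Negligible (W : ℂ → ℝ) (R : ℝ) (F : ℂ → ℝ) : Prop where
  continuous : Continuous F
  sq_le : ∃ B : ℝ, 0 ≤ B ∧ ∀ z, ‖z‖ ≤ R → F z ^ 2 ≤ B * W z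

namespace Negligible

variable {W F G : ℂ → ℝ} {R : ℝ}

theorem add (hF : Negligible W R F) (hG : Negligible W R G) :
    Negligible W R fun z => F z + G z := by
  obtain ⟨B, hB, hBF⟩ := hF.sq_le
  obtain ⟨D, hD, hDG⟩ := hG.sq_le
  refine ⟨hF.continuous.add hG.continuous, 2 * B + 2 * D, by positivity, fun z hz => ?_⟩
  nlinarith [hBF z hz, hDG z hz, sq_nonneg (F z - G z)]

theorem abs (hF : Negligible W R F) : Negligible W R fun z => |F z| := by
  obtain ⟨B, hB, hBF⟩ := hF.sq_le
  exact ⟨hF.continuous.abs, B, hB, fun z hz => by rw [sq_abs]; exact hBF z hz⟩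

theorem continuous_mul (hF : Negligible W R F) (hG : Continuous G) :
    Negligible W R fun z => G z * F z := by
  obtain ⟨B, hB, hBF⟩ := hF.sq_le
  obtain ⟨D, hD, hDG⟩ := exists_abs_le_closedBall hG R
  refine ⟨hG.mul hF.continuous, D ^ 2 * B, by positivity, fun z hz => ?_⟩
  have h1 : G z ^ 2 ≤ D ^ 2 := by
    rw [← sq_abs (G z)]; exact pow_le_pow_left₀ (abs_nonneg _) (hDG z hz) 2
  rw [mul_pow, mul_assoc]
  exact mul_le_mul h1 (hBF z hz) (sq_nonneg _) (by positivity)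

theorem self (hc : Continuous W) (hW : ∀ z, 0 ≤ W z) : Negligible W R W := by
  obtain ⟨D, hD, hDG⟩ := exists_abs_le_closedBall hc R
  refine ⟨hc, D, hD, fun z hz => ?_⟩
  rw [pow_two]
  exact mul_le_mul_of_nonneg_right ((le_abs_self _).trans (hDG z hz)) (hW z)

end Negligible

namespace PotentialHyp

variable {Γ : Set ℂ} {τ : ℝ → ℂ} {W : ℂ → ℝ} {R₀ : ℝ}

theorem negligible (hΓ : ArcParam Γ τ) (hW : PotentialHyp Γ W R₀) {F : ℂ → ℝ} (hF : Smooth F)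
    (hF0 : ∀ z ∈ Γ, F z = 0) : Negligible W R₀ F :=
  ⟨hF.continuous, hW.exists_sq_le hΓ hF hF0⟩

theorem exists_le_lap_add (hΓ : ArcParam Γ τ) (hW : PotentialHyp Γ W R₀) :
    ∃ l > 0, ∃ B : ℝ, 0 ≤ B ∧ ∀ z, ‖z‖ ≤ R₀ → l ≤ lap W z + B * W z := by
  obtain ⟨l, hl, hlap⟩ := hW.exists_le_lap hΓ
  have sW : Smooth W := hW.smooth
  have cl : Continuous (lap W) := ContDiff.continuous (𝕜 := ℝ) (n := (⊤ : ℕ∞)) (by fun_prop)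
  let K := Metric.closedBall (0 : ℂ) R₀ ∩ {z | lap W z ≤ l / 2}
  have hK : IsCompact K :=
    (isCompact_closedBall _ _).inter_right (isClosed_le cl continuous_const)
  have hpos : ∀ z ∈ K, 0 < W z := fun z hz => by
    refine (hW.nonneg z).lt_of_ne' fun h => ?_
    have h1 := hlap z ((hW.eq_zero_iff _).1 h)
    have h2 : lap W z ≤ l / 2 := hz.2
    linarith
  obtain ⟨B, hB⟩ := hK.exists_bound_of_continuousOn (f := fun z => (l / 2 - lap W z) / W z)
    ((continuousOn_const.sub cl.continuousOn).div sW.continuous.continuousOn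
      fun z hz => (hpos z hz).ne')
  refine ⟨l / 2, half_pos hl, max B 0, le_max_right _ _, fun z hz => ?_⟩
  have h0 := mul_nonneg (le_max_right B 0) (hW.nonneg z)
  by_cases h : lap W z ≤ l / 2
  · have hzK : z ∈ K := ⟨by simpa using hz, h⟩
    have h1 := ((le_abs_self _).trans (hB z hzK)).trans (le_max_left B 0)
    rw [div_le_iff₀ (hpos z hzK)] at h1
    linarith
  · linarith [not_le.1 h]

end PotentialHyp

/-- The `dx` component of the pull-back of the form `A₁ dx + A₂ dy` under `u`. -/
def pullX (A₁ A₂ : ℂ → ℝ) (u : ℂ → ℂ) (z : ℂ) : ℝ :=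
  A₁ (u z) * dx (rp u) z + A₂ (u z) * dx (ip u) z

/-- The `dy` component of the pull-back of the form `A₁ dx + A₂ dy` under `u`. -/
def pullY (A₁ A₂ : ℂ → ℝ) (u : ℂ → ℂ) (z : ℂ) : ℝ :=
  A₁ (u z) * dy (rp u) z + A₂ (u z) * dy (ip u) z

section pull

variable {A₁ A₂ : ℂ → ℝ} {u : ℂ → ℂ}

theorem smooth_comp_map {F : ℂ → ℝ} (hF : Smooth F) (hu : ContDiff ℝ (⊤ : ℕ∞) u) :
    ContDiff ℝ (⊤ : ℕ∞) fun z => F (u z) :=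
  ContDiff.comp hF hu

theorem smooth_pullX (h₁ : Smooth A₁) (h₂ : Smooth A₂) (hu : ContDiff ℝ (⊤ : ℕ∞) u) :
    Smooth (pullX A₁ A₂ u) := by
  have := smooth_comp_map h₁ hu
  have := smooth_comp_map h₂ hu
  unfold Smooth pullX
  fun_prop

theorem smooth_pullY (h₁ : Smooth A₁) (h₂ : Smooth A₂) (hu : ContDiff ℝ (⊤ : ℕ∞) u) :
    Smooth (pullY A₁ A₂ u) := by
  have := smooth_comp_map h₁ hu
  have := smooth_comp_map h₂ hu
  unfold Smooth pullY
  fun_prop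

theorem dx_pullY_sub_dy_pullX (h₁ : Smooth A₁) (h₂ : Smooth A₂) (hu : ContDiff ℝ (⊤ : ℕ∞) u)
    (z : ℂ) : dx (pullY A₁ A₂ u) z - dy (pullX A₁ A₂ u) z =
      (dx A₂ (u z) - dy A₁ (u z)) *
        (dx (rp u) z * dy (ip u) z - dy (rp u) z * dx (ip u) z) := by
  have c₁ := smooth_comp_map h₁ hu
  have c₂ := smooth_comp_map h₂ hu
  have sp := contDiff_rp hu
  have sq := contDiff_ip hu
  have e1 := dx_comp' h₁ hu z
  have e2 := dx_comp' h₂ hu z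
  have e3 := dy_comp' h₁ hu z
  have e4 := dy_comp' h₂ hu z
  unfold pullX pullY
  simp (disch := fun_prop) only [dx_add, dy_add, dx_mul, dy_mul]
  rw [e1, e2, e3, e4, dy_dx_comm sp, dy_dx_comm sq]
  ring

theorem dx_pullX_add_dy_pullY (h₁ : Smooth A₁) (h₂ : Smooth A₂) (hu : ContDiff ℝ (⊤ : ℕ∞) u)
    (z : ℂ) : dx (pullX A₁ A₂ u) z + dy (pullY A₁ A₂ u) z =
      dx A₁ (u z) * gsq (rp u) z + dy A₂ (u z) * gsq (ip u) z +
        (dy A₁ (u z) + dx A₂ (u z)) *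
          (dx (rp u) z * dx (ip u) z + dy (rp u) z * dy (ip u) z) +
        (A₁ (u z) * lap (rp u) z + A₂ (u z) * lap (ip u) z) := by
  have c₁ := smooth_comp_map h₁ hu
  have c₂ := smooth_comp_map h₂ hu
  have sp := contDiff_rp hu
  have sq := contDiff_ip hu
  have e1 := dx_comp' h₁ hu z
  have e2 := dx_comp' h₂ hu z
  have e3 := dy_comp' h₁ hu z
  have e4 := dy_comp' h₂ hu z
  unfold pullX pullY
  simp (disch := fun_prop) only [dx_add, dy_add, dx_mul, dy_mul]
  rw [e1, e2, e3, e4]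
  unfold gsq lap
  ring

theorem abs_jac_le (u : ℂ → ℂ) (z : ℂ) :
    |dx (rp u) z * dy (ip u) z - dy (rp u) z * dx (ip u) z| ≤ tsq u z := by
  unfold tsq gsq
  rw [abs_le]
  constructor <;>
    nlinarith [sq_nonneg (dx (rp u) z - dy (ip u) z), sq_nonneg (dx (rp u) z + dy (ip u) z),
    sq_nonneg (dy (rp u) z - dx (ip u) z), sq_nonneg (dy (rp u) z + dx (ip u) z)]

theorem abs_dot_le (u : ℂ → ℂ) (z : ℂ) :
    |dx (rp u) z * dx (ip u) z + dy (rp u) z * dy (ip u) z| ≤ tsq u z := by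
  unfold tsq gsq
  rw [abs_le]
  constructor <;>
    nlinarith [sq_nonneg (dx (rp u) z - dx (ip u) z), sq_nonneg (dx (rp u) z + dx (ip u) z),
    sq_nonneg (dy (rp u) z - dy (ip u) z), sq_nonneg (dy (rp u) z + dy (ip u) z)]

theorem pullX_sq_add_pullY_sq_le (A₁ A₂ : ℂ → ℝ) (u : ℂ → ℂ) (z : ℂ) :
    pullX A₁ A₂ u z ^ 2 + pullY A₁ A₂ u z ^ 2 ≤ (A₁ (u z) ^ 2 + A₂ (u z) ^ 2) * tsq u z := by
  unfold pullX pullY tsq gsq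
  nlinarith [sq_nonneg (A₁ (u z) * dx (ip u) z - A₂ (u z) * dx (rp u) z),
    sq_nonneg (A₁ (u z) * dy (ip u) z - A₂ (u z) * dy (rp u) z)]

end pull

namespace GLData

variable {Γ : Set ℂ} {τ : ℝ → ℂ} {W : ℂ → ℝ} {R₀ : ℝ} {Ω : Set ℂ} {γ : ℝ → ℂ} {L c : ℝ}
  {g : ℂ → ℂ}

theorem exists_integral_negligible (D : GLData Γ τ W R₀ Ω γ L c g) {F : ℂ → ℝ}
    (hF : Negligible W R₀ F) : ∃ C : ℝ, 0 ≤ C ∧ ∀ ε u,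
    GLSolution W Ω γ g ε u → ε ≤ 1 → ∫ z in Ω, |F (u z)| * tsq u z ≤ C := by
  obtain ⟨B, hB, hFB⟩ := hF.sq_le
  exact D.exists_negligible hF.continuous hB hFB

/-- The gradient of the component of a solution normal to `Γ` is bounded in `L²`. -/
theorem exists_normal_bound (D : GLData Γ τ W R₀ Ω γ L c g) {a b A₁ A₂ B₁ B₂ : ℂ → ℝ}
    (hA : AdaptedFields Γ W a b A₁ A₂ B₁ B₂) : ∃ C : ℝ, 0 ≤ C ∧ ∀ ε u,
    GLSolution W Ω γ g ε u → ε ≤ 1 →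
      ∫ z in Ω, (pullX (fun w => -b w) a u z ^ 2 + pullY (fun w => -b w) a u z ^ 2) ≤ C := by
  have h := D.dom
  have sW : Smooth W := D.pot.smooth
  have sa := hA.smooth_a
  have sb := hA.smooth_b
  obtain ⟨l, hl, B, hB, hlap⟩ := D.pot.exists_le_lap_add D.arc
  have n1 : Negligible W R₀ fun w => dx (dx W) w - lap W w * b w ^ 2 :=
    D.pot.negligible D.arc (by unfold Smooth; fun_prop) fun z hz => by simp [hA.dx_dx z hz]
  have n2 : Negligible W R₀ fun w => 2 * (dx (dy W) w + lap W w * (a w * b w)) :=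
    D.pot.negligible D.arc (by unfold Smooth; fun_prop) fun z hz => by simp [hA.dx_dy z hz]
  have n3 : Negligible W R₀ fun w => dy (dy W) w - lap W w * a w ^ 2 :=
    D.pot.negligible D.arc (by unfold Smooth; fun_prop) fun z hz => by simp [hA.dy_dy z hz]
  have n4 : Negligible W R₀ fun w => (B * (a w ^ 2 + b w ^ 2)) * W w :=
    (Negligible.self sW.continuous D.pot.nonneg).continuous_mul
      (by have := sa.continuous; have := sb.continuous; fun_prop)
  obtain ⟨N, hN⟩ : ∃ N : ℂ → ℝ, N = fun w => |dx (dx W) w - lap W w * b w ^ 2| +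
    |2 * (dx (dy W) w + lap W w * (a w * b w))| + |dy (dy W) w - lap W w * a w ^ 2| +
    |(B * (a w ^ 2 + b w ^ 2)) * W w| := ⟨_, rfl⟩
  have nN : Negligible W R₀ N := by
    rw [hN]; exact ((n1.abs.add n2.abs).add n3.abs).add n4.abs
  obtain ⟨C, hC, hCN⟩ := D.exists_integral_negligible nN
  refine ⟨C / l, by positivity, fun ε u hu hε => ?_⟩
  have su := hu.smooth
  have sx : Smooth (dx W) := sW.dx
  have sy : Smooth (dy W) := sW.dy
  have hX := smooth_pullX sx sy su
  have hY := smooth_pullY sx sy su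
  have hdiv := h.integral_divergence hX hY
  have hb0 : ∀ s, pullX (dx W) (dy W) u (γ s) = 0 ∧ pullY (dx W) (dy W) u (γ s) = 0 := fun s => by
    have h1 := D.pot.dx_eq_zero (D.bdry_W hu s)
    have h2 := D.pot.dy_eq_zero (D.bdry_W hu s)
    simp [pullX, pullY, h1, h2]
  simp only [hb0, zero_mul, sub_zero, intervalIntegral.integral_zero] at hdiv
  obtain ⟨n, hn⟩ : ∃ n : ℂ → ℝ,
    n = fun z => pullX (fun w => -b w) a u z ^ 2 + pullY (fun w => -b w) a u z ^ 2 := ⟨_, rfl⟩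
  have cn : Continuous n := by
    have := (smooth_pullX sb.neg sa su).continuous
    have := (smooth_pullY sb.neg sa su).continuous
    rw [hn]; fun_prop
  have cNt : Continuous fun z => |N (u z)| * tsq u z :=
    (nN.continuous.comp su.continuous).abs.mul (contDiff_tsq su).continuous
  have cdiv : Continuous fun z => dx (pullX (dx W) (dy W) u) z + dy (pullY (dx W) (dy W) u) z :=
    hX.dx.continuous.add hY.dy.continuous
  have key : ∫ z in Ω, l * n z ≤ ∫ z in Ω,
      ((dx (pullX (dx W) (dy W) u) z + dy (pullY (dx W) (dy W) u) z) + |N (u z)| * tsq u z) := by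
    refine h.setIntegral_mono (continuous_const.mul cn) (cdiv.add cNt) fun z hz => ?_
    have hz' := D.norm_le hu (subset_closure hz)
    have hl1 := hlap _ hz'
    rw [dx_pullX_add_dy_pullY sx sy su, hu.lap_rp z hz, hu.lap_ip z hz, dy_dx_comm sW]
    have hn0 : 0 ≤ n z := by rw [hn]; positivity
    have hnle : n z ≤ (a (u z) ^ 2 + b (u z) ^ 2) * tsq u z := by
      have := pullX_sq_add_pullY_sq_le (fun w => -b w) a u z
      rw [hn]
      simp only at this ⊢
      linarith
    have hneq : n z = b (u z) ^ 2 * gsq (rp u) z + a (u z) ^ 2 * gsq (ip u) z -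
        2 * (a (u z) * b (u z)) * (dx (rp u) z * dx (ip u) z + dy (rp u) z * dy (ip u) z) := by
      rw [hn]; unfold pullX pullY gsq; ring
    have hdot := abs_dot_le u z
    have hp0 := gsq_nonneg (rp u) z
    have hq0 := gsq_nonneg (ip u) z
    have ht : tsq u z = gsq (rp u) z + gsq (ip u) z := rfl
    have hsq : 0 ≤ (ε ^ 2)⁻¹ * (dx W (u z) ^ 2 + dy W (u z) ^ 2) := by positivity
    have hWn := D.pot.nonneg (u z)
    have e4 : B * W (u z) * n z ≤ (B * (a (u z) ^ 2 + b (u z) ^ 2)) * W (u z) * tsq u z := by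
      have := mul_le_mul_of_nonneg_left hnle (mul_nonneg hB hWn)
      linarith
    have e5 := mul_le_mul_of_nonneg_right hl1 hn0
    have eN : |N (u z)| = N (u z) := abs_of_nonneg (by rw [hN]; positivity)
    rw [eN, hN]
    simp only
    generalize dx (rp u) z * dx (ip u) z + dy (rp u) z * dy (ip u) z = dot at *
    have f1 : -(|dx (dx W) (u z) - lap W (u z) * b (u z) ^ 2| * gsq (rp u) z) ≤
        (dx (dx W) (u z) - lap W (u z) * b (u z) ^ 2) * gsq (rp u) z := by
      rw [← neg_mul]; exact mul_le_mul_of_nonneg_right (neg_abs_le _) hp0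
    have f3 : -(|dy (dy W) (u z) - lap W (u z) * a (u z) ^ 2| * gsq (ip u) z) ≤
        (dy (dy W) (u z) - lap W (u z) * a (u z) ^ 2) * gsq (ip u) z := by
      rw [← neg_mul]; exact mul_le_mul_of_nonneg_right (neg_abs_le _) hq0
    have f2 : -(|2 * (dx (dy W) (u z) + lap W (u z) * (a (u z) * b (u z)))| * tsq u z) ≤
        2 * (dx (dy W) (u z) + lap W (u z) * (a (u z) * b (u z))) * dot := by
      have := neg_abs_le (2 * (dx (dy W) (u z) + lap W (u z) * (a (u z) * b (u z))) * dot)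
      rw [abs_mul] at this
      have := mul_le_mul_of_nonneg_left hdot
        (abs_nonneg (2 * (dx (dy W) (u z) + lap W (u z) * (a (u z) * b (u z)))))
      linarith
    have f4 := mul_le_mul_of_nonneg_right
      (le_abs_self ((B * (a (u z) ^ 2 + b (u z) ^ 2)) * W (u z))) (tsq_nonneg u z)
    have f5 := mul_nonneg (abs_nonneg (dx (dx W) (u z) - lap W (u z) * b (u z) ^ 2)) hq0
    have f6 := mul_nonneg (abs_nonneg (dy (dy W) (u z) - lap W (u z) * a (u z) ^ 2)) hp0
    rw [add_mul _ _ (tsq u z), add_mul _ _ (tsq u z), add_mul _ _ (tsq u z)]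
    have f7 : |dx (dx W) (u z) - lap W (u z) * b (u z) ^ 2| * tsq u z =
      |dx (dx W) (u z) - lap W (u z) * b (u z) ^ 2| * gsq (rp u) z +
      |dx (dx W) (u z) - lap W (u z) * b (u z) ^ 2| * gsq (ip u) z := by rw [ht]; ring
    have f8 : |dy (dy W) (u z) - lap W (u z) * a (u z) ^ 2| * tsq u z =
      |dy (dy W) (u z) - lap W (u z) * a (u z) ^ 2| * gsq (rp u) z +
      |dy (dy W) (u z) - lap W (u z) * a (u z) ^ 2| * gsq (ip u) z := by rw [ht]; ring
    have f9 : lap W (u z) * n z = lap W (u z) * b (u z) ^ 2 * gsq (rp u) z +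
      lap W (u z) * a (u z) ^ 2 * gsq (ip u) z -
      2 * (lap W (u z) * (a (u z) * b (u z))) * dot := by rw [hneq]; ring
    linarith
  rw [h.integral_add cdiv cNt, hdiv, zero_add, integral_const_mul] at key
  rw [le_div_iff₀ hl, mul_comm]
  have := hCN ε u hu hε
  rw [hn] at key
  exact key.trans this

end GLData

namespace StarDomain

variable {Ω : Set ℂ} {γ : ℝ → ℂ} {L c : ℝ}

theorem shell_integral_mono (h : StarDomain Ω γ L c) {a : ℝ} (ha : 0 ≤ a) {f g : ℂ → ℝ}
    (hf : Continuous f) (hg : Continuous g) (hfg : ∀ z ∈ Ω, f z ≤ g z) :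
    ∫ z in shell γ L a, f z ≤ ∫ z in shell γ L a, g z := by
  have hs := h.shell_subset ha
  refine setIntegral_mono_ae_restrict ((h.integrableOn hf).mono_set hs)
    ((h.integrableOn hg).mono_set hs) ?_
  exact ae_restrict_of_ae_restrict_of_subset hs
    ((ae_restrict_iff' h.isOpen.measurableSet).2 (Filter.Eventually.of_forall hfg))

theorem setIntegral_eq_shell (h : StarDomain Ω γ L c) {a : ℝ} (ha : 0 ≤ a) {f : ℂ → ℝ}
    (hf : ∀ z ∈ Ω, z ∉ shell γ L a → f z = 0) : ∫ z in Ω, f z = ∫ z in shell γ L a, f z :=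
  setIntegral_eq_of_subset_of_forall_sdiff_eq_zero h.isOpen.measurableSet (h.shell_subset ha)
    fun z hz => hf z hz.1 hz.2

/-- The area of a boundary layer of width `δ` is `O(δ)`. -/
theorem exists_shell_area_le (h : StarDomain Ω γ L c) : ∃ B : ℝ, 0 ≤ B ∧ ∀ δ : ℝ, 0 < δ →
    δ ≤ 1 / 2 → ∫ _ in shell γ L (1 - δ), (1 : ℝ) ≤ B * δ := by
  obtain ⟨B, hB, hlayer⟩ := h.exists_layer_bound
  have hL := h.Lpos
  refine ⟨B * L, by positivity, fun δ hδ hδ2 => ?_⟩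
  have := hlayer δ hδ hδ2 (fun _ => 1) contDiff_const
  simp only [dx_const, dy_const, one_pow, intervalIntegral.integral_const] at this
  simp only [smul_eq_mul] at this
  refine this.trans (le_of_eq ?_)
  simp; ring

end StarDomain

namespace GLData

variable {Γ : Set ℂ} {τ : ℝ → ℂ} {W : ℂ → ℝ} {R₀ : ℝ} {Ω : Set ℂ} {γ : ℝ → ℂ} {L c : ℝ}
  {g : ℂ → ℂ}

/-- `L¹` and `L²` bounds for functions controlled by a boundary layer term, a negligible multiple
of `|∇u|²` and the potential energy density. -/
theorem exists_source_bound (D : GLData Γ τ W R₀ Ω γ L c g) {N : ℂ → ℝ} (hN : Negligible W R₀ N)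
    {M : ℝ} (hM : 0 ≤ M) : ∃ K : ℝ, 0 ≤ K ∧ ∀ ε u, GLSolution W Ω γ g ε u → ε ≤ 1 →
      ∀ h f : ℂ → ℝ, Smooth h → Smooth f → (∀ z ∉ Ω, h z = 0) →
      (∀ z ∈ Ω, z ∉ StarDomain.shell γ L (1 - ε ^ 2 / 2) → f z = 0) →
      (∀ z ∈ Ω, f z ^ 2 ≤ M * (ε ^ 2)⁻¹ ^ 2 * tsq u z) →
      (∀ z ∈ Ω, |h z| ≤ |f z| + |N (u z)| * tsq u z + M * (ε ^ 2)⁻¹ * W (u z)) →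
      ∫ z, |h z| ≤ K ∧ ∫ z, h z ^ 2 ≤ K * (ε ^ 2)⁻¹ := by
  have hd := D.dom
  obtain ⟨C₁, hC₁, hneg⟩ := D.exists_integral_negligible hN
  obtain ⟨C₂, hC₂, hest⟩ := D.exists_estimates
  obtain ⟨C₃, hC₃, harea⟩ := hd.exists_shell_area_le
  obtain ⟨N₀, hN₀, hNb⟩ := exists_abs_le_closedBall hN.continuous R₀
  obtain ⟨W₀, hW₀, hWb⟩ := exists_abs_le_closedBall D.pot.smooth.continuous R₀
  refine ⟨(C₃ + M * C₂ + C₁ + M * C₂) + (3 * (M * C₂) + 6 * (N₀ ^ 2 * C₂) + 3 * (M ^ 2 * W₀ * C₂)),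
    by positivity, fun ε u hu hε1 h f sh sf hΩ hf hf2 hh => ?_⟩
  have hε := hu.pos
  have su := hu.smooth
  obtain ⟨e1, e2, e3, -⟩ := hest ε u hu
  have e3 := e3 hε1
  have e4 := hneg ε u hu hε1
  have hε2 : ε ^ 2 ≤ 1 := pow_le_one₀ hε.le hε1
  have ha : 0 ≤ 1 - ε ^ 2 / 2 := by linarith
  have e5 := harea (ε ^ 2 / 2) (by positivity) (by linarith)
  have hi : 1 ≤ (ε ^ 2)⁻¹ := (one_le_inv₀ (by positivity)).2 hε2
  have hie : (ε ^ 2)⁻¹ * ε ^ 2 = 1 := inv_mul_cancel₀ (by positivity)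
  have ct : Continuous (tsq u) := (contDiff_tsq su).continuous
  have cW : Continuous fun z => W (u z) := D.pot.smooth.continuous.comp su.continuous
  have cN : Continuous fun z => N (u z) := hN.continuous.comp su.continuous
  have cf := sf.continuous
  have ch := sh.continuous
  have cNt : Continuous fun z => |N (u z)| * tsq u z := cN.abs.mul ct
  have cWM : Continuous fun z => M * (ε ^ 2)⁻¹ * W (u z) := continuous_const.mul cW
  have iS : ∀ g : ℂ → ℝ, Continuous g → IntegrableOn g (StarDomain.shell γ L (1 - ε ^ 2 / 2)) :=
    fun g hg => (hd.integrableOn hg).mono_set (hd.shell_subset ha)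
  set i := (ε ^ 2)⁻¹
  have hi0 : 0 ≤ i := by linarith
  set S := StarDomain.shell γ L (1 - ε ^ 2 / 2)
  have hf1 : ∫ z in Ω, |f z| ≤ C₃ + M * C₂ := by
    rw [hd.setIntegral_eq_shell ha fun z hz hzS => by rw [hf z hz hzS, abs_zero]]
    have c1 : Continuous fun _ : ℂ => i / 2 * (1 : ℝ) := continuous_const
    have c2 : Continuous fun z => M * i / 2 * tsq u z := continuous_const.mul ct
    calc ∫ z in S, |f z| ≤ ∫ z in S, (i / 2 * 1 + M * i / 2 * tsq u z) := by
          refine hd.shell_integral_mono ha cf.abs (c1.add c2) fun z hz => ?_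
          have h1 := hf2 z hz
          have h2 := two_mul_le_add_sq 1 (ε ^ 2 * |f z|)
          have h3 : (ε ^ 2 * |f z|) ^ 2 ≤ M * tsq u z := by
            rw [mul_pow, sq_abs]
            calc (ε ^ 2) ^ 2 * f z ^ 2 ≤ (ε ^ 2) ^ 2 * (M * i ^ 2 * tsq u z) := by gcongr
              _ = (i * ε ^ 2) ^ 2 * (M * tsq u z) := by ring
              _ = _ := by rw [hie]; ring
          have h4 : i * (2 * (ε ^ 2 * |f z|)) ≤ i * (1 + M * tsq u z) :=
            mul_le_mul_of_nonneg_left (by linarith) hi0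
          have h5 : i * (2 * (ε ^ 2 * |f z|)) = 2 * |f z| := by
            rw [show i * (2 * (ε ^ 2 * |f z|)) = (i * ε ^ 2) * (2 * |f z|) by ring, hie, one_mul]
          linarith
      _ = i / 2 * (∫ _ in S, (1 : ℝ)) + M * i / 2 * ∫ z in S, tsq u z := by
          rw [← integral_const_mul, ← integral_const_mul]
          exact MeasureTheory.integral_add (iS _ c1) (iS _ c2)
      _ ≤ i / 2 * (C₃ * (ε ^ 2 / 2)) + M * i / 2 * (C₂ * ε ^ 2) := by gcongr
      _ = (i * ε ^ 2) * (C₃ / 4 + M * C₂ / 2) := by ring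
      _ ≤ _ := by rw [hie]; linarith [mul_nonneg hM hC₂]
  have hf2' : ∫ z in Ω, f z ^ 2 ≤ M * C₂ * i := by
    rw [hd.setIntegral_eq_shell ha fun z hz hzS => by rw [hf z hz hzS]; ring]
    calc ∫ z in S, f z ^ 2 ≤ ∫ z in S, M * i ^ 2 * tsq u z :=
          hd.shell_integral_mono ha (cf.pow 2) (continuous_const.mul ct) hf2
      _ ≤ M * i ^ 2 * (C₂ * ε ^ 2) := by
          rw [integral_const_mul]; gcongr
      _ = M * C₂ * i * (i * ε ^ 2) := by ring
      _ = _ := by rw [hie, mul_one]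
  have hKi : (0 : ℝ) ≤ C₃ + M * C₂ + C₁ + M * C₂ := by positivity
  have hKi' : (0 : ℝ) ≤ 3 * (M * C₂) + 6 * (N₀ ^ 2 * C₂) + 3 * (M ^ 2 * W₀ * C₂) := by positivity
  constructor
  · have e6 : ∫ z, |h z| = ∫ z in Ω, |h z| :=
      (setIntegral_eq_integral_of_forall_compl_eq_zero fun z hz => by rw [hΩ z hz, abs_zero]).symm
    rw [e6]
    have c1 : Continuous fun z => |f z| + |N (u z)| * tsq u z := cf.abs.add cNt
    calc ∫ z in Ω, |h z| ≤ ∫ z in Ω, (|f z| + |N (u z)| * tsq u z + M * i * W (u z)) :=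
          hd.setIntegral_mono ch.abs (c1.add cWM) hh
      _ = (∫ z in Ω, |f z|) + (∫ z in Ω, |N (u z)| * tsq u z) + M * i * ∫ z in Ω, W (u z) := by
          rw [hd.integral_add c1 cWM, hd.integral_add cf.abs cNt,
            integral_const_mul]
      _ ≤ C₃ + M * C₂ + C₁ + M * i * (C₂ * ε ^ 2) := by gcongr
      _ = C₃ + M * C₂ + C₁ + M * C₂ * (i * ε ^ 2) := by ring
      _ ≤ _ := by rw [hie, mul_one]; linarith
  · have e6 : ∫ z, h z ^ 2 = ∫ z in Ω, h z ^ 2 :=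
      (setIntegral_eq_integral_of_forall_compl_eq_zero fun z hz => by rw [hΩ z hz]; ring).symm
    rw [e6]
    have c1 : Continuous fun z => 3 * f z ^ 2 := continuous_const.mul (cf.pow 2)
    have c2 : Continuous fun z => 3 * N₀ ^ 2 * tsq u z ^ 2 := continuous_const.mul (ct.pow 2)
    have c3 : Continuous fun z => 3 * (M * i) ^ 2 * W₀ * W (u z) := continuous_const.mul cW
    have c12 : Continuous fun z => 3 * f z ^ 2 + 3 * N₀ ^ 2 * tsq u z ^ 2 := c1.add c2
    calc ∫ z in Ω, h z ^ 2 ≤ ∫ z in Ω, (3 * f z ^ 2 + 3 * N₀ ^ 2 * tsq u z ^ 2 +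
          3 * (M * i) ^ 2 * W₀ * W (u z)) := by
          refine hd.setIntegral_mono (ch.pow 2) (c12.add c3) fun z hz => ?_
          have hz' := D.norm_le hu (subset_closure hz)
          have h1 := pow_le_pow_left₀ (abs_nonneg _) (hh z hz) 2
          rw [sq_abs] at h1
          have h2 : ∀ x y w : ℝ, (x + y + w) ^ 2 ≤ 3 * x ^ 2 + 3 * y ^ 2 + 3 * w ^ 2 := by
            intro x y w
            nlinarith [sq_nonneg (x - y), sq_nonneg (x - w), sq_nonneg (y - w)]
          have h3 := h2 |f z| (|N (u z)| * tsq u z) (M * i * W (u z))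
          have h4 : (|N (u z)| * tsq u z) ^ 2 ≤ N₀ ^ 2 * tsq u z ^ 2 := by
            rw [mul_pow]
            exact mul_le_mul_of_nonneg_right (pow_le_pow_left₀ (abs_nonneg _) (hNb _ hz') 2)
              (sq_nonneg _)
          have h5 : (M * i * W (u z)) ^ 2 ≤ (M * i) ^ 2 * (W₀ * W (u z)) := by
            rw [mul_pow, pow_two (W (u z))]
            have := (le_abs_self _).trans (hWb _ hz')
            have := D.pot.nonneg (u z)
            gcongr
          rw [sq_abs] at h3
          linarith
      _ = 3 * (∫ z in Ω, f z ^ 2) + 3 * N₀ ^ 2 * (∫ z in Ω, tsq u z ^ 2) +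
          3 * (M * i) ^ 2 * W₀ * ∫ z in Ω, W (u z) := by
          rw [hd.integral_add c12 c3, hd.integral_add c1 c2, integral_const_mul,
            integral_const_mul, integral_const_mul]
      _ ≤ 3 * (M * C₂ * i) + 3 * N₀ ^ 2 * (C₂ * (1 + i)) + 3 * (M * i) ^ 2 * W₀ * (C₂ * ε ^ 2) := by
          gcongr
      _ = 3 * (M * C₂ * i) + 3 * N₀ ^ 2 * C₂ * (1 + i) +
          3 * (M ^ 2 * W₀ * C₂) * i * (i * ε ^ 2) := by ring
      _ ≤ 3 * (M * C₂ * i) + 3 * N₀ ^ 2 * C₂ * (i + i) +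
          3 * (M ^ 2 * W₀ * C₂) * i * (i * ε ^ 2) := by gcongr
      _ = (3 * (M * C₂) + 6 * (N₀ ^ 2 * C₂) + 3 * (M ^ 2 * W₀ * C₂)) * i := by rw [hie]; ring
      _ ≤ _ := mul_le_mul_of_nonneg_right (by linarith) hi0

end GLData

namespace GLData

variable {Γ : Set ℂ} {τ : ℝ → ℂ} {W : ℂ → ℝ} {R₀ : ℝ} {Ω : Set ℂ} {γ : ℝ → ℂ} {L c : ℝ}
  {g : ℂ → ℂ}

/-- The `L²` norm of the gradient of the component of a solution tangent to `Γ`, after cutting off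
near the boundary, grows at most logarithmically. -/
theorem exists_tangential_bound (D : GLData Γ τ W R₀ Ω γ L c g) {a b A₁ A₂ B₁ B₂ : ℂ → ℝ}
    (hA : AdaptedFields Γ W a b A₁ A₂ B₁ B₂) : ∃ C : ℝ, 0 ≤ C ∧ ∀ ε u,
    GLSolution W Ω γ g ε u → ε ≤ 1 → ∃ η : ℂ → ℝ, Smooth η ∧ (∀ z, 0 ≤ η z) ∧ (∀ z, η z ≤ 1) ∧
      (∀ z ∈ Ω, z ∉ StarDomain.shell γ L (1 - ε ^ 2 / 2) → η z = 1) ∧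
      ∫ z in Ω, ((η z * pullX A₁ A₂ u z) ^ 2 + (η z * pullY A₁ A₂ u z) ^ 2) ≤
        C * (|Real.log ε| + 1) := by
  have hd := D.dom
  have sW : Smooth W := D.pot.smooth
  have sA₁ := hA.smooth_A₁
  have sA₂ := hA.smooth_A₂
  have sB₁ := hA.smooth_B₁
  have sB₂ := hA.smooth_B₂
  obtain ⟨R, hR⟩ := hd.bounded.subset_closedBall 0
  obtain ⟨Bη, hBη, hcut⟩ := hd.exists_cutoff
  obtain ⟨P, hP, hPA⟩ := exists_abs_le_closedBall
    (F := fun w => (A₁ w ^ 2 + A₂ w ^ 2) + (B₁ w ^ 2 + B₂ w ^ 2))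
    (by have := sA₁.continuous; have := sA₂.continuous
        have := sB₁.continuous; have := sB₂.continuous; fun_prop) R₀
  obtain ⟨BW, hBW, hBWle⟩ := D.pot.exists_abs_le D.arc
    (F := fun w => B₁ w * dx W w + B₂ w * dy W w) (by unfold Smooth; fun_prop)
    (fun z hz => by simp [D.pot.dx_eq_zero hz, D.pot.dy_eq_zero hz])
    (fun z hz => by
      simp (disch := fun_prop) only [dx_add, dx_mul]
      rw [D.pot.dx_eq_zero hz, D.pot.dy_eq_zero hz, hA.dx_dx z hz, hA.dx_dy z hz, hA.B₁_eq z hz,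
        hA.B₂_eq z hz]
      ring)
    (fun z hz => by
      simp (disch := fun_prop) only [dy_add, dy_mul]
      rw [D.pot.dx_eq_zero hz, D.pot.dy_eq_zero hz, dy_dx_comm sW, hA.dy_dy z hz, hA.dx_dy z hz,
        hA.B₁_eq z hz, hA.B₂_eq z hz]
      ring)
  have nc : Negligible W R₀ fun w => dx A₂ w - dy A₁ w :=
    D.pot.negligible D.arc (by unfold Smooth; fun_prop) hA.curl_A
  have nd₁ : Negligible W R₀ fun w => dx B₁ w :=
    D.pot.negligible D.arc sB₁.dx hA.dx_B₁
  have nd₂ : Negligible W R₀ fun w => dy B₂ w :=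
    D.pot.negligible D.arc sB₂.dy hA.dy_B₂
  have nd₃ : Negligible W R₀ fun w => dy B₁ w + dx B₂ w :=
    D.pot.negligible D.arc (by unfold Smooth; fun_prop) hA.dxy_B
  have nd := (nd₁.abs.add nd₂.abs).add nd₃.abs
  have nAB : Negligible W R₀ fun w => (A₁ w - B₁ w) ^ 2 + (A₂ w - B₂ w) ^ 2 :=
    D.pot.negligible D.arc (by unfold Smooth; fun_prop) fun z hz => by
      simp [hA.A₁_eq z hz, hA.A₂_eq z hz, hA.B₁_eq z hz, hA.B₂_eq z hz]
  have hM : 0 ≤ 8 * Bη ^ 2 * P + BW := by positivity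
  obtain ⟨K₁, hK₁, hcurl⟩ := D.exists_source_bound nc hM
  obtain ⟨K₂, hK₂, hdiv⟩ := D.exists_source_bound nd hM
  obtain ⟨K₃, hK₃, hAB⟩ := D.exists_integral_negligible nAB
  have hK : 0 ≤ K₁ + K₂ + K₃ := by positivity
  obtain ⟨C, hC⟩ := energy_le_log_of_curl_div hK (abs_nonneg R)
  refine ⟨|C|, abs_nonneg C, fun ε u hu hε1 => ?_⟩
  have hε := hu.pos
  have su := hu.smooth
  have hε2 : ε ^ 2 ≤ 1 := pow_le_one₀ hε.le hε1
  obtain ⟨η, sη, hη0, hη1, hηx, hηy, hηout, hηin⟩ := hcut (ε ^ 2 / 2) (by positivity) (by linarith)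
  refine ⟨η, sη, hη0, hη1, fun z hz hzS => (hηin z hz hzS).1, ?_⟩
  have hi0 : 0 ≤ (ε ^ 2)⁻¹ := by positivity
  have hBδ : Bη / (ε ^ 2 / 2) = 2 * Bη * (ε ^ 2)⁻¹ := by field_simp
  rw [hBδ] at hηx hηy
  have hηsq : ∀ z, dx η z ^ 2 + dy η z ^ 2 ≤ 8 * Bη ^ 2 * (ε ^ 2)⁻¹ ^ 2 := fun z => by
    have h1 := pow_le_pow_left₀ (abs_nonneg _) (hηx z) 2
    have h2 := pow_le_pow_left₀ (abs_nonneg _) (hηy z) 2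
    rw [sq_abs] at h1 h2
    linarith
  have sXA := smooth_pullX sA₁ sA₂ su
  have sYA := smooth_pullY sA₁ sA₂ su
  have sXB := smooth_pullX sB₁ sB₂ su
  have sYB := smooth_pullY sB₁ sB₂ su
  have layer : ∀ E₁ E₂ : ℂ → ℝ, ∀ z, E₁ (u z) ^ 2 + E₂ (u z) ^ 2 ≤ P → ∀ X,
      X ^ 2 ≤ (dx η z ^ 2 + dy η z ^ 2) * (pullX E₁ E₂ u z ^ 2 + pullY E₁ E₂ u z ^ 2) →
      X ^ 2 ≤ (8 * Bη ^ 2 * P + BW) * (ε ^ 2)⁻¹ ^ 2 * tsq u z := by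
    intro E₁ E₂ z hE X hX
    have ht := tsq_nonneg u z
    have h1 : pullX E₁ E₂ u z ^ 2 + pullY E₁ E₂ u z ^ 2 ≤ P * tsq u z :=
      (pullX_sq_add_pullY_sq_le E₁ E₂ u z).trans (mul_le_mul_of_nonneg_right hE ht)
    calc X ^ 2 ≤ _ := hX
      _ ≤ (8 * Bη ^ 2 * (ε ^ 2)⁻¹ ^ 2) * (P * tsq u z) :=
          mul_le_mul (hηsq z) h1 (by positivity) (by positivity)
      _ ≤ (8 * Bη ^ 2 * (ε ^ 2)⁻¹ ^ 2) * (P * tsq u z) + BW * (ε ^ 2)⁻¹ ^ 2 * tsq u z := by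
          have : 0 ≤ BW * (ε ^ 2)⁻¹ ^ 2 * tsq u z := by positivity
          linarith
      _ = _ := by ring
  obtain ⟨c1, c2⟩ := hcurl ε u hu hε1
    (fun z => dx (fun w => η w * pullY A₁ A₂ u w) z - dy (fun w => η w * pullX A₁ A₂ u w) z)
    (fun z => dx η z * pullY A₁ A₂ u z - dy η z * pullX A₁ A₂ u z)
    (by unfold Smooth; fun_prop) (by unfold Smooth; fun_prop)
    (fun z hz => by
      obtain ⟨e1, e2, e3⟩ := hηout z hz
      simp (disch := fun_prop) only [dx_mul, dy_mul]
      rw [e1, e2, e3]; ring)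
    (fun z hz hzS => by
      obtain ⟨-, e2, e3⟩ := hηin z hz hzS
      rw [e2, e3]; ring)
    (fun z hz => by
      have hz' := D.norm_le hu (subset_closure hz)
      have h1 := (le_abs_self _).trans (hPA _ hz')
      refine layer A₁ A₂ z (by linarith [sq_nonneg (B₁ (u z)), sq_nonneg (B₂ (u z))]) _ ?_
      linarith [sq_nonneg (dx η z * pullX A₁ A₂ u z + dy η z * pullY A₁ A₂ u z)])
    (fun z hz => by
      have e : dx (fun w => η w * pullY A₁ A₂ u w) z - dy (fun w => η w * pullX A₁ A₂ u w) z =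
          (dx η z * pullY A₁ A₂ u z - dy η z * pullX A₁ A₂ u z) +
            η z * (dx (pullY A₁ A₂ u) z - dy (pullX A₁ A₂ u) z) := by
        simp (disch := fun_prop) only [dx_mul, dy_mul]; ring
      rw [e, dx_pullY_sub_dy_pullX sA₁ sA₂ su]
      refine (abs_add_le _ _).trans ?_
      have h0 : 0 ≤ (8 * Bη ^ 2 * P + BW) * (ε ^ 2)⁻¹ * W (u z) :=
        mul_nonneg (mul_nonneg hM hi0) (D.pot.nonneg _)
      have h1 : |η z * ((dx A₂ (u z) - dy A₁ (u z)) *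
          (dx (rp u) z * dy (ip u) z - dy (rp u) z * dx (ip u) z))| ≤
          |dx A₂ (u z) - dy A₁ (u z)| * tsq u z := by
        rw [abs_mul, abs_mul, abs_of_nonneg (hη0 z)]
        refine (mul_le_of_le_one_left (by positivity) (hη1 z)).trans ?_
        exact mul_le_mul_of_nonneg_left (abs_jac_le u z) (abs_nonneg _)
      linarith)
  obtain ⟨d1, d2⟩ := hdiv ε u hu hε1
    (fun z => dx (fun w => η w * pullX B₁ B₂ u w) z + dy (fun w => η w * pullY B₁ B₂ u w) z)
    (fun z => dx η z * pullX B₁ B₂ u z + dy η z * pullY B₁ B₂ u z)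
    (by unfold Smooth; fun_prop) (by unfold Smooth; fun_prop)
    (fun z hz => by
      obtain ⟨e1, e2, e3⟩ := hηout z hz
      simp (disch := fun_prop) only [dx_mul, dy_mul]
      rw [e1, e2, e3]; ring)
    (fun z hz hzS => by
      obtain ⟨-, e2, e3⟩ := hηin z hz hzS
      rw [e2, e3]; ring)
    (fun z hz => by
      have hz' := D.norm_le hu (subset_closure hz)
      have h1 := (le_abs_self _).trans (hPA _ hz')
      refine layer B₁ B₂ z (by linarith [sq_nonneg (A₁ (u z)), sq_nonneg (A₂ (u z))]) _ ?_
      linarith [sq_nonneg (dx η z * pullY B₁ B₂ u z - dy η z * pullX B₁ B₂ u z)])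
    (fun z hz => by
      have hz' := D.norm_le hu (subset_closure hz)
      have e : dx (fun w => η w * pullX B₁ B₂ u w) z + dy (fun w => η w * pullY B₁ B₂ u w) z =
          (dx η z * pullX B₁ B₂ u z + dy η z * pullY B₁ B₂ u z) +
            η z * (dx (pullX B₁ B₂ u) z + dy (pullY B₁ B₂ u) z) := by
        simp (disch := fun_prop) only [dx_mul, dy_mul]; ring
      rw [e, dx_pullX_add_dy_pullY sB₁ sB₂ su, hu.lap_rp z hz, hu.lap_ip z hz]
      refine (abs_add_le _ _).trans ?_
      rw [add_assoc |_|]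
      refine add_le_add le_rfl ?_
      rw [abs_mul, abs_of_nonneg (hη0 z)]
      refine (mul_le_of_le_one_left (abs_nonneg _) (hη1 z)).trans ((abs_add_le _ _).trans ?_)
      have hp0 := gsq_nonneg (rp u) z
      have hq0 := gsq_nonneg (ip u) z
      have ht : tsq u z = gsq (rp u) z + gsq (ip u) z := rfl
      refine add_le_add ?_ ?_
      · have eN : |(|dx B₁ (u z)| + |dy B₂ (u z)| + |dy B₁ (u z) + dx B₂ (u z)|)| =
            |dx B₁ (u z)| + |dy B₂ (u z)| + |dy B₁ (u z) + dx B₂ (u z)| :=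
          abs_of_nonneg (by positivity)
        rw [eN, add_mul _ _ (tsq u z), add_mul _ _ (tsq u z)]
        refine (abs_add_le _ _).trans (add_le_add ((abs_add_le _ _).trans (add_le_add ?_ ?_)) ?_)
        · rw [abs_mul, abs_of_nonneg hp0]
          exact mul_le_mul_of_nonneg_left (by linarith) (abs_nonneg _)
        · rw [abs_mul, abs_of_nonneg hq0]
          exact mul_le_mul_of_nonneg_left (by linarith) (abs_nonneg _)
        · rw [abs_mul]
          exact mul_le_mul_of_nonneg_left (abs_dot_le u z) (abs_nonneg _)
      · have e' : B₁ (u z) * ((ε ^ 2)⁻¹ * dx W (u z)) + B₂ (u z) * ((ε ^ 2)⁻¹ * dy W (u z)) =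
          (ε ^ 2)⁻¹ * (B₁ (u z) * dx W (u z) + B₂ (u z) * dy W (u z)) := by ring
        rw [e', abs_mul, abs_of_nonneg hi0]
        have h1 := mul_le_mul_of_nonneg_left (hBWle _ hz') hi0
        have h2 : 0 ≤ 8 * Bη ^ 2 * P * (ε ^ 2)⁻¹ * W (u z) :=
          mul_nonneg (by positivity) (D.pot.nonneg _)
        linarith)
  have houtside : ∀ z, |R| < ‖z‖ → η z = 0 := fun z hz => by
    refine (hηout z fun hzΩ => ?_).1
    have h1 : ‖z‖ ≤ R := by simpa using hR hzΩ
    linarith [le_abs_self R]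
  have hAB' := hAB ε u hu hε1
  have sF₁ : Smooth fun w => η w * pullX A₁ A₂ u w := sη.mul sXA
  have sF₂ : Smooth fun w => η w * pullY A₁ A₂ u w := sη.mul sYA
  have sG₁ : Smooth fun w => η w * pullX B₁ B₂ u w := sη.mul sXB
  have sG₂ : Smooth fun w => η w * pullY B₁ B₂ u w := sη.mul sYB
  have cAB : Continuous fun z =>
      |(A₁ (u z) - B₁ (u z)) ^ 2 + (A₂ (u z) - B₂ (u z)) ^ 2| * tsq u z :=
    (nAB.continuous.comp su.continuous).abs.mul (contDiff_tsq su).continuous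
  have hdiff : ∀ z, (pullX A₁ A₂ u z - pullX B₁ B₂ u z) ^ 2 +
      (pullY A₁ A₂ u z - pullY B₁ B₂ u z) ^ 2 ≤
      |(A₁ (u z) - B₁ (u z)) ^ 2 + (A₂ (u z) - B₂ (u z)) ^ 2| * tsq u z := fun z => by
    rw [abs_of_nonneg (by positivity)]
    refine le_trans (le_of_eq ?_)
      (pullX_sq_add_pullY_sq_le (fun w => A₁ w - B₁ w) (fun w => A₂ w - B₂ w) u z)
    unfold pullX pullY
    ring
  have hcomp : ∀ X Y : ℂ → ℝ, Smooth X → Smooth Y → (∀ z, (X z - Y z) ^ 2 ≤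
      |(A₁ (u z) - B₁ (u z)) ^ 2 + (A₂ (u z) - B₂ (u z)) ^ 2| * tsq u z) →
      ∫ z, (η z * X z - η z * Y z) ^ 2 ≤ K₁ + K₂ + K₃ := fun X Y hX hY hXY => by
    rw [← setIntegral_eq_integral_of_forall_compl_eq_zero (s := Ω)
      fun z hz => by rw [(hηout z hz).1]; ring]
    have cXY : Continuous fun z => (η z * X z - η z * Y z) ^ 2 :=
      (((sη.mul hX).sub (sη.mul hY)).pow 2).continuous
    refine (hd.setIntegral_mono cXY cAB fun z _ => ?_).trans (by linarith)
    refine le_trans ?_ (hXY z)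
    rw [← mul_sub, mul_pow]
    exact mul_le_of_le_one_left (sq_nonneg _) (pow_le_one₀ (hη0 z) (hη1 z))
  have hfin := hC ε⁻¹ _ _ _ _ ((one_le_inv₀ hε).2 hε1) sF₁ sF₂ sG₁ sG₂
    (fun z hz => by simp [houtside z hz]) (fun z hz => by simp [houtside z hz])
    (fun z hz => by simp [houtside z hz]) (fun z hz => by simp [houtside z hz])
    (by linarith) (by linarith)
    (by rw [inv_pow]; exact c2.trans (mul_le_mul_of_nonneg_right (by linarith) hi0))
    (by rw [inv_pow]; exact d2.trans (mul_le_mul_of_nonneg_right (by linarith) hi0))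
    (hcomp _ _ sXA sXB fun z => by
      linarith [hdiff z, sq_nonneg (pullY A₁ A₂ u z - pullY B₁ B₂ u z)])
    (hcomp _ _ sYA sYB fun z => by
      linarith [hdiff z, sq_nonneg (pullX A₁ A₂ u z - pullX B₁ B₂ u z)])
  rw [← setIntegral_eq_integral_of_forall_compl_eq_zero (s := Ω)
    fun z hz => by rw [(hηout z hz).1]; ring] at hfin
  refine hfin.trans ?_
  rw [Real.log_inv]
  have h1 : 0 ≤ -Real.log ε := by linarith [Real.log_nonpos hε.le hε1]
  exact mul_le_mul (le_abs_self C) (by linarith [neg_le_abs (Real.log ε)]) (by linarith)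
    (abs_nonneg C)

/-- The Dirichlet energy of solutions grows at most logarithmically. -/
theorem exists_dirichlet_bound (D : GLData Γ τ W R₀ Ω γ L c g) : ∃ C : ℝ, 0 ≤ C ∧ ∀ ε u,
    GLSolution W Ω γ g ε u → ∫ z in Ω, tsq u z ≤ C * (|Real.log ε| + 1) := by
  have hd := D.dom
  obtain ⟨a, b, A₁, A₂, B₁, B₂, hA⟩ := exists_adaptedFields D.arc D.pot
  have sa := hA.smooth_a
  have sb := hA.smooth_b
  have sA₁ := hA.smooth_A₁
  have sA₂ := hA.smooth_A₂
  obtain ⟨C₁, hC₁, hest⟩ := D.exists_estimates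
  obtain ⟨C₂, hC₂, hnor⟩ := D.exists_normal_bound hA
  obtain ⟨C₃, hC₃, htan⟩ := D.exists_tangential_bound hA
  have n1 : Negligible W R₀ fun w => 1 - a w ^ 2 - b w ^ 2 :=
    D.pot.negligible D.arc (by unfold Smooth; fun_prop) fun z hz => by linarith [hA.unit z hz]
  have n2 : Negligible W R₀ fun w => 2 * ((a w - A₁ w) ^ 2 + (b w - A₂ w) ^ 2) :=
    D.pot.negligible D.arc (by unfold Smooth; fun_prop) fun z hz => by
      simp [hA.A₁_eq z hz, hA.A₂_eq z hz]
  have nN := n1.abs.add n2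
  obtain ⟨C₄, hC₄, hneg⟩ := D.exists_integral_negligible nN
  refine ⟨C₁ + 2 * C₃ + C₂ + C₄, by positivity, fun ε u hu => ?_⟩
  have hε := hu.pos
  have su := hu.smooth
  have hlog := abs_nonneg (Real.log ε)
  obtain ⟨-, -, e3, e4⟩ := hest ε u hu
  rcases le_total 1 ε with hε1 | hε1
  · calc _ ≤ C₁ := e4 hε1
      _ ≤ (C₁ + 2 * C₃ + C₂ + C₄) * 1 := by linarith
      _ ≤ _ := by gcongr; linarith
  have hε2 : ε ^ 2 ≤ 1 := pow_le_one₀ hε.le hε1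
  have ha : 0 ≤ 1 - ε ^ 2 / 2 := by linarith
  obtain ⟨η, sη, hη0, hη1, hηin, htan⟩ := htan ε u hu hε1
  have hnor := hnor ε u hu hε1
  have hneg := hneg ε u hu hε1
  have e3 := e3 hε1
  have ct : Continuous (tsq u) := (contDiff_tsq su).continuous
  have cη := sη.continuous
  have cX := (smooth_pullX sA₁ sA₂ su).continuous
  have cY := (smooth_pullY sA₁ sA₂ su).continuous
  have cX' := (smooth_pullX sb.neg sa su).continuous
  have cY' := (smooth_pullY sb.neg sa su).continuous
  have c1 : Continuous fun z => (1 - η z ^ 2) * tsq u z := by fun_prop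
  have c2 : Continuous fun z =>
      2 * ((η z * pullX A₁ A₂ u z) ^ 2 + (η z * pullY A₁ A₂ u z) ^ 2) := by
    fun_prop
  have c3 : Continuous fun z =>
      pullX (fun w => -b w) a u z ^ 2 + pullY (fun w => -b w) a u z ^ 2 := by
    fun_prop
  have c4 : Continuous fun z => |(|1 - a (u z) ^ 2 - b (u z) ^ 2| +
      2 * ((a (u z) - A₁ (u z)) ^ 2 + (b (u z) - A₂ (u z)) ^ 2))| * tsq u z :=
    (nN.continuous.comp su.continuous).abs.mul ct
  have c12 : Continuous fun z => (1 - η z ^ 2) * tsq u z +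
      2 * ((η z * pullX A₁ A₂ u z) ^ 2 + (η z * pullY A₁ A₂ u z) ^ 2) := c1.add c2
  have c123 : Continuous fun z => (1 - η z ^ 2) * tsq u z +
      2 * ((η z * pullX A₁ A₂ u z) ^ 2 + (η z * pullY A₁ A₂ u z) ^ 2) +
      (pullX (fun w => -b w) a u z ^ 2 + pullY (fun w => -b w) a u z ^ 2) := c12.add c3
  have i1 : ∫ z in Ω, (1 - η z ^ 2) * tsq u z ≤ C₁ := by
    rw [hd.setIntegral_eq_shell ha fun z hz hzS => by rw [hηin z hz hzS]; ring]
    refine (hd.shell_integral_mono ha c1 ct fun z _ => ?_).trans (e3.trans ?_)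
    · exact mul_le_of_le_one_left (tsq_nonneg u z) (by linarith [sq_nonneg (η z)])
    · exact mul_le_of_le_one_right hC₁ hε2
  calc ∫ z in Ω, tsq u z
      ≤ ∫ z in Ω, ((1 - η z ^ 2) * tsq u z +
        2 * ((η z * pullX A₁ A₂ u z) ^ 2 + (η z * pullY A₁ A₂ u z) ^ 2) +
        (pullX (fun w => -b w) a u z ^ 2 + pullY (fun w => -b w) a u z ^ 2) +
        |(|1 - a (u z) ^ 2 - b (u z) ^ 2| +
          2 * ((a (u z) - A₁ (u z)) ^ 2 + (b (u z) - A₂ (u z)) ^ 2))| * tsq u z) := by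
        refine hd.setIntegral_mono ct (c123.add c4) fun z _ => ?_
        have ht := tsq_nonneg u z
        have h1 : (a (u z) ^ 2 + b (u z) ^ 2) * tsq u z =
            (pullX a b u z ^ 2 + pullY a b u z ^ 2) +
            (pullX (fun w => -b w) a u z ^ 2 + pullY (fun w => -b w) a u z ^ 2) := by
          unfold pullX pullY tsq gsq; ring
        have h2 := pullX_sq_add_pullY_sq_le (fun w => a w - A₁ w) (fun w => b w - A₂ w) u z
        have h3 : pullX (fun w => a w - A₁ w) (fun w => b w - A₂ w) u z =
          pullX a b u z - pullX A₁ A₂ u z := by unfold pullX; ring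
        have h4 : pullY (fun w => a w - A₁ w) (fun w => b w - A₂ w) u z =
          pullY a b u z - pullY A₁ A₂ u z := by unfold pullY; ring
        rw [h3, h4] at h2
        have h5 : pullX a b u z ^ 2 + pullY a b u z ^ 2 ≤
            2 * (pullX A₁ A₂ u z ^ 2 + pullY A₁ A₂ u z ^ 2) +
            2 * ((a (u z) - A₁ (u z)) ^ 2 + (b (u z) - A₂ (u z)) ^ 2) * tsq u z := by
          linarith [sq_nonneg (pullX a b u z - 2 * pullX A₁ A₂ u z),
            sq_nonneg (pullY a b u z - 2 * pullY A₁ A₂ u z)]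
        have h6 : (1 - a (u z) ^ 2 - b (u z) ^ 2) * tsq u z ≤
            |1 - a (u z) ^ 2 - b (u z) ^ 2| * tsq u z :=
          mul_le_mul_of_nonneg_right (le_abs_self _) ht
        rw [abs_of_nonneg (by positivity)]
        have hη2 : η z ^ 2 ≤ 1 := pow_le_one₀ (hη0 z) (hη1 z)
        have h7 : η z ^ 2 * tsq u z ≤ η z ^ 2 *
            (2 * (pullX A₁ A₂ u z ^ 2 + pullY A₁ A₂ u z ^ 2) +
            ((pullX (fun w => -b w) a u z ^ 2 + pullY (fun w => -b w) a u z ^ 2) +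
            (|1 - a (u z) ^ 2 - b (u z) ^ 2| +
              2 * ((a (u z) - A₁ (u z)) ^ 2 + (b (u z) - A₂ (u z)) ^ 2)) * tsq u z)) :=
          mul_le_mul_of_nonneg_left (by linarith) (sq_nonneg _)
        have h8 : η z ^ 2 *
            ((pullX (fun w => -b w) a u z ^ 2 + pullY (fun w => -b w) a u z ^ 2) +
            (|1 - a (u z) ^ 2 - b (u z) ^ 2| +
              2 * ((a (u z) - A₁ (u z)) ^ 2 + (b (u z) - A₂ (u z)) ^ 2)) * tsq u z) ≤
            (pullX (fun w => -b w) a u z ^ 2 + pullY (fun w => -b w) a u z ^ 2) +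
            (|1 - a (u z) ^ 2 - b (u z) ^ 2| +
              2 * ((a (u z) - A₁ (u z)) ^ 2 + (b (u z) - A₂ (u z)) ^ 2)) * tsq u z :=
          mul_le_of_le_one_left (by positivity) hη2
        rw [mul_add] at h7
        linarith
    _ = (∫ z in Ω, (1 - η z ^ 2) * tsq u z) +
        2 * (∫ z in Ω, ((η z * pullX A₁ A₂ u z) ^ 2 + (η z * pullY A₁ A₂ u z) ^ 2)) +
        (∫ z in Ω, (pullX (fun w => -b w) a u z ^ 2 + pullY (fun w => -b w) a u z ^ 2)) +
        ∫ z in Ω, |(|1 - a (u z) ^ 2 - b (u z) ^ 2| +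
          2 * ((a (u z) - A₁ (u z)) ^ 2 + (b (u z) - A₂ (u z)) ^ 2))| * tsq u z := by
        rw [hd.integral_add c123 c4, hd.integral_add c12 c3, hd.integral_add c1 c2,
          integral_const_mul]
    _ ≤ C₁ + 2 * (C₃ * (|Real.log ε| + 1)) + C₂ + C₄ := by gcongr
    _ ≤ _ := by nlinarith [mul_nonneg hC₁ hlog, mul_nonneg hC₂ hlog, mul_nonneg hC₄ hlog]

end GLData

theorem re_lapC {u : ℂ → ℂ} (hu : ContDiff ℝ (⊤ : ℕ∞) u) (z : ℂ) :
    (lapC u z).re = lap (rp u) z := by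
  have h1 : ∀ v, ContDiff ℝ (⊤ : ℕ∞) fun y => fderiv ℝ u y v := fun v =>
    (hu.fderiv_right (m := (⊤ : ℕ∞)) (by simp)).clm_apply contDiff_const
  unfold lapC lap
  rw [Complex.add_re, fderiv_re_comp (h1 1), fderiv_re_comp (h1 Complex.I)]
  simp only [fderiv_re_comp hu]
  rfl

theorem im_lapC {u : ℂ → ℂ} (hu : ContDiff ℝ (⊤ : ℕ∞) u) (z : ℂ) :
    (lapC u z).im = lap (ip u) z := by
  have h1 : ∀ v, ContDiff ℝ (⊤ : ℕ∞) fun y => fderiv ℝ u y v := fun v =>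
    (hu.fderiv_right (m := (⊤ : ℕ∞)) (by simp)).clm_apply contDiff_const
  unfold lapC lap
  rw [Complex.add_im, fderiv_im_comp (h1 1), fderiv_im_comp (h1 Complex.I)]
  simp only [fderiv_im_comp hu]
  rfl

theorem gradSq_eq_tsq {u : ℂ → ℂ} (hu : ContDiff ℝ (⊤ : ℕ∞) u) (z : ℂ) :
    gradSq u z = tsq u z := by
  unfold gradSq tsq gsq
  rw [norm_sq_eq_re_im, norm_sq_eq_re_im, fderiv_re_comp hu, fderiv_im_comp hu, fderiv_re_comp hu,
    fderiv_im_comp hu]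
  change _ = fderiv ℝ (fun w => (u w).re) z 1 ^ 2 + fderiv ℝ (fun w => (u w).re) z Complex.I ^ 2 +
    (fderiv ℝ (fun w => (u w).im) z 1 ^ 2 + fderiv ℝ (fun w => (u w).im) z Complex.I ^ 2)
  ring

theorem SolvesGL.glSolution {W : ℂ → ℝ} {Ω : Set ℂ} {ε : ℝ} {u g : ℂ → ℂ} {γ : ℝ → ℂ}
    (hu : SolvesGL W Ω ε u) (hε : 0 < ε) (hb : ∀ s, u (γ s) = g (γ s)) :
    GLSolution W Ω γ g ε u where
  pos := hε
  smooth := hu.1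
  lap_rp z hz := by
    rw [← re_lapC hu.1, hu.2 z hz]
    rw [Complex.smul_re]; simp [gradW, dx]
  lap_ip z hz := by
    rw [← im_lapC hu.1, hu.2 z hz]
    rw [Complex.smul_im]; simp [gradW, dy]
  bdry := hb

theorem GLData.exists_energy_bound {Γ : Set ℂ} {τ : ℝ → ℂ} {W : ℂ → ℝ} {R₀ : ℝ} {Ω : Set ℂ}
    {γ : ℝ → ℂ} {L c : ℝ} {g : ℂ → ℂ} (D : GLData Γ τ W R₀ Ω γ L c g) : ∃ C : ℝ, ∀ ε u,
    GLSolution W Ω γ g ε u → energy W Ω ε u ≤ C * (|Real.log ε| + 1) := by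
  obtain ⟨C₁, hC₁, h1⟩ := D.exists_dirichlet_bound
  obtain ⟨C₂, hC₂, h2⟩ := D.exists_estimates
  refine ⟨C₁ + C₂, fun ε u hu => ?_⟩
  have hε := hu.pos
  have su := hu.smooth
  have ct : Continuous fun z => 1 / 2 * tsq u z := continuous_const.mul (contDiff_tsq su).continuous
  have cW : Continuous fun z => W (u z) / ε ^ 2 :=
    (D.pot.smooth.continuous.comp su.continuous).div_const _
  have e : energy W Ω ε u = 1 / 2 * (∫ z in Ω, tsq u z) + (∫ z in Ω, W (u z)) / ε ^ 2 := by
    unfold energy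
    simp only [gradSq_eq_tsq su]
    rw [D.dom.integral_add ct cW, integral_const_mul, integral_div]
  have hW : (∫ z in Ω, W (u z)) / ε ^ 2 ≤ C₂ :=
    (div_le_iff₀ (by positivity)).2 (h2 ε u hu).1
  have hT := h1 ε u hu
  have hlog := abs_nonneg (Real.log ε)
  rw [e]
  nlinarith [mul_nonneg hC₁ hlog, mul_nonneg hC₂ hlog]

/-- Proposition 5.6: for solutions on a smooth bounded strictly
star-shaped domain with smooth `Γ`-valued boundary datum,
`E_ε(u_ε) ≤ C(|log ε| + 1)` with `C` independent of `ε`. -/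
theorem log_energy_bound
    (Γ : Set ℂ) (τ : ℝ → ℂ) (W : ℂ → ℝ) (R₀ : ℝ)
    (hΓ : ArcParam Γ τ) (hW : PotentialHyp Γ W R₀)
    (Ω : Set ℂ) (hΩo : IsOpen Ω) (hΩb : Bornology.IsBounded Ω) (h0 : (0 : ℂ) ∈ Ω)
    (γ : ℝ → ℂ) (L : ℝ) (hγ : BoundaryParam Ω γ L)
    (nv : ℝ → ℂ) (hn : OutwardNormal Ω γ nv)
    (c : ℝ) (hc : 0 < c)
    (hstar : ∀ s, c ≤ (γ s).re * (nv s).re + (γ s).im * (nv s).im)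
    (g : ℂ → ℂ) (hg : ContDiff ℝ (⊤ : ℕ∞) g) (hgΓ : ∀ x ∈ frontier Ω, g x ∈ Γ)
    (u : ℝ → ℂ → ℂ)
    (hu : ∀ ε > (0 : ℝ), SolvesGL W Ω ε (u ε) ∧ ∀ x ∈ frontier Ω, u ε x = g x)
    :
    ∃ C : ℝ, ∀ ε > (0 : ℝ), energy W Ω ε (u ε) ≤ C * (|Real.log ε| + 1) := by
  obtain ⟨γ', hd⟩ := exists_starDomain hΩo hΩb h0 hγ hn hc hstar
  have D : GLData Γ τ W R₀ Ω γ' L c g := ⟨hΓ, hW, hd, hg, fun s => hgΓ _ (hd.mem_frontier s)⟩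
  obtain ⟨C, hC⟩ := D.exists_energy_bound
  exact ⟨C, fun ε hε => hC ε (u ε)
    ((hu ε hε).1.glSolution hε fun s => (hu ε hε).2 _ (hd.mem_frontier s))⟩
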